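/- arXiv:2212.14200 — 4 statements merged into one kernel-verified Lean document; each statement's English description precedes it below -/
import Mathlib

section
/- Let a₁,b₁,…,aₙ,bₙ be 2n points in the Euclidean plane ℝ² such that the perfect matching {a₁b₁,…,aₙbₙ} is max-sum, i.e., ∑ᵢ‖aᵢ−bᵢ‖ ≥ ∑ᵢ‖cᵢ−dᵢ‖ for every other way {c₁d₁,…,cₙdₙ} of partitioning the same 2n points (with multiplicity) into n pairs. Then there exists a point o ∈ ℝ² such that ‖aᵢ−o‖+‖bᵢ−o‖ ≤ (2/√3)·‖aᵢ−bᵢ‖ for all i = 1,…,n. -/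
open scoped BigOperators

section Fingerhut

open Real

/-- Distance between the points with polar coordinates `(r, θ)` and `(s, ψ)`. -/
noncomputable def dd (r θ s ψ : ℝ) : ℝ := √(r ^ 2 + s ^ 2 - 2 * r * s * cos (θ - ψ))

lemma dd_comm (r θ s ψ : ℝ) : dd r θ s ψ = dd s ψ r θ := by
  unfold dd
  rw [show θ - ψ = -(ψ - θ) by ring, cos_neg]
  ring_nf

lemma dd_proj {r θ s ψ : ℝ} (β γ : ℝ) (hr : 0 ≤ r) (hs : 0 ≤ s)
    (h : cos (θ - ψ) + cos (β + γ) ≤ 0) : r * cos β + s * cos γ ≤ dd r θ s ψ := by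
  unfold dd
  apply Real.le_sqrt_of_sq_le
  rw [cos_add] at h
  have h1 := mul_le_mul_of_nonneg_left h (mul_nonneg hr hs)
  nlinarith [sq_nonneg (r * sin β - s * sin γ), sin_sq_add_cos_sq β, sin_sq_add_cos_sq γ,
    congrArg (fun t => r ^ 2 * t) (sin_sq_add_cos_sq β),
    congrArg (fun t => s ^ 2 * t) (sin_sq_add_cos_sq γ)]

lemma dd_120 {r θ s ψ : ℝ} (hr : 0 ≤ r) (hs : 0 ≤ s)
    (h : cos (θ - ψ) ≤ -(1 / 2)) : √3 / 2 * (r + s) ≤ dd r θ s ψ := by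
  have := dd_proj (r := r) (s := s) (θ := θ) (ψ := ψ) (π / 6) (π / 6) hr hs (by
    rw [show π / 6 + π / 6 = π / 3 by ring, cos_pi_div_three]; linarith)
  rw [cos_pi_div_six] at this
  linarith

lemma dd_le_of_cos {r θ s ψ k t : ℝ} (hr : 0 ≤ r) (hs : 0 ≤ s) (ht : 0 ≤ t)
    (h : k ≤ cos (θ - ψ)) (h2 : r ^ 2 + s ^ 2 - 2 * r * s * k ≤ t ^ 2) : dd r θ s ψ ≤ t := by
  unfold dd
  rw [Real.sqrt_le_left ht]
  have := mul_le_mul_of_nonneg_left h (mul_nonneg hr hs)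
  nlinarith

/-- `cos x ≥ 1/2` for `|x| ≤ π/3`. -/
lemma half_le_cos {x : ℝ} (h1 : -(π / 3) ≤ x) (h2 : x ≤ π / 3) : 1 / 2 ≤ cos x := by
  rw [← cos_pi_div_three, ← cos_abs x]
  exact cos_le_cos_of_nonneg_of_le_pi (abs_nonneg _) (by linarith [pi_pos]) (abs_le.2 ⟨h1, h2⟩)

lemma cos_le_cos_abs {x y : ℝ} (h1 : -y ≤ x) (h2 : x ≤ y) (h3 : y ≤ π) : cos y ≤ cos x := by
  rw [← cos_abs x]
  exact cos_le_cos_of_nonneg_of_le_pi (abs_nonneg _) h3 (abs_le.2 ⟨h1, h2⟩)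

lemma sqrt3_bounds : 1.732 < √3 ∧ √3 < 1.7321 := by
  constructor
  · apply Real.lt_sqrt_of_sq_lt; norm_num
  · rw [Real.sqrt_lt' (by norm_num)]; norm_num

/-- the concavity step -/
lemma concav {r s τ ab : ℝ} (hs : 0 < s) (hsr : s ≤ r) (h0 : 0 ≤ τ) (h1 : τ ≤ π / 6)
    (hab : ab < √3 / 2 * (r + s)) (hab2 : ab ≤ r) :
    ab < r * cos (π / 6 - τ) + s * cos (π / 6 + τ) := by
  rw [cos_sub, cos_add, cos_pi_div_six, sin_pi_div_six]
  have hsin0 : 0 ≤ sin τ := sin_nonneg_of_nonneg_of_le_pi h0 (by linarith [pi_pos])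
  have hsin1 : sin τ ≤ 1 / 2 := by
    rw [← sin_pi_div_six]
    exact sin_le_sin_of_le_of_le_pi_div_two (by linarith [pi_pos]) (by linarith [pi_pos]) h1
  have hcos0 : 0 ≤ cos τ := cos_nonneg_of_neg_pi_div_two_le_of_le (by linarith [pi_pos]) (by linarith [pi_pos])
  obtain ⟨h3a, h3b⟩ := sqrt3_bounds
  have h33 : √3 ^ 2 = 3 := by norm_num
  set S := sin τ
  have hc : 1 - (2 - √3) * S ≤ cos τ := by
    refine le_of_sq_le_sq ?_ hcos0
    have hm := mul_nonneg (mul_nonneg hsin0 (by linarith : 0 ≤ 1 / 2 - S)) (by linarith : 0 ≤ 2 - √3)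
    have := sin_sq_add_cos_sq τ
    linear_combination 4 * hm - this + S ^ 2 * h33
  have hr : 0 < r := by linarith
  have e1 : √3 / 2 * (r + s) * (1 - (2 - √3) * S) ≤ √3 / 2 * (r + s) * cos τ :=
    mul_le_mul_of_nonneg_left hc (by positivity)
  have e2 : √3 / 2 * (r + s) * (1 - (2 - √3) * S) + 1 / 2 * (r - s) * S
      = (1 - 2 * S) * (√3 / 2 * (r + s)) + 2 * S * (r + s / 2) := by
    linear_combination (1/2 * (r+s) * S) * h33
  rcases eq_or_lt_of_le hsin1 with h | h
  · nlinarith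
  · have := mul_lt_mul_of_pos_left hab (by linarith : 0 < 1 - 2 * S)
    nlinarith


set_option maxHeartbeats 1000000 in
/-- Lemma P. -/
lemma lemP {α X Y L S r s d0 : ℝ} (ha0 : 0 ≤ α) (ha1 : α ≤ π / 3) (hX : 0 ≤ X) (hY : 0 ≤ Y)
    (hL0 : 0 ≤ L) (hL1 : L ≤ π / 3) (hS0 : 0 ≤ S) (hS1 : S ≤ π / 3) (hs : 0 < s) (hsr : s ≤ r)
    (hd0 : d0 < √3 / 2 * (X + Y)) (hab : dd r L s S < √3 / 2 * (r + s))
    (HA : dd Y (π + α) r L + dd X (π - α) s S ≤ dd r L s S + d0)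
    (HB : dd X (π - α) r L + dd Y (π + α) s S ≤ dd r L s S + d0) : False := by
  have hr : 0 < r := by linarith
  have hpi := pi_pos
  obtain ⟨h3a, h3b⟩ := sqrt3_bounds
  have h33 : √3 ^ 2 = 3 := by norm_num
  have cYL : ∀ t, cos (π + α - t) = - cos (α - t) := fun t => by
    rw [show π + α - t = (α - t) + π by ring, cos_add_pi]
  have cXL : ∀ t, cos (π - α - t) = - cos (α + t) := fun t => by
    rw [show π - α - t = π - (α + t) by ring, cos_pi_sub]
  have hab2 : dd r L s S ≤ r := dd_le_of_cos (k := 1 / 2) hr.le hs.le hr.le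
    (half_le_cos (by linarith) (by linarith)) (by nlinarith)
  have pXS : X * cos (π / 6) + s * cos (α + S - π / 6) ≤ dd X (π - α) s S :=
    dd_proj _ _ hX hs.le (by rw [cXL, show π / 6 + (α + S - π / 6) = α + S by ring]; linarith)
  have cS0 : 0 ≤ cos (α + S - π / 6) :=
    cos_nonneg_of_neg_pi_div_two_le_of_le (by linarith) (by linarith)
  rw [cos_pi_div_six] at pXS
  have hsS := mul_nonneg hs.le cS0
  rcases le_or_gt L (α + π / 6) with h1 | h1
  · rcases le_or_gt α (L + π / 6) with h2 | h2
    · have pY : Y * cos (π / 6) + r * cos 0 ≤ dd Y (π + α) r L :=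
        dd_proj _ _ hY hr.le (by
          rw [cYL, add_zero]
          linarith [cos_le_cos_abs (x := α - L) (y := π / 6) (by linarith) (by linarith)
            (by linarith)])
      rw [cos_zero, cos_pi_div_six] at pY
      nlinarith
    · -- α > L + 30
      obtain ⟨T, hT0, hT1, hTc, hTs⟩ : ∃ T, 0 < T ∧ T < π / 6 ∧ cos T = 40 / 41 ∧
          sin T = 9 / 41 := by
        refine ⟨arccos (40 / 41), arccos_pos.2 (by norm_num), ?_,
          cos_arccos (by norm_num) (by norm_num), ?_⟩
        · rw [← arccos_cos (x := π / 6) (by linarith) (by linarith), cos_pi_div_six]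
          exact strictAntiOn_arccos ⟨by linarith, by linarith⟩ ⟨by norm_num, by norm_num⟩
            (by linarith)
        · rw [sin_arccos, show (1 : ℝ) - (40 / 41) ^ 2 = (9 / 41) ^ 2 by norm_num]
          exact sqrt_sq (by norm_num)
      rcases le_or_gt T L with h3 | h3
      · have pY : Y * cos (π / 6) + r * cos (α - L - π / 6) ≤ dd Y (π + α) r L :=
          dd_proj _ _ hY hr.le (by
            rw [cYL, show π / 6 + (α - L - π / 6) = α - L by ring]; linarith)
        have e1 : cos (π / 6 - T) ≤ cos (α - L - π / 6) :=
          cos_le_cos_abs (by linarith) (by linarith) (by linarith)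
        rw [cos_sub, cos_pi_div_six, sin_pi_div_six, hTc, hTs] at e1
        rw [cos_pi_div_six] at pY
        have e2 : 0.9546 ≤ cos (α - L - π / 6) := by
          refine le_trans ?_ e1; norm_num; linarith
        have e3 := mul_le_mul_of_nonneg_left e2 hr.le
        have e4 : dd r L s S ≤ 0.9546 * r := by
          rcases le_or_gt s (0.1022 * r) with h4 | h4
          · nlinarith
          · have e5 : cos (π / 3 - T) ≤ cos (L - S) :=
              cos_le_cos_abs (by linarith) (by linarith) (by linarith)
            rw [cos_sub, cos_pi_div_three, sin_pi_div_three, hTc, hTs] at e5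
            refine dd_le_of_cos (k := 0.677) hr.le hs.le (by positivity) ?_ ?_
            · refine le_trans ?_ e5; norm_num; linarith
            · nlinarith [mul_nonneg (sub_nonneg.2 hsr) (sub_nonneg.2 h4.le), mul_pos hr hs]
        linarith
      · obtain ⟨φ, hp0, hp1, hpc, hps⟩ : ∃ φ, 0 < φ ∧ φ < π / 3 ∧ cos φ = √3 - 1 ∧
            0.681 ≤ sin φ := by
          refine ⟨arccos (√3 - 1), arccos_pos.2 (by linarith), ?_,
            cos_arccos (by linarith) (by linarith), ?_⟩
          · rw [← arccos_cos (x := π / 3) (by linarith) (by linarith), cos_pi_div_three]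
            exact strictAntiOn_arccos ⟨by linarith, by linarith⟩ ⟨by linarith, by linarith⟩
              (by linarith)
          · rw [sin_arccos]
            apply Real.le_sqrt_of_sq_le
            nlinarith
        have p1 : X * cos φ + r * cos (α + L - φ) ≤ dd X (π - α) r L :=
          dd_proj _ _ hX hr.le (by
            rw [cXL, show φ + (α + L - φ) = α + L by ring]; linarith)
        have p2 : Y * cos 0 + s * cos (α - S) ≤ dd Y (π + α) s S :=
          dd_proj _ _ hY hs.le (by rw [cYL, zero_add]; linarith)
        have p3 : X * cos 0 + s * cos (α + S) ≤ dd X (π - α) s S :=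
          dd_proj _ _ hX hs.le (by rw [cXL, zero_add]; linarith)
        have p4 : Y * cos φ + r * cos (α - L - φ) ≤ dd Y (π + α) r L :=
          dd_proj _ _ hY hr.le (by
            rw [cYL, show φ + (α - L - φ) = α - L by ring]; linarith)
        rw [cos_zero] at p2 p3
        rw [hpc] at p1 p4
        have q1 : cos (α + L - φ) + cos (α - L - φ) = 2 * (cos (α - φ) * cos L) := by
          rw [show α + L - φ = (α - φ) + L by ring, show α - L - φ = (α - φ) - L by ring,
            cos_add, cos_sub (α - φ) L]
          ring
        have q2 : cos (α + S) + cos (α - S) = 2 * (cos α * cos S) := by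
          rw [cos_add, cos_sub]; ring
        have q3 : cos (π / 3 - φ) ≤ cos (α - φ) := by
          refine cos_le_cos_abs ?_ (by linarith) (by linarith)
          have : φ ≤ π / 4 := by
            by_contra hc
            push Not at hc
            have := cos_lt_cos_of_nonneg_of_le_pi (by linarith) (by linarith) hc
            rw [cos_pi_div_four, hpc] at this
            have h2 : √2 < 1.4143 := by rw [Real.sqrt_lt' (by norm_num)]; norm_num
            linarith
          linarith
        rw [cos_sub, cos_pi_div_three, sin_pi_div_three, hpc] at q3
        have q3' : 0.9557 ≤ cos (α - φ) := by nlinarith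
        have q4 : 40 / 41 ≤ cos L := by
          rw [← hTc]; exact cos_le_cos_abs (by linarith) (by linarith) (by linarith)
        have q5 : 1 / 2 ≤ cos α := half_le_cos (by linarith) (by linarith)
        have q6 : 1 / 2 ≤ cos S := half_le_cos (by linarith) (by linarith)
        have q7 : 0.93 ≤ cos (α - φ) * cos L := by nlinarith
        have q8 : 0.25 ≤ cos α * cos S := by nlinarith
        have e3 := mul_le_mul_of_nonneg_left q7 hr.le
        have e4 := mul_le_mul_of_nonneg_left q8 hs.le
        have e5 : dd r L s S ≤ 0.93 * r + 0.25 * s := by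
          rcases le_or_gt s (0.1037 * r) with h4 | h4
          · nlinarith
          · refine dd_le_of_cos (k := 1 / 2) hr.le hs.le (by positivity)
              (half_le_cos (by linarith) (by linarith)) ?_
            linarith [mul_nonneg (sub_nonneg.2 hsr) (sub_nonneg.2 h4.le), mul_nonneg hr.le (sub_nonneg.2 h4.le), sq_nonneg r, sq_nonneg s]
        have q1' : r * cos (α + L - φ) + r * cos (α - L - φ) = 2 * (r * (cos (α - φ) * cos L)) := by
          rw [← mul_add, q1]; ring
        have q2' : s * cos (α + S) + s * cos (α - S) = 2 * (s * (cos α * cos S)) := by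
          rw [← mul_add, q2]; ring
        linarith
  · have pY : Y * cos (π / 6) + r * cos (L - α - π / 6) ≤ dd Y (π + α) r L :=
      dd_proj _ _ hY hr.le (by
        rw [cYL, show π / 6 + (L - α - π / 6) = -(α - L) by ring, cos_neg]; linarith)
    rw [cos_pi_div_six] at pY
    have hc := concav hs hsr ha0 (by linarith) hab hab2
    have e1 : cos (π / 6 - α) ≤ cos (L - α - π / 6) :=
      cos_le_cos_abs (by linarith) (by linarith) (by linarith)
    have e2 : cos (π / 6 + α) ≤ cos (α + S - π / 6) :=
      cos_le_cos_abs (by linarith) (by linarith) (by linarith)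
    have e3 := mul_le_mul_of_nonneg_left e1 hr.le
    have e4 := mul_le_mul_of_nonneg_left e2 hs.le
    linarith

lemma cos_le_neg_half {x : ℝ} (h1 : 2 * π / 3 ≤ x) (h2 : x ≤ 4 * π / 3) : cos x ≤ -(1 / 2) := by
  have := half_le_cos (x := x - π) (by linarith) (by linarith)
  rw [cos_sub_pi] at this
  linarith

lemma dd_ge {r θ s ψ : ℝ} (hr : 0 < r) (hs : 0 < s)
    (h1 : 2 * π / 3 ≤ θ - ψ) (h2 : θ - ψ ≤ 4 * π / 3) : √3 / 2 * (r + s) ≤ dd r θ s ψ :=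
  dd_120 hr.le hs.le (cos_le_neg_half h1 h2)

lemma dd_ge' {r θ s ψ : ℝ} (hr : 0 < r) (hs : 0 < s)
    (h1 : 2 * π / 3 ≤ ψ - θ) (h2 : ψ - θ ≤ 4 * π / 3) : √3 / 2 * (r + s) ≤ dd r θ s ψ := by
  rw [dd_comm, add_comm]; exact dd_ge hs hr h1 h2

lemma dd_refl1 (r θ s ψ : ℝ) : dd r (2 * π - θ) s (-ψ) = dd r θ s ψ := by
  unfold dd
  rw [show 2 * π - θ - -ψ = 2 * π - (θ - ψ) by ring, cos_two_pi_sub]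

lemma dd_refl2 (r θ s ψ : ℝ) : dd r (-θ) s (-ψ) = dd r θ s ψ := by
  unfold dd
  rw [show -θ - -ψ = - (θ - ψ) by ring, cos_neg]

set_option maxHeartbeats 1000000 in
lemma core_gamma {ι : Type*} [Finite ι] (c α r s : ι → ℝ) (z : ι)
    (hα0 : ∀ i, 0 ≤ α i) (hα1 : ∀ i, α i < π / 3) (hαz : ∀ i, α i ≤ α z)
    (hz : c z = π) (hc0 : ∀ i, -π < c i) (hc1 : ∀ i, c i ≤ π)
    (hr : ∀ i, 0 < r i) (hs : ∀ i, 0 < s i)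
    (hD : ∀ i, dd (r i) (c i - α i) (s i) (c i + α i) < √3 / 2 * (r i + s i))
    (H1 : ∀ i j, i ≠ j → dd (r i) (c i - α i) (r j) (c j - α j)
        + dd (s i) (c i + α i) (s j) (c j + α j)
      ≤ dd (r i) (c i - α i) (s i) (c i + α i) + dd (r j) (c j - α j) (s j) (c j + α j))
    (H2 : ∀ i j, i ≠ j → dd (r i) (c i - α i) (s j) (c j + α j)
        + dd (r j) (c j - α j) (s i) (c i + α i)
      ≤ dd (r i) (c i - α i) (s i) (c i + α i) + dd (r j) (c j - α j) (s j) (c j + α j))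
    (H3 : ∀ i j k, i ≠ j → j ≠ k → i ≠ k → dd (r i) (c i - α i) (s j) (c j + α j)
        + dd (r j) (c j - α j) (s k) (c k + α k) + dd (r k) (c k - α k) (s i) (c i + α i)
      ≤ dd (r i) (c i - α i) (s i) (c i + α i) + dd (r j) (c j - α j) (s j) (c j + α j)
        + dd (r k) (c k - α k) (s k) (c k + α k))
    (hω : ∀ ω : ℝ, ∃ i, cos (c i - ω) ≤ 0) : False := by
  have hpi := pi_pos
  obtain ⟨i, hi0, hi⟩ := Set.exists_min_image {k | 0 ≤ c k} c (Set.toFinite _)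
    ⟨z, by simp [hz, hpi.le]⟩
  have hi0 : 0 ≤ c i := hi0
  have hi : ∀ k, 0 ≤ c k → c i ≤ c k := hi
  have hneg : ({k | c k ≤ 0} : Set ι).Nonempty := by
    by_contra hcon
    rw [Set.not_nonempty_iff_eq_empty, Set.eq_empty_iff_forall_notMem] at hcon
    have hcon : ∀ k, 0 < c k := fun k => not_le.1 (hcon k)
    obtain ⟨k, hk⟩ := hω ((c i + π) / 2)
    have h1 := hi k (hcon k).le
    have := cos_pos_of_mem_Ioo (x := c k - (c i + π) / 2)
      ⟨by linarith [hcon i], by linarith [hc1 k, hcon i]⟩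
    linarith
  obtain ⟨j, hj0, hj⟩ := Set.exists_max_image {k | c k ≤ 0} c (Set.toFinite _) hneg
  have hj0 : c j ≤ 0 := hj0
  have hj : ∀ k, c k ≤ 0 → c k ≤ c j := hj
  have hg : c i - c j ≤ π := by
    by_contra hcon
    push Not at hcon
    obtain ⟨k, hk⟩ := hω ((c i + c j) / 2 + π)
    have := hc0 j
    have := hc0 k
    have := hc1 k
    have := hc1 i
    rcases le_total 0 (c k) with h | h
    · have h1 := hi k h
      have := cos_pos_of_mem_Ioo (x := c k - ((c i + c j) / 2 + π))
        ⟨by linarith, by linarith⟩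
      linarith
    · have h1 := hj k h
      have := cos_pos_of_mem_Ioo (x := c k - ((c i + c j) / 2 + π) + 2 * π)
        ⟨by linarith, by linarith⟩
      rw [cos_add_two_pi] at this
      linarith
  have a0 := hα0 z
  have a1 := hα1 z
  have ai0 := hα0 i
  have aj0 := hα0 j
  have aiz := hαz i
  have ajz := hαz j
  have hzj : z ≠ j := by rintro rfl; linarith
  have Dz := hD z
  have Di := hD i
  have Dj := hD j
  have rz := hr z
  have ri := hr i
  have rj := hr j
  have sz := hs z
  have si := hs i
  have sj := hs j
  have h1zj := H1 z j hzj
  have h2zj := H2 z j hzj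
  rw [hz] at Dz h1zj h2zj
  have e1 : π / 3 - α z + α j < - c j := by
    by_contra hcon
    push Not at hcon
    have q1 := dd_ge (θ := π - α z) (ψ := c j - α j) rz rj (by linarith) (by linarith)
    have q2 := dd_ge (θ := π + α z) (ψ := c j + α j) sz sj (by linarith) (by linarith)
    linarith
  have hzi : z ≠ i := by rintro rfl; linarith
  have hij : i ≠ j := by rintro rfl; linarith
  have h1zi := H1 z i hzi
  have h2zi := H2 z i hzi
  have h1ij := H1 i j hij
  have h3 := H3 z j i hzj hij.symm hzi
  rw [hz] at h1zi h2zi h3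
  have e2 : π / 3 - α z + α i < c i := by
    by_contra hcon
    push Not at hcon
    have q1 := dd_ge (θ := π - α z) (ψ := c i - α i) rz ri (by linarith) (by linarith)
    have q2 := dd_ge (θ := π + α z) (ψ := c i + α i) sz si (by linarith) (by linarith)
    linarith
  have e3 : π / 3 < c i + α i := by
    by_contra hcon
    push Not at hcon
    rcases le_total (s i) (r i) with h | h
    · refine lemP (α := α z) (X := r z) (Y := s z) (L := c i - α i) (S := c i + α i) (r := r i)
        (s := s i) a0 a1.le rz.le sz.le (by linarith) (by linarith) (by linarith) (by linarith)
        si h Dz Di ?_ ?_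
      · rw [dd_comm (s z)]; linarith
      · linarith
    · rw [dd_comm, add_comm (r i)] at Di
      rw [dd_comm (r i) (c i - α i) (s i)] at h1zi h2zi
      refine lemP (α := α z) (X := r z) (Y := s z) (L := c i + α i) (S := c i - α i) (r := s i)
        (s := r i) a0 a1.le rz.le sz.le (by linarith) (by linarith) (by linarith) (by linarith)
        ri h Dz Di ?_ ?_
      · linarith
      · rw [dd_comm (s z)]; linarith
  have e4 : π / 3 < - c j + α j := by
    by_contra hcon
    push Not at hcon
    have t1 : ∀ r s x, dd r (π - α z) s x = dd r (π + α z) s (-x) := fun r s x => by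
      rw [← dd_refl1]; congr 1; ring
    have t2 : ∀ r s x, dd r (π + α z) s x = dd r (π - α z) s (-x) := fun r s x => by
      rw [← dd_refl1]; congr 1; ring
    have k0 : dd (r z) (π - α z) (s z) (π + α z) = dd (s z) (π - α z) (r z) (π + α z) := by
      unfold dd
      rw [show π - α z - (π + α z) = -(2 * α z) by ring]
      ring_nf
    rw [dd_comm (r j) (c j - α j) (s z)] at h2zj
    rw [t1 (r z) (r j), t2 (s z) (s j), ← dd_refl2 (r j)] at h1zj
    rw [t1 (r z) (s j), t2 (s z) (r j), ← dd_refl2 (r j)] at h2zj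
    rw [← dd_refl2] at Dj
    rcases le_total (s j) (r j) with h | h
    · refine lemP (α := α z) (X := s z) (Y := r z) (L := -(c j - α j)) (S := -(c j + α j)) (r := r j)
        (s := s j) a0 a1.le sz.le rz.le (by linarith) (by linarith) (by linarith) (by linarith)
        sj h (d0 := dd (r z) (π - α z) (s z) (π + α z)) (by linarith) Dj ?_ ?_
      · linarith
      · linarith
    · rw [dd_comm, add_comm (r j)] at Dj
      rw [dd_comm (r j) (-(c j - α j)) (s j)] at h1zj h2zj
      refine lemP (α := α z) (X := s z) (Y := r z) (L := -(c j + α j)) (S := -(c j - α j)) (r := s j)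
        (s := r j) a0 a1.le sz.le rz.le (by linarith) (by linarith) (by linarith) (by linarith)
        rj h (d0 := dd (r z) (π - α z) (s z) (π + α z)) (by linarith) Dj ?_ ?_
      · linarith
      · linarith
  have sw : 2 * π / 3 ≤ c i - c j - α i + α j → 2 * π / 3 ≤ c i - c j + α i - α j → False := by
    intro k1 k2
    have q1 := dd_ge (θ := c i - α i) (ψ := c j - α j) ri rj (by linarith) (by linarith)
    have q2 := dd_ge (θ := c i + α i) (ψ := c j + α j) si sj (by linarith) (by linarith)
    linarith
  rcases lt_or_ge (π / 3 + α z) (c i - α i) with f1 | f1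
  · exact sw (by linarith) (by linarith)
  rcases lt_or_ge (π / 3 + α z) (-c j - α j) with f2 | f2
  · exact sw (by linarith) (by linarith)
  rcases lt_or_ge (4 * π / 3) (c i + α i - c j + α j) with f3 | f3
  · exact sw (by linarith) (by linarith)
  have q1 := dd_ge (θ := π - α z) (ψ := c j + α j) rz sj (by linarith) (by linarith)
  have q2 := dd_ge' (θ := c j - α j) (ψ := c i + α i) rj si (by linarith) (by linarith)
  have q3 := dd_ge' (θ := c i - α i) (ψ := π + α z) ri sz (by linarith) (by linarith)
  linarith

lemma core {ι : Type*} [Finite ι] [Nonempty ι] (c α r s : ι → ℝ)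
    (hα0 : ∀ i, 0 ≤ α i) (hα1 : ∀ i, α i < π / 3)
    (hr : ∀ i, 0 < r i) (hs : ∀ i, 0 < s i)
    (hD : ∀ i, dd (r i) (c i - α i) (s i) (c i + α i) < √3 / 2 * (r i + s i))
    (H1 : ∀ i j, i ≠ j → dd (r i) (c i - α i) (r j) (c j - α j)
        + dd (s i) (c i + α i) (s j) (c j + α j)
      ≤ dd (r i) (c i - α i) (s i) (c i + α i) + dd (r j) (c j - α j) (s j) (c j + α j))
    (H2 : ∀ i j, i ≠ j → dd (r i) (c i - α i) (s j) (c j + α j)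
        + dd (r j) (c j - α j) (s i) (c i + α i)
      ≤ dd (r i) (c i - α i) (s i) (c i + α i) + dd (r j) (c j - α j) (s j) (c j + α j))
    (H3 : ∀ i j k, i ≠ j → j ≠ k → i ≠ k → dd (r i) (c i - α i) (s j) (c j + α j)
        + dd (r j) (c j - α j) (s k) (c k + α k) + dd (r k) (c k - α k) (s i) (c i + α i)
      ≤ dd (r i) (c i - α i) (s i) (c i + α i) + dd (r j) (c j - α j) (s j) (c j + α j)
        + dd (r k) (c k - α k) (s k) (c k + α k))
    (hω : ∀ ω : ℝ, ∃ i, cos (c i - ω) ≤ 0) : False := by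
  obtain ⟨z, hz⟩ := Finite.exists_max α
  set γ : ι → ℝ := fun i => toIocMod two_pi_pos (-π) (c i - c z + π) with hγ
  set m : ι → ℤ := fun i => toIocDiv two_pi_pos (-π) (c i - c z + π) with hm
  have hcm : ∀ i, c i = γ i + (c z - π) + m i * (2 * π) := fun i => by
    have := toIocMod_add_toIocDiv_zsmul two_pi_pos (-π) (c i - c z + π)
    rw [zsmul_eq_mul] at this
    simp only [hγ, hm]
    linarith
  have hmem : ∀ i, -π < γ i ∧ γ i ≤ π := fun i => by
    have := toIocMod_mem_Ioc two_pi_pos (-π) (c i - c z + π)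
    exact ⟨this.1, by linarith [this.2]⟩
  have hγz : γ z = π := by
    simp only [hγ]
    rw [toIocMod_eq_iff two_pi_pos]
    refine ⟨⟨by linarith [pi_pos], by linarith⟩, 0, by simp⟩
  have key : ∀ i j x y u v, dd u (c i + x) v (c j + y) = dd u (γ i + x) v (γ j + y) := by
    intro i j x y u v
    unfold dd
    rw [show c i + x - (c j + y) = γ i + x - (γ j + y) + ((m i - m j : ℤ) : ℝ) * (2 * π) by
      rw [hcm i, hcm j]; push_cast; ring, cos_add_int_mul_two_pi]
  have key1 : ∀ i j x y u v, dd u (c i - x) v (c j - y) = dd u (γ i - x) v (γ j - y) := by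
    intro i j x y u v; simpa only [sub_eq_add_neg] using key i j (-x) (-y) u v
  have key2 : ∀ i j x y u v, dd u (c i - x) v (c j + y) = dd u (γ i - x) v (γ j + y) := by
    intro i j x y u v; simpa only [sub_eq_add_neg] using key i j (-x) y u v
  simp only [key, key1, key2] at hD H1 H2 H3
  refine core_gamma γ α r s z hα0 hα1 hz hγz (fun i => (hmem i).1) (fun i => (hmem i).2) hr hs
    hD H1 H2 H3 ?_
  intro ω
  obtain ⟨i, hi⟩ := hω (ω + (c z - π))
  refine ⟨i, ?_⟩
  rwa [show c i - (ω + (c z - π)) = γ i - ω + (m i) * (2 * π) by linarith [hcm i],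
    cos_add_int_mul_two_pi] at hi

/-- unit vector with given angle -/
noncomputable def eU (θ : ℝ) : EuclideanSpace ℝ (Fin 2) := !₂[cos θ, sin θ]

lemma norm_eU_sub (r θ s ψ : ℝ) : ‖r • eU θ - s • eU ψ‖ = dd r θ s ψ := by
  rw [EuclideanSpace.norm_eq, Fin.sum_univ_two]
  unfold dd
  congr 1
  simp only [eU, PiLp.sub_apply, PiLp.smul_apply, smul_eq_mul, Real.norm_eq_abs, sq_abs]
  simp
  rw [cos_sub]
  linear_combination r ^ 2 * (sin_sq_add_cos_sq θ) + s ^ 2 * (sin_sq_add_cos_sq ψ)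

lemma exists_polar (p : EuclideanSpace ℝ (Fin 2)) : ∃ θ, p = ‖p‖ • eU θ := by
  have hn : ‖(⟨p 0, p 1⟩ : ℂ)‖ = ‖p‖ := by
    rw [EuclideanSpace.norm_eq, Fin.sum_univ_two, Complex.norm_eq_sqrt_sq_add_sq]
    simp
  refine ⟨Complex.arg ⟨p 0, p 1⟩, ?_⟩
  have h1 := Complex.norm_mul_cos_arg ⟨p 0, p 1⟩
  have h2 := Complex.norm_mul_sin_arg ⟨p 0, p 1⟩
  rw [hn] at h1 h2
  ext i
  fin_cases i
  · simp [eU, h1]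
  · simp [eU, h2]

lemma eU_add_int (θ : ℝ) (m : ℤ) : eU (θ + m * (2 * π)) = eU θ := by
  simp [eU, cos_add_int_mul_two_pi, sin_add_int_mul_two_pi]

lemma pair_polar (p q : EuclideanSpace ℝ (Fin 2))
    (h : ‖p - q‖ < √3 / 2 * (‖p‖ + ‖q‖)) :
    ∃ p' q' : EuclideanSpace ℝ (Fin 2), ∃ c α : ℝ,
      ((p' = p ∧ q' = q) ∨ (p' = q ∧ q' = p)) ∧ 0 ≤ α ∧ α < π / 3 ∧
      p' = ‖p'‖ • eU (c - α) ∧ q' = ‖q'‖ • eU (c + α) := by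
  obtain ⟨θ, hθ⟩ := exists_polar p
  obtain ⟨ψ, hψ⟩ := exists_polar q
  set δ := toIocMod two_pi_pos (-π) (ψ - θ) with hδ
  have e := toIocMod_add_toIocDiv_zsmul two_pi_pos (-π) (ψ - θ)
  rw [zsmul_eq_mul, ← hδ] at e
  have hmem := toIocMod_mem_Ioc two_pi_pos (-π) (ψ - θ)
  rw [← hδ] at hmem
  have hψ' : q = ‖q‖ • eU (θ + δ) := by
    rw [← eU_add_int (θ + δ) (toIocDiv two_pi_pos (-π) (ψ - θ)), add_assoc, e,
      add_sub_cancel]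
    exact hψ
  have hdd : ‖p - q‖ = dd ‖p‖ θ ‖q‖ (θ + δ) := by
    rw [← norm_eU_sub, ← hθ, ← hψ']
  have hcos : -(1 / 2) < cos δ := by
    by_contra hcon
    push Not at hcon
    have := dd_120 (θ := θ) (ψ := θ + δ) (norm_nonneg p) (norm_nonneg q)
      (by rw [show θ - (θ + δ) = -δ by ring, cos_neg]; exact hcon)
    linarith
  have hpi := pi_pos
  rcases le_total 0 δ with h0 | h0
  · refine ⟨p, q, θ + δ / 2, δ / 2, Or.inl ⟨rfl, rfl⟩, by linarith, ?_, ?_, ?_⟩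
    · by_contra hcon
      push Not at hcon
      have := cos_le_neg_half (x := δ) (by linarith) (by linarith [hmem.2])
      linarith
    · rw [add_sub_cancel_right]; exact hθ
    · rw [add_assoc, add_halves]; exact hψ'
  · refine ⟨q, p, θ + δ / 2, -(δ / 2), Or.inr ⟨rfl, rfl⟩, by linarith, ?_, ?_, ?_⟩
    · by_contra hcon
      push Not at hcon
      have := cos_le_neg_half (x := -δ) (by linarith) (by linarith [hmem.1])
      rw [cos_neg] at this
      linarith
    · rw [sub_neg_eq_add, add_assoc, add_halves]; exact hψ'
    · rw [add_neg_cancel_right]; exact hθ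

/-- the max-sum property -/
def MaxSum (n : ℕ) (a b : Fin n → EuclideanSpace ℝ (Fin 2)) : Prop :=
  ∀ σ : Equiv.Perm (Fin n ⊕ Fin n),
      ∑ i : Fin n, ‖Sum.elim a b (σ (Sum.inl i)) - Sum.elim a b (σ (Sum.inr i))‖
        ≤ ∑ i : Fin n, ‖a i - b i‖

lemma MaxSum.flip {n : ℕ} {a b a' b' : Fin n → EuclideanSpace ℝ (Fin 2)} (h : MaxSum n a b)
    (hf : ∀ i, (a' i = a i ∧ b' i = b i) ∨ (a' i = b i ∧ b' i = a i)) : MaxSum n a' b' := by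
  classical
  let g : Fin n ⊕ Fin n → Fin n ⊕ Fin n := fun x => match x with
    | Sum.inl i => if a' i = a i ∧ b' i = b i then Sum.inl i else Sum.inr i
    | Sum.inr i => if a' i = a i ∧ b' i = b i then Sum.inr i else Sum.inl i
  have hg : Function.Involutive g := by
    rintro (i | i)
    · by_cases hi : a' i = a i ∧ b' i = b i <;> simp [g, hi]
    · by_cases hi : a' i = a i ∧ b' i = b i <;> simp [g, hi]
  have hel : ∀ x, Sum.elim a' b' x = Sum.elim a b (g x) := by
    rintro (i | i)
    · by_cases hi : a' i = a i ∧ b' i = b i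
      · simp [g, hi]
      · simp only [g, if_neg hi]; simpa using ((hf i).resolve_left hi).1
    · by_cases hi : a' i = a i ∧ b' i = b i
      · simp [g, hi]
      · simp only [g, if_neg hi]; simpa using ((hf i).resolve_left hi).2
  have hsum : ∑ i : Fin n, ‖a' i - b' i‖ = ∑ i : Fin n, ‖a i - b i‖ := by
    refine Finset.sum_congr rfl fun i _ => ?_
    rcases hf i with ⟨h1, h2⟩ | ⟨h1, h2⟩
    · rw [h1, h2]
    · rw [h1, h2, norm_sub_rev]
  intro σ
  rw [hsum]
  have := h (σ.trans hg.toPerm)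
  simpa [hel] using this

lemma MaxSum.perm {n : ℕ} {a b : Fin n → EuclideanSpace ℝ (Fin 2)} (h : MaxSum n a b)
    (τ : Equiv.Perm (Fin n)) : 0 ≤ ∑ i : Fin n, (‖a i - b i‖ - ‖a i - b (τ i)‖) := by
  have := h (Equiv.sumCongr (Equiv.refl _) τ)
  rw [Finset.sum_sub_distrib]
  simpa using this

lemma MaxSum.H2 {n : ℕ} {a b : Fin n → EuclideanSpace ℝ (Fin 2)} (h : MaxSum n a b)
    {i j : Fin n} (hij : i ≠ j) :
    ‖a i - b j‖ + ‖a j - b i‖ ≤ ‖a i - b i‖ + ‖a j - b j‖ := by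
  have h0 := h.perm (Equiv.swap i j)
  rw [← Finset.sum_subset (Finset.subset_univ {i, j}) (by
    intro x _ hx
    simp only [Finset.mem_insert, Finset.mem_singleton, not_or] at hx
    rw [Equiv.swap_apply_of_ne_of_ne hx.1 hx.2, sub_self]), Finset.sum_pair hij,
    Equiv.swap_apply_left, Equiv.swap_apply_right] at h0
  linarith

lemma MaxSum.H3 {n : ℕ} {a b : Fin n → EuclideanSpace ℝ (Fin 2)} (h : MaxSum n a b)
    {i j k : Fin n} (hij : i ≠ j) (hjk : j ≠ k) (hik : i ≠ k) :
    ‖a i - b j‖ + ‖a j - b k‖ + ‖a k - b i‖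
      ≤ ‖a i - b i‖ + ‖a j - b j‖ + ‖a k - b k‖ := by
  have h0 := h.perm (Equiv.swap i j * Equiv.swap j k)
  rw [← Finset.sum_subset (Finset.subset_univ {i, j, k}) (by
    intro x _ hx
    simp only [Finset.mem_insert, Finset.mem_singleton, not_or] at hx
    rw [Equiv.Perm.mul_apply, Equiv.swap_apply_of_ne_of_ne hx.2.1 hx.2.2,
      Equiv.swap_apply_of_ne_of_ne hx.1 hx.2.1, sub_self]),
    Finset.sum_insert (by simp [hij, hik]), Finset.sum_pair hjk,
    Equiv.Perm.mul_apply, Equiv.Perm.mul_apply, Equiv.Perm.mul_apply,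
    Equiv.swap_apply_left, Equiv.swap_apply_right,
    Equiv.swap_apply_of_ne_of_ne hij hik, Equiv.swap_apply_left,
    Equiv.swap_apply_of_ne_of_ne hik.symm hjk.symm, Equiv.swap_apply_right] at h0
  linarith

lemma MaxSum.H1 {n : ℕ} {a b : Fin n → EuclideanSpace ℝ (Fin 2)} (h : MaxSum n a b)
    {i j : Fin n} (hij : i ≠ j) :
    ‖a i - a j‖ + ‖b i - b j‖ ≤ ‖a i - b i‖ + ‖a j - b j‖ := by
  classical
  have hM : MaxSum n (Function.update a j (b j)) (Function.update b j (a j)) := by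
    refine h.flip fun k => ?_
    by_cases hk : k = j
    · subst hk; right; simp
    · left; simp [hk]
  have := hM.H2 hij
  simp only [Function.update_self, Function.update_of_ne hij] at this
  rw [norm_sub_rev (b j) (b i), norm_sub_rev (b j) (a j)] at this
  exact this

lemma dd_small {r θ t ω : ℝ} (hr : 0 < r) :
    dd r θ t ω ≤ r - t * cos (θ - ω) + t ^ 2 / (2 * r) := by
  set C := cos (θ - ω) with hC
  have hC1 := neg_one_le_cos (θ - ω)
  have hC2 := cos_le_one (θ - ω)
  rw [← hC] at hC1 hC2
  have key : r - t * C + t ^ 2 / (2 * r) = (2 * r ^ 2 - 2 * r * t * C + t ^ 2) / (2 * r) := by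
    field_simp
  unfold dd
  rw [← hC]
  apply Real.sqrt_le_iff.2
  have hX : r ^ 2 + t ^ 2 - 2 * r * t * C = r ^ 2 + 2 * r * (-(t * C) + t ^ 2 / (2 * r)) := by
    field_simp; ring
  constructor
  · rw [key]
    apply div_nonneg _ (by positivity)
    nlinarith [sq_nonneg (r - t * C), sq_nonneg r, mul_nonneg (sq_nonneg t) (by nlinarith : 0 ≤ 1 - C ^ 2)]
  · rw [hX]
    nlinarith [sq_nonneg (-(t * C) + t ^ 2 / (2 * r))]

open Filter Topology

set_option maxHeartbeats 1000000 in
lemma main_aux (n : ℕ) (a b : Fin n → EuclideanSpace ℝ (Fin 2)) (hmax : MaxSum n a b) :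
    ∃ o : EuclideanSpace ℝ (Fin 2),
      ∀ i : Fin n, ‖a i - o‖ + ‖b i - o‖ ≤ (2 / Real.sqrt 3) * ‖a i - b i‖ := by
  classical
  rcases isEmpty_or_nonempty (Fin n) with he | hne
  · exact ⟨0, fun i => (he.false i).elim⟩
  set f : Fin n → EuclideanSpace ℝ (Fin 2) → ℝ := fun i x =>
    ‖a i - x‖ + ‖b i - x‖ - (2 / √3) * ‖a i - b i‖ with hf
  have hfc : ∀ i, Continuous (f i) := fun i => by simp only [hf]; fun_prop
  set m : EuclideanSpace ℝ (Fin 2) → ℝ := fun x =>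
    Finset.univ.sup' Finset.univ_nonempty (fun i => f i x) with hm
  have hmc : Continuous m := Continuous.finset_sup'_apply _ fun i _ => hfc i
  have hle : ∀ i x, f i x ≤ m x := fun i x =>
    Finset.le_sup' (fun i => f i x) (Finset.mem_univ i)
  have hatt : ∀ x, ∃ i, m x = f i x := fun x => by
    obtain ⟨i, -, hi⟩ := Finset.exists_mem_eq_sup' Finset.univ_nonempty (fun i => f i x)
    exact ⟨i, hi⟩
  have hco : Tendsto m (cocompact _) atTop := by
    obtain ⟨i⟩ := hne
    have h1 : Tendsto (fun x : EuclideanSpace ℝ (Fin 2) =>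
        ‖x‖ + (-‖a i‖ - (2 / √3) * ‖a i - b i‖)) (cocompact _) atTop :=
      tendsto_atTop_add_const_right _ _ tendsto_norm_cocompact_atTop
    refine tendsto_atTop_mono (fun x => ?_) h1
    refine le_trans ?_ (hle i x)
    simp only [hf]
    have := norm_sub_norm_le x (a i)
    rw [norm_sub_rev] at this
    linarith [norm_nonneg (b i - x)]
  obtain ⟨o, ho⟩ := hmc.exists_forall_le hco
  refine ⟨o, ?_⟩
  by_contra hcon
  have hpos : 0 < m o := by
    push Not at hcon
    obtain ⟨i, hi⟩ := hcon
    refine lt_of_lt_of_le ?_ (hle i o)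
    simp only [hf]; linarith
  obtain ⟨h3a, h3b⟩ := sqrt3_bounds
  have h33 : √3 * √3 = 3 := by norm_num
  have hk1 : 1 ≤ 2 / √3 := by rw [le_div_iff₀ (by positivity)]; linarith
  -- active pairs
  have hact : ∀ i, f i o = m o → 0 < ‖a i - o‖ ∧ 0 < ‖b i - o‖ ∧
      ‖a i - b i‖ < √3 / 2 * (‖a i - o‖ + ‖b i - o‖) := by
    intro i hi
    have h0 : 2 / √3 * ‖a i - b i‖ < ‖a i - o‖ + ‖b i - o‖ := by
      rw [← hi] at hpos; simp only [hf] at hpos; linarith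
    have h1 : ‖a i - b i‖ ≤ 2 / √3 * ‖a i - b i‖ := le_mul_of_one_le_left (norm_nonneg _) hk1
    refine ⟨?_, ?_, ?_⟩
    · rw [norm_pos_iff]
      intro hz
      have : a i = o := sub_eq_zero.1 hz
      rw [hz, norm_zero, ← this, norm_sub_rev (b i)] at h0
      linarith
    · rw [norm_pos_iff]
      intro hz
      have : b i = o := sub_eq_zero.1 hz
      rw [hz, norm_zero, ← this] at h0
      linarith
    · have h2 := mul_lt_mul_of_pos_left h0 (by positivity : 0 < √3 / 2)
      have h4 : √3 / 2 * (2 / √3 * ‖a i - b i‖) = ‖a i - b i‖ := by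
        field_simp
      linarith
  have hex : ∀ i, ∃ a' b' : EuclideanSpace ℝ (Fin 2), ∃ c α : ℝ,
      ((a' = a i ∧ b' = b i) ∨ (a' = b i ∧ b' = a i)) ∧ (f i o = m o → 0 ≤ α ∧ α < π / 3 ∧
      a' - o = ‖a' - o‖ • eU (c - α) ∧ b' - o = ‖b' - o‖ • eU (c + α)) := by
    intro i
    by_cases hi : f i o = m o
    · obtain ⟨-, -, h3⟩ := hact i hi
      obtain ⟨p, q, c, α, h1, h2, h4, h5, h6⟩ := pair_polar (a i - o) (b i - o)
        (by rwa [sub_sub_sub_cancel_right])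
      refine ⟨p + o, q + o, c, α, ?_, fun _ => ⟨h2, h4, ?_, ?_⟩⟩
      · rcases h1 with ⟨h1, h1'⟩ | ⟨h1, h1'⟩
        · left; rw [h1, h1']; simp
        · right; rw [h1, h1']; simp
      · rw [add_sub_cancel_right]; exact h5
      · rw [add_sub_cancel_right]; exact h6
    · exact ⟨a i, b i, 0, 0, Or.inl ⟨rfl, rfl⟩, fun h => absurd h hi⟩
  choose a' b' c α hfl hpol using hex
  have hM := hmax.flip hfl
  have hf' : ∀ i x, f i x = ‖a' i - x‖ + ‖b' i - x‖ - (2 / √3) * ‖a' i - b' i‖ := by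
    intro i x
    simp only [hf]
    rcases hfl i with ⟨h1, h2⟩ | ⟨h1, h2⟩
    · rw [h1, h2]
    · rw [h1, h2, norm_sub_rev (b i) (a i)]; ring
  have hact' : ∀ i, f i o = m o → 0 < ‖a' i - o‖ ∧ 0 < ‖b' i - o‖ ∧
      ‖a' i - b' i‖ < √3 / 2 * (‖a' i - o‖ + ‖b' i - o‖) := by
    intro i hi
    obtain ⟨h1, h2, h3⟩ := hact i hi
    rcases hfl i with ⟨g1, g2⟩ | ⟨g1, g2⟩
    · rw [g1, g2]; exact ⟨h1, h2, h3⟩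
    · rw [g1, g2, norm_sub_rev (b i) (a i), add_comm]; exact ⟨h2, h1, h3⟩
  let ι := {i : Fin n // f i o = m o}
  have : Nonempty ι := by
    obtain ⟨i, hi⟩ := hatt o
    exact ⟨⟨i, hi.symm⟩⟩
  have daa : ∀ i j : ι, dd ‖a' i - o‖ (c i - α i) ‖a' j - o‖ (c j - α j) = ‖a' i - a' j‖ := by
    intro i j
    rw [← norm_eU_sub, ← (hpol i i.2).2.2.1, ← (hpol j j.2).2.2.1, sub_sub_sub_cancel_right]
  have dab : ∀ i j : ι, dd ‖a' i - o‖ (c i - α i) ‖b' j - o‖ (c j + α j) = ‖a' i - b' j‖ := by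
    intro i j
    rw [← norm_eU_sub, ← (hpol i i.2).2.2.1, ← (hpol j j.2).2.2.2, sub_sub_sub_cancel_right]
  have dbb : ∀ i j : ι, dd ‖b' i - o‖ (c i + α i) ‖b' j - o‖ (c j + α j) = ‖b' i - b' j‖ := by
    intro i j
    rw [← norm_eU_sub, ← (hpol i i.2).2.2.2, ← (hpol j j.2).2.2.2, sub_sub_sub_cancel_right]
  have hneι : ∀ {i j : ι}, i ≠ j → (i : Fin n) ≠ j := fun h h' => h (Subtype.ext h')
  refine core (ι := ι) (fun i => c i) (fun i => α i) (fun i => ‖a' i - o‖) (fun i => ‖b' i - o‖)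
    (fun i => (hpol i i.2).1) (fun i => (hpol i i.2).2.1) (fun i => (hact' i i.2).1)
    (fun i => (hact' i i.2).2.1) ?_ ?_ ?_ ?_ ?_
  · intro i
    simp only [dab]
    exact (hact' i i.2).2.2
  · intro i j hij
    simp only [daa, dab, dbb]
    exact hM.H1 (hneι hij)
  · intro i j hij
    simp only [dab]
    exact hM.H2 (hneι hij)
  · intro i j k hij hjk hik
    simp only [dab]
    exact hM.H3 (hneι hij) (hneι hjk) (hneι hik)
  · intro ω
    by_contra hω
    push Not at hω
    have hev : ∀ i, ∀ᶠ t in 𝓝[>] (0 : ℝ), f i (o + t • eU ω) < m o := by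
      intro i
      by_cases hi : f i o = m o
      · have hci : 0 < cos (c i - ω) := hω ⟨i, hi⟩
        obtain ⟨q1, q2, q3, q4⟩ := hpol i hi
        obtain ⟨r1, r2, -⟩ := hact' i hi
        have hαp : 0 < cos (α i) := by
          have := half_le_cos (x := α i) (by linarith [pi_pos]) q2.le
          linarith
        have hP : 0 < 2 * (cos (α i) * cos (c i - ω)) := by positivity
        set K := 1 / (2 * ‖a' i - o‖) + 1 / (2 * ‖b' i - o‖) with hK
        have hlim : Tendsto (fun t : ℝ => t * K) (𝓝[>] 0) (𝓝 0) := by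
          have : Tendsto (fun t : ℝ => t * K) (𝓝 0) (𝓝 (0 * K)) :=
            (continuous_id.mul continuous_const).tendsto 0
          rw [zero_mul] at this
          exact this.mono_left nhdsWithin_le_nhds
        filter_upwards [hlim.eventually (gt_mem_nhds hP), self_mem_nhdsWithin] with t ht ht0
        have ht0 : 0 < t := ht0
        rw [← hi, hf', hf']
        have w1 : ‖a' i - (o + t • eU ω)‖ = dd ‖a' i - o‖ (c i - α i) t ω := by
          rw [← norm_eU_sub, ← q3, sub_sub]
        have w2 : ‖b' i - (o + t • eU ω)‖ = dd ‖b' i - o‖ (c i + α i) t ω := by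
          rw [← norm_eU_sub, ← q4, sub_sub]
        have w3 := dd_small (θ := c i - α i) (t := t) (ω := ω) r1
        have w4 := dd_small (θ := c i + α i) (t := t) (ω := ω) r2
        have w5 : cos (c i - α i - ω) + cos (c i + α i - ω) = 2 * (cos (α i) * cos (c i - ω)) := by
          rw [show c i - α i - ω = (c i - ω) - α i by ring,
            show c i + α i - ω = (c i - ω) + α i by ring, cos_add, cos_sub (c i - ω)]
          ring
        have w6 : t ^ 2 / (2 * ‖a' i - o‖) + t ^ 2 / (2 * ‖b' i - o‖) = t * (t * K) := by
          rw [hK]; ring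
        have w7 := mul_lt_mul_of_pos_left ht ht0
        rw [← w5] at w7
        rw [w1, w2]
        linarith
      · have hlt : f i o < m o := lt_of_le_of_ne (hle i o) hi
        have hcont : Tendsto (fun t : ℝ => f i (o + t • eU ω)) (𝓝 0) (𝓝 (f i (o + (0 : ℝ) • eU ω))) := by
          have : Continuous (fun t : ℝ => f i (o + t • eU ω)) := (hfc i).comp (by fun_prop)
          exact this.tendsto 0
        rw [zero_smul, add_zero] at hcont
        exact (hcont.mono_left nhdsWithin_le_nhds).eventually (gt_mem_nhds hlt)
    obtain ⟨t, ht⟩ := (eventually_all.2 hev).exists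
    obtain ⟨i, hi⟩ := hatt (o + t • eU ω)
    have := ho (o + t • eU ω)
    linarith [ht i]

end Fingerhut

/-- If the matching {a_i b_i} is max-sum (every re-pairing of the same
2n points, encoded by a permutation of the 2n point slots, has cost at most that of
the given matching), then there is a point `o` with
`‖a_i - o‖ + ‖b_i - o‖ ≤ (2/√3) ‖a_i - b_i‖` for all `i`. -/
theorem fingerhut_conjecture (n : ℕ) (a b : Fin n → EuclideanSpace ℝ (Fin 2))
    (hmax : ∀ σ : Equiv.Perm (Fin n ⊕ Fin n),
      ∑ i : Fin n, ‖Sum.elim a b (σ (Sum.inl i)) - Sum.elim a b (σ (Sum.inr i))‖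
        ≤ ∑ i : Fin n, ‖a i - b i‖) :
    ∃ o : EuclideanSpace ℝ (Fin 2),
      ∀ i : Fin n, ‖a i - o‖ + ‖b i - o‖ ≤ (2 / Real.sqrt 3) * ‖a i - b i‖ := by
  exact main_aux n a b hmax
end

section
/- Let a₁,b₁,…,aₙ,bₙ be 2n points in the Euclidean plane ℝ² such that the perfect matching {a₁b₁,…,aₙbₙ} is max-sum. Then the intersection ⋂ᵢ E(aᵢbᵢ) of the elliptical regions E(aᵢbᵢ) over all edges of the matching is nonempty. -/
open scoped BigOperators

abbrev Pl := EuclideanSpace ℝ (Fin 2)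

lemma exists_dual_perm {V : Type} [Fintype V] [DecidableEq V] (w : V → V → ℝ)
    (hw0 : ∀ u v, 0 ≤ w u v) (hsymm : ∀ u v, w u v = w v u) :
    ∃ r : V → ℝ, (∀ v, 0 ≤ r v) ∧ (∀ u v, w u v ≤ r u + r v) ∧
      ∃ π : Equiv.Perm V, ∀ v, w v (π v) = r v + r (π v) := by
  classical
  set C : ℝ := ∑ u, ∑ v, w u v with hC
  have hC0 : 0 ≤ C := Finset.sum_nonneg fun u _ => Finset.sum_nonneg fun v _ => hw0 u v
  have hwC : ∀ u v, w u v ≤ C := fun u v =>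
    (Finset.single_le_sum (f := fun v => w u v) (fun v _ => hw0 u v) (Finset.mem_univ v)).trans
      (Finset.single_le_sum (f := fun u => ∑ v, w u v)
        (fun u _ => Finset.sum_nonneg fun v _ => hw0 u v) (Finset.mem_univ u))
  let K : Set (V → ℝ) := Set.Icc (fun _ => 0) (fun _ => C) ∩ {r | ∀ u v, w u v ≤ r u + r v}
  have hKc : IsCompact K := by
    apply isCompact_Icc.inter_right
    simp only [Set.ofPred_forall]
    refine isClosed_iInter fun u => isClosed_iInter fun v => isClosed_le (by fun_prop) (by fun_prop)
  have hKne : K.Nonempty := ⟨fun _ => C, ⟨fun _ => hC0, fun _ => le_rfl⟩,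
    fun u v => by have := hwC u v; simp only; linarith⟩
  obtain ⟨r, hrK, hrmin⟩ := hKc.exists_isMinOn hKne
    (f := fun r : V → ℝ => ∑ v, r v) (by fun_prop)
  have hr0 : ∀ v, 0 ≤ r v := fun v => hrK.1.1 v
  have hr : ∀ u v, w u v ≤ r u + r v := hrK.2
  refine ⟨r, hr0, hr, ?_⟩
  have hall := (Fintype.all_card_le_filter_rel_iff_exists_injective
    (fun u v => w u v = r u + r v)).1 ?_
  · obtain ⟨f, hf, hf2⟩ := hall
    exact ⟨Equiv.ofBijective f (Finite.injective_iff_bijective.1 hf), hf2⟩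
  intro S
  by_contra hlt
  push Not at hlt
  set N : Finset V := {b | ∃ a ∈ S, w a b = r a + r b} with hN
  have hev : ∀ᶠ ε in nhdsWithin (0:ℝ) (Set.Ioi 0), ∀ u v, w u v ≠ r u + r v →
      2 * ε ≤ r u + r v - w u v := by
    rw [Filter.eventually_all]; intro u
    rw [Filter.eventually_all]; intro v
    by_cases h : w u v = r u + r v
    · simp [h]
    · have hpos : 0 < (r u + r v - w u v) / 2 := by
        have := lt_of_le_of_ne (hr u v) h; linarith
      filter_upwards [Ioo_mem_nhdsGT hpos] with ε hε _
      have := hε.2; linarith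
  obtain ⟨ε, hε, hε0⟩ := (hev.and self_mem_nhdsWithin).exists
  have hε0 : 0 < ε := hε0
  let d : V → ℝ := fun v => (if v ∈ N then ε else 0) - (if v ∈ S then ε else 0)
  have hd : ∀ v, -ε ≤ d v := fun v => by
    simp only [d]; split_ifs <;> linarith
  have hfeas : ∀ u v, w u v ≤ (r u + d u) + (r v + d v) := by
    intro u v
    by_cases h : w u v = r u + r v
    · have h1 : u ∈ S → v ∈ N := fun hu => by
        simp only [hN, Finset.mem_filter, Finset.mem_univ, true_and]
        exact ⟨u, hu, h⟩
      have h2 : v ∈ S → u ∈ N := fun hv => by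
        simp only [hN, Finset.mem_filter, Finset.mem_univ, true_and]
        exact ⟨v, hv, by rw [hsymm, h, add_comm]⟩
      have : 0 ≤ d u + d v := by
        simp only [d]
        split_ifs <;> first | linarith | (exfalso; tauto)
      linarith
    · have := hε u v h
      have := hd u; have := hd v; linarith
  have hr'0 : ∀ v, 0 ≤ r v + d v := fun v => by
    have := hfeas v v; have := hw0 v v; linarith
  have hsum : ∑ v, (r v + d v) < ∑ v, r v := by
    rw [Finset.sum_add_distrib]
    have : ∑ v, d v = ε * ((N.card : ℝ) - S.card) := by
      simp only [d, Finset.sum_sub_distrib, Finset.sum_ite_mem, Finset.univ_inter,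
        Finset.sum_const, nsmul_eq_mul]
      ring
    have h3 : (N.card : ℝ) < S.card := by exact_mod_cast hlt
    rw [this]; nlinarith
  -- truncate at C
  have hmem : (fun v => min (r v + d v) C) ∈ K := by
    refine ⟨⟨fun v => le_min (hr'0 v) hC0, fun v => min_le_right _ _⟩, fun u v => ?_⟩
    have h1 := hfeas u v
    have h2 := hwC u v
    have h3 := hr'0 u
    have h4 := hr'0 v
    simp only
    rcases min_cases (r u + d u) C with h | h <;> rcases min_cases (r v + d v) C with h' | h' <;>
      linarith
  have := hrmin hmem
  simp only [Set.mem_ofPred_eq] at this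
  have h5 : ∑ v, min (r v + d v) C ≤ ∑ v, (r v + d v) :=
    Finset.sum_le_sum fun v _ => min_le_left _ _
  linarith

lemma jung_zero {ι : Type*} [Fintype ι] (z : ι → Pl) (w : ι → ℝ) (c : ℝ) (hc : -1/2 < c)
    (hc1 : c ≤ 1)
    (hcard : Fintype.card ι ≤ 3) (hz : ∀ i, ‖z i‖ = 1) (hzc : ∀ i j, c ≤ inner ℝ (z i) (z j))
    (hw : ∀ i, 0 < w i) (hw1 : ∑ i, w i = 1) (h0 : ∑ i, w i • z i = 0) : False := by
  classical
  have h1 : (0:ℝ) = ∑ i, ∑ j, w i * w j * inner ℝ (z i) (z j) := by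
    have : (0:ℝ) = inner ℝ (∑ i, w i • z i) (∑ i, w i • z i) := by rw [h0]; simp
    rw [this]
    rw [sum_inner]
    refine Finset.sum_congr rfl fun i _ => ?_
    rw [inner_sum]
    refine Finset.sum_congr rfl fun j _ => ?_
    rw [inner_smul_left, inner_smul_right, conj_trivial]; ring
  have h2 : ∑ i, ∑ j, w i * w j * (c + if i = j then 1 - c else 0) ≤
      ∑ i, ∑ j, w i * w j * inner ℝ (z i) (z j) := by
    refine Finset.sum_le_sum fun i _ => Finset.sum_le_sum fun j _ => ?_
    refine mul_le_mul_of_nonneg_left ?_ (mul_nonneg (hw i).le (hw j).le)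
    split_ifs with h
    · subst h; rw [real_inner_self_eq_norm_sq, hz]; norm_num
    · simpa using hzc i j
  have h3 : ∑ i, ∑ j, w i * w j * (c + if i = j then 1 - c else 0)
      = c + (1 - c) * ∑ i, w i ^ 2 := by
    have e1 : ∑ i, ∑ j, w i * w j * (c + if i = j then 1 - c else 0)
       = ∑ i, (w i * c * ∑ j, w j + w i ^ 2 * (1 - c)) := by
      refine Finset.sum_congr rfl fun i _ => ?_
      simp only [mul_add, Finset.sum_add_distrib, mul_ite, mul_zero, Finset.sum_ite_eq,
        Finset.mem_univ, if_true]
      congr 1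
      · rw [Finset.mul_sum]; refine Finset.sum_congr rfl fun j _ => by ring
      · ring
    rw [e1, hw1, Finset.sum_add_distrib, ← Finset.sum_mul, ← Finset.sum_mul, ← Finset.sum_mul,
      hw1]
    ring
  have h4 : (1:ℝ) ≤ 3 * ∑ i, w i ^ 2 := by
    have := sq_sum_le_card_mul_sum_sq (s := (Finset.univ : Finset ι)) (f := w)
    rw [hw1, Finset.card_univ] at this
    have h5 : (Fintype.card ι : ℝ) ≤ 3 := by exact_mod_cast hcard
    have h6 : 0 ≤ ∑ i, w i ^ 2 := Finset.sum_nonneg fun i _ => sq_nonneg _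
    nlinarith
  nlinarith

lemma jung_discs {V : Type} [Fintype V] (p : V → Pl) (r : V → ℝ) (hr : ∀ v, 0 < r v)
    (h : ∀ u v, ‖p u - p v‖ ≤ r u + r v) :
    ∃ o : Pl, ∀ v, ‖p v - o‖ ≤ 2 / Real.sqrt 3 * r v := by
  classical
  rcases isEmpty_or_nonempty V with hV | hV
  · exact ⟨0, fun v => hV.elim v⟩
  let f : Pl → ℝ := fun o => Finset.univ.sup' Finset.univ_nonempty (fun v => ‖p v - o‖ / r v)
  have hfc : Continuous f := by
    apply Continuous.finset_sup'_apply
    intro v _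
    fun_prop
  have hfle : ∀ o v, ‖p v - o‖ / r v ≤ f o := fun o v =>
    Finset.le_sup' (fun v => ‖p v - o‖ / r v) (Finset.mem_univ v)
  have hft : Filter.Tendsto f (Filter.cocompact Pl) Filter.atTop := by
    obtain ⟨v0⟩ := hV
    apply Filter.tendsto_atTop_mono (fun o => hfle o v0)
    apply Filter.Tendsto.atTop_div_const (hr v0)
    have h1 : Filter.Tendsto (fun o : Pl => ‖o‖ - ‖p v0‖) (Filter.cocompact Pl) Filter.atTop :=
      Filter.tendsto_atTop_add_const_right _ _ (tendsto_norm_cocompact_atTop)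
    refine Filter.tendsto_atTop_mono (fun o => ?_) h1
    rw [norm_sub_rev]; exact norm_sub_norm_le _ _
  obtain ⟨o, ho⟩ := hfc.exists_forall_le hft
  refine ⟨o, ?_⟩
  by_contra hcon
  push Not at hcon
  obtain ⟨v1, hv1⟩ := hcon
  set L := f o with hL
  have hs3 : 0 < Real.sqrt 3 := by positivity
  have hLgt : 2 / Real.sqrt 3 < L := by
    refine lt_of_lt_of_le ?_ (hfle o v1)
    rwa [lt_div_iff₀ (hr v1)]
  have hL0 : 0 < L := lt_trans (by positivity) hLgt
  have hL2 : 4 / 3 < L ^ 2 := by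
    have : (2 / Real.sqrt 3) ^ 2 < L ^ 2 := by gcongr
    rw [div_pow, Real.sq_sqrt (by norm_num)] at this
    norm_num at this ⊢; exact this
  have hle : ∀ v, ‖p v - o‖ ≤ L * r v := fun v => by
    have := hfle o v; rwa [div_le_iff₀ (hr v)] at this
  let e : V → Pl := fun v => (L * r v)⁻¹ • (p v - o)
  let S : Set V := {v | ‖p v - o‖ = L * r v}
  have hLr : ∀ v, 0 < L * r v := fun v => mul_pos hL0 (hr v)
  have hpe : ∀ v, p v - o = (L * r v) • e v := fun v => by
    simp only [e]; rw [smul_smul, mul_inv_cancel₀ (hLr v).ne', one_smul]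
  have he1 : ∀ v ∈ S, ‖e v‖ = 1 := fun v hv => by
    have hv : ‖p v - o‖ = L * r v := hv
    simp only [e]; rw [norm_smul, hv, Real.norm_eq_abs, abs_of_pos (inv_pos.2 (hLr v)),
      inv_mul_cancel₀ (hLr v).ne']
  have h0 : (0:Pl) ∈ convexHull ℝ (e '' S) := by
    by_contra h0
    have hfin : (e '' S).Finite := Set.toFinite _
    obtain ⟨g, u, hg0, hg⟩ := geometric_hahn_banach_point_closed (convex_convexHull ℝ _)
      (hfin.isClosed_convexHull (𝕜 := ℝ)) h0
    rw [map_zero] at hg0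
    obtain ⟨k, hk⟩ : ∃ k : Pl, ∀ x, g x = inner ℝ k x :=
      ⟨(InnerProductSpace.toDual ℝ Pl).symm g, fun x => by simp⟩
    have hkS : ∀ v ∈ S, 0 < inner ℝ k (p v - o) := fun v hv => by
      rw [hpe, inner_smul_right]
      refine mul_pos (hLr v) ?_
      rw [← hk]
      exact hg0.trans (hg _ (subset_convexHull ℝ _ ⟨v, hv, rfl⟩))
    have hev : ∀ᶠ t in nhdsWithin (0:ℝ) (Set.Ioi 0), ∀ v, ‖p v - (o + t • k)‖ < L * r v := by
      rw [Filter.eventually_all]; intro v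
      by_cases hv : v ∈ S
      · have hv' : ‖p v - o‖ = L * r v := hv
        have hpos := hkS v hv
        have hpos2 : 0 < inner ℝ k (p v - o) / (‖k‖ ^ 2 + 1) := by positivity
        filter_upwards [Ioo_mem_nhdsGT hpos2] with t ht
        have ht1 := ht.1
        have ht2 := ht.2
        rw [lt_div_iff₀ (by positivity)] at ht2
        refine lt_of_pow_lt_pow_left₀ 2 (hLr v).le ?_
        rw [← hv', ← sub_sub, norm_sub_sq_real, inner_smul_right, norm_smul, mul_pow,
          Real.norm_eq_abs, sq_abs, real_inner_comm]
        nlinarith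
      · have hlt : ‖p v - o‖ < L * r v := lt_of_le_of_ne (hle v) hv
        have hcont : Continuous fun t : ℝ => ‖p v - (o + t • k)‖ := by fun_prop
        have : ∀ᶠ t in nhds (0:ℝ), ‖p v - (o + t • k)‖ < L * r v :=
          hcont.continuousAt.eventually_lt continuousAt_const (by simpa using hlt)
        exact this.filter_mono nhdsWithin_le_nhds
    obtain ⟨t, ht⟩ := hev.exists
    have h7 : f (o + t • k) < L := by
      simp only [f]
      rw [Finset.sup'_lt_iff]
      intro v _
      rw [div_lt_iff₀ (hr v)]; exact ht v
    exact absurd (ho (o + t • k)) (not_le.2 h7)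
  obtain ⟨ι, hι, z, w, hzS, haff, hw, hw1, hsum⟩ := eq_pos_convex_span_of_mem_convexHull h0
  have hcard : Fintype.card ι ≤ 3 := by
    have := haff.card_le_finrank_succ
    have h2 : Module.finrank ℝ (vectorSpan ℝ (Set.range z)) ≤ Module.finrank ℝ Pl :=
      Submodule.finrank_le _
    rw [finrank_euclideanSpace_fin] at h2
    omega
  refine jung_zero z w (1 - 2 / L ^ 2) ?_ ?_ hcard ?_ ?_ hw hw1 hsum
  · have : 2 / L ^ 2 < 3 / 2 := by rw [div_lt_iff₀ (by positivity)]; linarith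
    linarith
  · have : 0 ≤ 2 / L ^ 2 := by positivity
    linarith
  · intro i
    obtain ⟨v, hv, hvz⟩ := hzS ⟨i, rfl⟩
    rw [← hvz]; exact he1 v hv
  · intro i j
    obtain ⟨u, hu, huz⟩ := hzS ⟨i, rfl⟩
    obtain ⟨v, hv, hvz⟩ := hzS ⟨j, rfl⟩
    rw [← huz, ← hvz]
    have hn := h u v
    have e1 : p u - p v = (L * r u) • e u - (L * r v) • e v := by rw [← hpe, ← hpe]; abel
    have hn2 : ‖p u - p v‖ ^ 2 ≤ (r u + r v) ^ 2 := by gcongr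
    rw [e1, norm_sub_sq_real, norm_smul (L * r u) (e u), norm_smul (L * r v) (e v), he1 u hu, he1 v hv, inner_smul_left,
      inner_smul_right, Real.norm_eq_abs, Real.norm_eq_abs, abs_of_pos (hLr u),
      abs_of_pos (hLr v)] at hn2
    simp only [conj_trivial, mul_one] at hn2
    have hru := hr u
    have hrv := hr v
    set x := inner ℝ (e u) (e v)
    have key : 0 ≤ (r u * r v) * (L ^ 2 * x - L ^ 2 + 2) := by
      nlinarith [mul_nonneg (sub_nonneg.2 (show (1:ℝ) ≤ L ^ 2 by linarith)) (sq_nonneg (r u - r v))]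
    have key2 : 0 ≤ L ^ 2 * x - L ^ 2 + 2 := nonneg_of_mul_nonneg_right key (mul_pos hru hrv)
    have : 1 - 2 / L ^ 2 = (L ^ 2 - 2) / L ^ 2 := by field_simp
    rw [this, div_le_iff₀ (by positivity)]
    linarith
lemma cross_ineq {a b c d x : Pl} (h1 : x ∈ segment ℝ a b) (h2 : x ∈ segment ℝ c d) :
    ‖a - c‖ + ‖b - d‖ ≤ ‖a - b‖ + ‖c - d‖ := by
  have e1 := dist_add_dist_of_mem_segment h1
  have e2 := dist_add_dist_of_mem_segment h2
  have t1 := dist_triangle a x c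
  have t2 := dist_triangle b x d
  rw [dist_comm b x] at t2
  rw [dist_comm x c] at t1
  simp only [← dist_eq_norm]
  linarith

/-- the median of three reals -/
def med3 (x y z : ℝ) : ℝ := max (min x y) (min (max x y) z)

lemma med3_neg (x y z : ℝ) : med3 (-x) (-y) (-z) = - med3 x y z := by
  unfold med3
  rcases le_total x y with h1 | h1 <;> rcases le_total y z with h2 | h2 <;>
    rcases le_total x z with h3 | h3 <;> simp [h1, h2, h3] <;> grind

lemma med3_eq_zero {x y z : ℝ} (h : med3 x y z = 0) :
    (x = 0 ∧ y ≤ 0 ∧ 0 ≤ z) ∨ (x = 0 ∧ z ≤ 0 ∧ 0 ≤ y) ∨ (y = 0 ∧ x ≤ 0 ∧ 0 ≤ z) ∨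
    (y = 0 ∧ z ≤ 0 ∧ 0 ≤ x) ∨ (z = 0 ∧ x ≤ 0 ∧ 0 ≤ y) ∨ (z = 0 ∧ y ≤ 0 ∧ 0 ≤ x) := by
  unfold med3 at h
  rcases le_total x y with h1 | h1 <;> rcases le_total y z with h2 | h2 <;>
    rcases le_total x z with h3 | h3 <;>
    simp only [h1, h2, h3, min_eq_left, min_eq_right, max_eq_left, max_eq_right] at h <;>
    subst h <;> simp [*]

lemma med3_ivt (x y : Fin 3 → ℝ)
    (h : 0 ≤ med3 (x 0) (x 1) (x 2) ∧ 0 ≤ med3 (y 0) (y 1) (y 2) ∨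
      med3 (x 0) (x 1) (x 2) ≤ 0 ∧ med3 (y 0) (y 1) (y 2) ≤ 0) :
    ∃ s : ℝ, 0 ≤ s ∧ s ≤ 1 ∧ ∃ i k : Fin 3, i ≠ k ∧ s * x i - (1 - s) * y i ≤ 0 ∧
      0 ≤ s * x k - (1 - s) * y k ∧ ∀ l, l ≠ i → l ≠ k → s * x l - (1 - s) * y l = 0 := by
  let g : Fin 3 → ℝ → ℝ := fun i s => s * x i - (1 - s) * y i
  let f : ℝ → ℝ := fun s => med3 (g 0 s) (g 1 s) (g 2 s)
  have hf : Continuous f := by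
    unfold f g med3; fun_prop
  have f1 : f 1 = med3 (x 0) (x 1) (x 2) := by simp [f, g]
  have f0 : f 0 = - med3 (y 0) (y 1) (y 2) := by simp [f, g, med3_neg]
  have hz : ∃ s ∈ Set.Icc (0:ℝ) 1, f s = 0 := by
    rcases h with h | h
    · have := intermediate_value_Icc (zero_le_one (α := ℝ)) hf.continuousOn
      exact this ⟨by rw [f0]; linarith, by rw [f1]; linarith⟩
    · have := intermediate_value_Icc' (zero_le_one (α := ℝ)) hf.continuousOn
      exact this ⟨by rw [f1]; linarith, by rw [f0]; linarith⟩
  obtain ⟨s, ⟨hs0, hs1⟩, hs⟩ := hz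
  refine ⟨s, hs0, hs1, ?_⟩
  rcases med3_eq_zero hs with h | h | h | h | h | h
  · exact ⟨1, 2, by decide, h.2.1, h.2.2, fun l => by fin_cases l <;> simp; exact h.1⟩
  · exact ⟨2, 1, by decide, h.2.1, h.2.2, fun l => by fin_cases l <;> simp; exact h.1⟩
  · exact ⟨0, 2, by decide, h.2.1, h.2.2, fun l => by fin_cases l <;> simp; exact h.1⟩
  · exact ⟨2, 0, by decide, h.2.1, h.2.2, fun l => by fin_cases l <;> simp; exact h.1⟩
  · exact ⟨0, 1, by decide, h.2.1, h.2.2, fun l => by fin_cases l <;> simp; exact h.1⟩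
  · exact ⟨1, 0, by decide, h.2.1, h.2.2, fun l => by fin_cases l <;> simp; exact h.1⟩

/-- A straight-line drawing of `K_{3,3}` has two independent edges that meet. -/
lemma k33_cross (A D : Fin 3 → Pl) (hA : AffineIndependent ℝ A) :
    ∃ i k j l : Fin 3, i ≠ k ∧ j ≠ l ∧
      (segment ℝ (A i) (D j) ∩ segment ℝ (A k) (D l)).Nonempty := by
  let b : AffineBasis (Fin 3) ℝ Pl := ⟨A, hA, by
    rw [hA.affineSpan_eq_top_iff_card_eq_finrank_add_one]; simp⟩
  let x : Fin 3 → Fin 3 → ℝ := fun j i => b.coord i (D j)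
  have hx1 : ∀ j, ∑ i, x j i = 1 := fun j => b.sum_coord_apply_eq_one (D j)
  have hxD : ∀ j, ∑ i, x j i • A i = D j := fun j => b.linear_combination_coord_eq_self (D j)
  let m : Fin 3 → ℝ := fun j => med3 (x j 0) (x j 1) (x j 2)
  have hpig : ∃ j l, j ≠ l ∧ (0 ≤ m j ∧ 0 ≤ m l ∨ m j ≤ 0 ∧ m l ≤ 0) := by
    rcases le_total 0 (m 0) with h0 | h0 <;> rcases le_total 0 (m 1) with h1 | h1 <;>
      rcases le_total 0 (m 2) with h2 | h2
    · exact ⟨0, 1, by decide, Or.inl ⟨h0, h1⟩⟩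
    · exact ⟨0, 1, by decide, Or.inl ⟨h0, h1⟩⟩
    · exact ⟨0, 2, by decide, Or.inl ⟨h0, h2⟩⟩
    · exact ⟨1, 2, by decide, Or.inr ⟨h1, h2⟩⟩
    · exact ⟨1, 2, by decide, Or.inl ⟨h1, h2⟩⟩
    · exact ⟨0, 2, by decide, Or.inr ⟨h0, h2⟩⟩
    · exact ⟨0, 1, by decide, Or.inr ⟨h0, h1⟩⟩
    · exact ⟨0, 1, by decide, Or.inr ⟨h0, h1⟩⟩
  obtain ⟨j, l, hjl, hm⟩ := hpig
  obtain ⟨s, hs0, hs1, i, k, hik, hi, hk, hz⟩ := med3_ivt (x j) (x l) hm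
  refine ⟨i, k, j, l, hik, hjl, ?_⟩
  set c : Fin 3 → ℝ := fun i => s * x j i - (1 - s) * x l i with hc
  have hcsum : c i + c k = s - (1 - s) := by
    have : ∑ i, c i = s - (1 - s) := by
      simp only [hc, Finset.sum_sub_distrib, ← Finset.mul_sum, hx1, mul_one]
    rw [← this]
    symm
    rw [← Finset.sum_pair hik]
    symm
    refine Finset.sum_subset (Finset.subset_univ _) fun q _ hq => ?_
    simp only [Finset.mem_insert, Finset.mem_singleton, not_or] at hq
    exact hz q hq.1 hq.2
  have hcvec : c i • A i + c k • A k = s • D j - (1 - s) • D l := by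
    have : ∑ i, c i • A i = s • D j - (1 - s) • D l := by
      simp only [hc, sub_smul (s * _), mul_smul, Finset.sum_sub_distrib, ← Finset.smul_sum, hxD]
    rw [← this, ← Finset.sum_pair (f := fun i => c i • A i) hik]
    refine Finset.sum_subset (Finset.subset_univ _) fun q _ hq => ?_
    simp only [Finset.mem_insert, Finset.mem_singleton, not_or] at hq
    have : c q = 0 := hz q hq.1 hq.2
    rw [this, zero_smul]
  have hi' : c i ≤ 0 := hi
  have hk' : 0 ≤ c k := hk
  set W := s - c i with hW
  have hW2 : W = (1 - s) + c k := by linarith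
  have hW0 : 0 < W := by
    rcases eq_or_lt_of_le hs0 with h | h
    · rw [hW2, ← h]; linarith
    · linarith
  refine ⟨(-c i / W) • A i + (s / W) • D j, ⟨-c i / W, s / W, div_nonneg (by linarith) hW0.le,
    div_nonneg hs0 hW0.le, by field_simp; linarith, rfl⟩, ⟨c k / W, (1 - s) / W,
    div_nonneg hk' hW0.le, div_nonneg (by linarith) hW0.le, by field_simp; linarith, ?_⟩⟩
  have e : c k • A k + (1 - s) • D l = (-c i) • A i + s • D j := by
    rw [neg_smul, ← sub_eq_zero, ← sub_eq_zero.2 hcvec]; abel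
  have := congrArg (fun v => W⁻¹ • v) e
  simp only [smul_add, smul_smul] at this
  simpa only [div_eq_inv_mul] using this

lemma cross_tight (A D : Fin 3 → Pl) (ρ σ : Fin 3 → ℝ)
    (hA : ∀ i j, i ≠ j → ‖A i - A j‖ = ρ i + ρ j)
    (hD : ∀ i j, i ≠ j → ‖D i - D j‖ = σ i + σ j) :
    ∃ i j, ρ i + σ j ≤ ‖A i - D j‖ := by
  by_contra hcon
  push Not at hcon
  by_cases haff : AffineIndependent ℝ A
  · obtain ⟨i, k, j, l, hik, hjl, x, hx1, hx2⟩ := k33_cross A D haff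
    have := cross_ineq hx1 hx2
    rw [hA i k hik, hD j l hjl] at this
    have := hcon i j
    have := hcon k l
    linarith
  · have hz : ∃ i, ρ i = 0 := by
      rw [← collinear_iff_not_affineIndependent] at haff
      have hr : Set.range A = {A 0, A 1, A 2} := by
        ext y; simp [Fin.exists_fin_succ, eq_comm]
      rw [hr] at haff
      have h01 := hA 0 1 (by decide)
      have h12 := hA 1 2 (by decide)
      have h02 := hA 0 2 (by decide)
      have h10 := hA 1 0 (by decide)
      have h21 := hA 2 1 (by decide)
      have h20 := hA 2 0 (by decide)
      rcases haff.wbtw_or_wbtw_or_wbtw with h | h | h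
      · have := h.dist_add_dist
        simp only [dist_eq_norm] at this
        exact ⟨1, by linarith⟩
      · have := h.dist_add_dist
        simp only [dist_eq_norm] at this
        exact ⟨2, by linarith⟩
      · have := h.dist_add_dist
        simp only [dist_eq_norm] at this
        exact ⟨0, by linarith⟩
    obtain ⟨i, hi⟩ := hz
    have h0 := hcon i 0
    have h1 := hcon i 1
    have h2 := hD 0 1 (by decide)
    have h3 := norm_sub_le_norm_sub_add_norm_sub (D 0) (A i) (D 1)
    rw [norm_sub_rev (D 0) (A i)] at h3
    linarith
lemma matching_of_even {V : Type} [Fintype V] [DecidableEq V] (π : Equiv.Perm V)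
    (h : ∀ v : V, Even (MulAction.period π v)) :
    ∃ τ : V → V, Function.Involutive τ ∧ ∀ v, τ v = π v ∨ π (τ v) = v := by
  classical
  let rep : V → V := fun v => (Quotient.mk (Equiv.Perm.SameCycle.setoid π) v).out
  have hrep : ∀ v, π.SameCycle (rep v) v := fun v =>
    Quotient.exact (Quotient.out_eq (Quotient.mk (Equiv.Perm.SameCycle.setoid π) v))
  have hrepπ : ∀ v, rep (π v) = rep v := fun v => by
    simp only [rep]
    congr 1
    apply Quotient.sound
    exact (Equiv.Perm.sameCycle_apply_left.2 (Equiv.Perm.SameCycle.refl _ _))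
  choose k hk using hrep
  have hpar : ∀ v, (Even (k (π v)) ↔ ¬ Even (k v)) := by
    intro v
    have h1 := hk (π v)
    rw [hrepπ] at h1
    have h2 : (π ^ (k v + 1)) (rep v) = π v := by
      rw [add_comm, zpow_add, Equiv.Perm.mul_apply, hk, zpow_one]
    have h3 : (π ^ (k (π v) - (k v + 1))) • (rep v) = rep v := by
      rw [sub_eq_neg_add, zpow_add, mul_smul, Equiv.Perm.smul_def, Equiv.Perm.smul_def, h1, ← h2,
        zpow_neg]
      simp
    rw [MulAction.zpow_smul_eq_iff_period_dvd] at h3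
    have h4 : (2:ℤ) ∣ k (π v) - (k v + 1) := by
      refine dvd_trans ?_ h3
      exact_mod_cast (h (rep v)).two_dvd
    rw [Int.even_iff, Int.even_iff]
    omega
  refine ⟨fun v => if Even (k v) then π v else π⁻¹ v, ?_, ?_⟩
  · intro v
    by_cases hv : Even (k v)
    · have := (hpar v).not.2 (by simpa using hv)
      simp [hv, this]
    · have h5 := hpar (π⁻¹ v)
      have h5' : π (π⁻¹ v) = v := by simp
      rw [h5'] at h5
      have h6 : Even (k (π⁻¹ v)) := by tauto
      simp only [hv, h6, if_true, if_false]
      simp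
  · intro v
    by_cases hv : Even (k v) <;> simp [hv]

set_option maxHeartbeats 2000000 in
lemma matching_or_triangles {V : Type} [Fintype V] [DecidableEq V] (π : Equiv.Perm V)
    (hfix : ∀ v, π v ≠ v) (hcard : Fintype.card V ≤ 6) (heven : Even (Fintype.card V)) :
    (∃ τ : V → V, Function.Involutive τ ∧ ∀ v, τ v = π v ∨ π (τ v) = v) ∨
    (∃ v x : V, π (π (π v)) = v ∧ π (π (π x)) = x ∧
      [v, π v, π (π v), x, π x, π (π x)].Nodup ∧
      ∀ y, y ∈ [v, π v, π (π v), x, π x, π (π x)]) := by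
  classical
  by_cases h : ∀ v : V, Even (MulAction.period π v)
  · exact Or.inl (matching_of_even π h)
  right
  push Not at h
  obtain ⟨v, hv⟩ := h
  have hinj : ∀ a b, π a = π b ↔ a = b := fun a b => π.injective.eq_iff
  have hper : ∀ n : ℕ, (π ^ n) v = v ↔ MulAction.period π v ∣ n := fun n =>
    MulAction.pow_smul_eq_iff_period_dvd (α := V) (M := Equiv.Perm V)
  have p1 := hper 1
  have p2 := hper 2
  have p3 := hper 3
  have p4 := hper 4
  have p5 := hper 5
  simp only [pow_succ, pow_zero, one_mul, Equiv.Perm.mul_apply] at p1 p2 p3 p4 p5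
  set p := MulAction.period π v with hp
  rw [Nat.not_even_iff_odd] at hv
  have n1 : π v ≠ v := hfix v
  have hp1 : p ≠ 1 := fun h => n1 (p1.2 (by rw [h]))
  have hp2 : ¬ p ∣ 2 := fun h => by
    rcases (Nat.dvd_prime Nat.prime_two).1 h with h | h
    · exact hp1 h
    · rw [h] at hv; exact absurd hv (by decide)
  have hp4 : ¬ p ∣ 4 := fun h => by
    have h5 : p ≤ 4 := Nat.le_of_dvd (by norm_num) h
    interval_cases p <;> simp_all (config := { decide := true })
  have n2 : π (π v) ≠ v := fun h => hp2 (p2.1 h)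
  have n4 : π (π (π (π v))) ≠ v := fun h => hp4 (p4.1 h)
  have hlist : ∀ l : List V, l.Nodup → l.length ≤ Fintype.card V := fun l hl => hl.length_le_card
  have hall : ∀ l : List V, l.Nodup → l.length = Fintype.card V → ∀ y, y ∈ l := by
    intro l hl hlc y
    have h1 : l.toFinset = Finset.univ := by
      rw [← Finset.card_eq_iff_eq_univ, List.toFinset_card_of_nodup hl, hlc]
    have := Finset.mem_univ y
    rw [← h1] at this
    simpa using this
  have hex : ∀ l : List V, l.length < Fintype.card V → ∃ y, y ∉ l := by
    intro l hl
    by_contra hcon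
    push Not at hcon
    have h1 : l.toFinset = Finset.univ := by ext y; simp [hcon y]
    have h2 := List.toFinset_card_le l
    rw [h1, Finset.card_univ] at h2
    omega
  by_cases h3 : π (π (π v)) = v
  · have hl3 : [v, π v, π (π v)].Nodup := by
      simp [hinj, n1.symm, n2.symm]
    have h3c := hlist _ hl3
    simp only [List.length_cons, List.length_nil] at h3c
    have : 3 < Fintype.card V := lt_of_le_of_ne h3c (fun h => by
      rw [← h] at heven; exact absurd heven (by decide))
    obtain ⟨x, hx⟩ := hex [v, π v, π (π v)] (by simpa using this)
    simp only [List.mem_cons, List.not_mem_nil, or_false, not_or] at hx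
    obtain ⟨x1, x2, x3⟩ := hx
    have y1 : π x ≠ v := fun h => x3 ((hinj _ _).1 (by rw [h, h3]))
    have y2 : π x ≠ π v := fun h => x1 ((hinj _ _).1 h)
    have y3 : π x ≠ π (π v) := fun h => x2 ((hinj _ _).1 h)
    have z1 : π (π x) ≠ v := fun h => y3 ((hinj _ _).1 (by rw [h, h3]))
    have z2 : π (π x) ≠ π v := fun h => y1 ((hinj _ _).1 h)
    have z3 : π (π x) ≠ π (π v) := fun h => y2 ((hinj _ _).1 h)
    have w0 := hfix x
    have hl5 : [v, π v, π (π v), x, π x].Nodup := by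
      simp only [List.nodup_cons, List.mem_cons, List.not_mem_nil, or_false, not_or,
        List.nodup_nil, not_false_eq_true, and_true, hinj]
      grind
    have h5c := hlist _ hl5
    simp only [List.length_cons, List.length_nil] at h5c
    have hc6 : Fintype.card V = 6 := by
      rcases heven with ⟨q, hq⟩; omega
    have w2 : π (π x) ≠ x := by
      intro hw
      obtain ⟨y, hy⟩ := hex [v, π v, π (π v), x, π x] (by simp [hc6])
      have hl6 : [v, π v, π (π v), x, π x, y].Nodup := by
        simp only [List.nodup_cons, List.mem_cons, List.not_mem_nil, or_false, not_or,
          List.nodup_nil, not_false_eq_true, and_true] at hl5 hy ⊢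
        grind
      have hπy := hall _ hl6 (by simp [hc6]) (π y)
      have := hfix y
      simp only [List.mem_cons, List.not_mem_nil, or_false, not_or] at hπy hy
      have i1 := hinj y v
      have i2 := hinj y (π v)
      have i3 := hinj y (π (π v))
      have i4 := hinj y x
      have i5 := hinj y (π x)
      rw [h3] at i3
      rw [hw] at i5
      obtain ⟨y1, y2, y3, y4, y5⟩ := hy
      rcases hπy with g | g | g | g | g | g
      · exact y3 (i3.1 g)
      · exact y1 (i1.1 g)
      · exact y2 (i2.1 g)
      · exact y5 (i5.1 g)
      · exact y4 (i4.1 g)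
      · exact this g
    have hl6 : [v, π v, π (π v), x, π x, π (π x)].Nodup := by
      simp only [List.nodup_cons, List.mem_cons, List.not_mem_nil, or_false, not_or,
        List.nodup_nil, not_false_eq_true, and_true, hinj] at hl5 ⊢
      grind
    have hmem := hall _ hl6 (by simp [hc6])
    refine ⟨v, x, h3, ?_, hl6, hmem⟩
    have := hmem (π (π (π x)))
    simp only [List.mem_cons, List.not_mem_nil, or_false, hinj] at this
    have j1 : π (π (π x)) ≠ v := fun h => z3 ((hinj _ _).1 (by rw [h, h3]))
    rcases this with g | g | g | g | g | g
    · exact absurd g j1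
    · exact absurd g z1
    · exact absurd g y1
    · exact g
    · exact absurd g w2
    · exact absurd g w0
  · exfalso
    have hl5 : [v, π v, π (π v), π (π (π v)), π (π (π (π v)))].Nodup := by
      simp only [List.nodup_cons, List.mem_cons, List.not_mem_nil, or_false, not_or,
        List.nodup_nil, not_false_eq_true, and_true, hinj]
      grind
    have h5c := hlist _ hl5
    simp only [List.length_cons, List.length_nil] at h5c
    have hc6 : Fintype.card V = 6 := by
      rcases heven with ⟨q, hq⟩; omega
    have h5 : π (π (π (π (π v)))) = v := by
      by_contra h5
      have hp6 : ¬ p ∣ 5 := fun h => h5 (p5.2 h)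
      have hp3 : ¬ p ∣ 3 := fun h => h3 (p3.2 h)
      have hl6 : [v, π v, π (π v), π (π (π v)), π (π (π (π v))), π (π (π (π (π v))))].Nodup := by
        simp only [List.nodup_cons, List.mem_cons, List.not_mem_nil, or_false, not_or,
          List.nodup_nil, not_false_eq_true, and_true, hinj]
        grind
      have := hall _ hl6 (by simp [hc6]) (π (π (π (π (π (π v))))))
      have p6 := hper 6
      simp only [pow_succ, pow_zero, one_mul, Equiv.Perm.mul_apply] at p6
      simp only [List.mem_cons, List.not_mem_nil, or_false, hinj] at this
      have h6 : p ∣ 6 := by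
        rw [← p6]; tauto
      have : p ≤ 6 := Nat.le_of_dvd (by norm_num) h6
      interval_cases p <;> simp_all (config := { decide := true })
    obtain ⟨y, hy⟩ := hex _ (by simp [hc6] : [v, π v, π (π v), π (π (π v)), π (π (π (π v)))].length < _)
    have hl6 : [v, π v, π (π v), π (π (π v)), π (π (π (π v))), y].Nodup := by
      simp only [List.nodup_cons, List.mem_cons, List.not_mem_nil, or_false, not_or,
        List.nodup_nil, not_false_eq_true, and_true] at hl5 hy ⊢
      grind
    have hπy := hall _ hl6 (by simp [hc6]) (π y)
    have := hfix y
    simp only [List.mem_cons, List.not_mem_nil, or_false, not_or] at hπy hy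
    have i1 := hinj y v
    have i2 := hinj y (π v)
    have i3 := hinj y (π (π v))
    have i4 := hinj y (π (π (π v)))
    have i5 := hinj y (π (π (π (π v))))
    rw [h5] at i5
    obtain ⟨y1, y2, y3, y4, y5⟩ := hy
    rcases hπy with g | g | g | g | g | g
    · exact y5 (i5.1 g)
    · exact y1 (i1.1 g)
    · exact y2 (i2.1 g)
    · exact y3 (i3.1 g)
    · exact y4 (i4.1 g)
    · exact this g

lemma conj_of_involutive {J : Type} [Fintype J] [DecidableEq J] (τ : J ⊕ J → J ⊕ J)
    (hτ : Function.Involutive τ) (hfix : ∀ v, τ v ≠ v) :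
    ∃ σ : Equiv.Perm (J ⊕ J), ∀ i, τ (σ (Sum.inl i)) = σ (Sum.inr i) := by
  classical
  have hct : ∀ t : Equiv.Perm (J ⊕ J), t ^ 2 = 1 → (∀ v, t v ≠ v) →
      t.cycleType = Multiset.replicate (Fintype.card J) 2 := by
    intro t ht hf
    have : Fact (Nat.Prime 2) := ⟨Nat.prime_two⟩
    have h1 := Equiv.Perm.cycleType_of_pow_prime_eq_one ht
    have h2 := t.sum_cycleType
    have h3 : t.support = Finset.univ := by ext v; simp [hf v]
    rw [h3, Finset.card_univ, Fintype.card_sum, h1, Multiset.sum_replicate] at h2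
    rw [h1]
    congr 1
    simp at h2
    omega
  have hc : IsConj (Equiv.sumComm J J : Equiv.Perm (J ⊕ J)) (Function.Involutive.toPerm τ hτ) := by
    rw [Equiv.Perm.isConj_iff_cycleType_eq, hct _ _ _, hct _ _ _]
    · ext v; simp [pow_two, hτ v]
    · intro v; simpa using hfix v
    · ext v; simp [pow_two]
    · rintro (v | v) <;> simp
  obtain ⟨σ, hσ⟩ := isConj_iff.1 hc
  refine ⟨σ, fun i => ?_⟩
  have : (Function.Involutive.toPerm τ hτ) (σ (Sum.inl i)) = σ (Sum.inr i) := by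
    rw [← hσ]; simp
  simpa using this

lemma exists_dual_deranged {V : Type} [Fintype V] [DecidableEq V] [Nontrivial V] (p : V → Pl) :
    ∃ r : V → ℝ, (∀ u v, u ≠ v → ‖p u - p v‖ ≤ r u + r v) ∧
      ∃ π : Equiv.Perm V, ∀ v, π v ≠ v ∧ ‖p v - p (π v)‖ = r v + r (π v) := by
  obtain ⟨B, hB⟩ : ∃ B : ℝ, ∀ u v, ‖p u - p v‖ < B := by
    obtain ⟨B, hB⟩ := (Set.finite_range (fun q : V × V => ‖p q.1 - p q.2‖)).bddAbove
    exact ⟨B + 1, fun u v => lt_of_le_of_lt (hB ⟨(u, v), rfl⟩) (by linarith)⟩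
  have hB0 : 0 < B := by
    obtain ⟨v, _⟩ := exists_pair_ne V
    have := hB v v; simpa using this
  obtain ⟨r, hr0, hr, π, hπ⟩ := exists_dual_perm
    (fun u v : V => if u = v then 0 else ‖p u - p v‖ + B)
    (fun u v => by split_ifs <;> positivity)
    (fun u v => by simp only [eq_comm (a := u), norm_sub_rev (p u)])
  have hr' : ∀ u v, u ≠ v → ‖p u - p v‖ + B ≤ r u + r v := fun u v huv => by
    have := hr u v; simpa [huv] using this
  have hfix : ∀ v, π v ≠ v := by
    intro v hv
    have h1 := hπ v
    simp only [hv, if_true] at h1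
    have hge : ∀ u, u ≠ v → B ≤ r u := fun u hu => by
      have := hr' u v hu
      have := norm_nonneg (p u - p v)
      linarith
    obtain ⟨u, hu⟩ := exists_ne v
    have hu' : π u ≠ v := fun h => hu (π.injective (h.trans hv.symm))
    have h2 := hπ u
    have h3 := hge u hu
    have h4 := hge _ hu'
    have h5 := hB u (π u)
    split_ifs at h2 <;> linarith
  refine ⟨fun v => r v - B / 2, fun u v huv => by have := hr' u v huv; simp only; linarith, π,
    fun v => ⟨hfix v, ?_⟩⟩
  have := hπ v
  simp only [(hfix v).symm, if_false] at this
  simp only; linarith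

lemma matching_of_six {V : Type} [DecidableEq V] (p : V → Pl) (r : V → ℝ) (a b c d e f : V)
    (hn : [a, b, c, d, e, f].Nodup) (hall : ∀ y, y ∈ [a, b, c, d, e, f])
    (h1 : ‖p a - p d‖ = r a + r d) (h2 : ‖p b - p c‖ = r b + r c)
    (h3 : ‖p e - p f‖ = r e + r f) :
    ∃ τ : V → V, Function.Involutive τ ∧ (∀ v, τ v ≠ v) ∧
      ∀ v, ‖p v - p (τ v)‖ = r v + r (τ v) := by
  have h1' : ‖p d - p a‖ = r d + r a := by rw [norm_sub_rev, h1, add_comm]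
  have h2' : ‖p c - p b‖ = r c + r b := by rw [norm_sub_rev, h2, add_comm]
  have h3' : ‖p f - p e‖ = r f + r e := by rw [norm_sub_rev, h3, add_comm]
  simp only [List.nodup_cons, List.mem_cons, List.not_mem_nil, or_false, not_or,
    List.nodup_nil, not_false_eq_true, and_true] at hn hall
  let τ : V → V := fun v => if v = a then d else if v = d then a else if v = b then c else
    if v = c then b else if v = e then f else e
  have ta : τ a = d := by simp [τ]
  have td : τ d = a := by simp only [τ]; grind
  have tb : τ b = c := by simp only [τ]; grind
  have tc : τ c = b := by simp only [τ]; grind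
  have te : τ e = f := by simp only [τ]; grind
  have tf : τ f = e := by simp only [τ]; grind
  refine ⟨τ, fun v => ?_, fun v => ?_, fun v => ?_⟩ <;>
    rcases hall v with h | h | h | h | h | h <;> subst h <;> simp only [ta, tb, tc, td, te, tf] <;>
    first | assumption | grind

lemma exists_tight_matching {V : Type} [Fintype V] [DecidableEq V] (p : V → Pl) (r : V → ℝ)
    (hcard : Fintype.card V ≤ 6) (heven : Even (Fintype.card V))
    (hr : ∀ u v, u ≠ v → ‖p u - p v‖ ≤ r u + r v) (π : Equiv.Perm V)
    (hfix : ∀ v, π v ≠ v) (hπ : ∀ v, ‖p v - p (π v)‖ = r v + r (π v)) :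
    ∃ τ : V → V, Function.Involutive τ ∧ (∀ v, τ v ≠ v) ∧
      ∀ v, ‖p v - p (τ v)‖ = r v + r (τ v) := by
  rcases matching_or_triangles π hfix hcard heven with ⟨τ, hτ, h⟩ | ⟨v, x, hv, hx, hn, hall⟩
  · refine ⟨τ, hτ, fun v => ?_, fun v => ?_⟩
    · intro hv
      rcases h v with h | h
      · exact hfix v (h.symm.trans hv)
      · rw [hv] at h; exact hfix v h
    · rcases h v with h | h
      · rw [h]; exact hπ v
      · have := hπ (τ v)
        rw [h] at this
        rw [norm_sub_rev, this, add_comm]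
  · have hT : ∀ v, π (π (π v)) = v → ∀ i j : Fin 3, i ≠ j →
        ‖p (![v, π v, π (π v)] i) - p (![v, π v, π (π v)] j)‖ =
          r (![v, π v, π (π v)] i) + r (![v, π v, π (π v)] j) := by
      intro v hv i j hij
      have a1 := hπ v
      have a2 := hπ (π v)
      have a3 := hπ (π (π v))
      rw [hv] at a3
      have b1 := a1
      have b2 := a2
      have b3 := a3
      rw [norm_sub_rev, add_comm] at b1 b2 b3
      fin_cases i <;> fin_cases j <;> first | exact absurd rfl hij | assumption
    obtain ⟨i, j, hij⟩ := cross_tight (fun i => p (![v, π v, π (π v)] i))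
      (fun i => p (![x, π x, π (π x)] i)) (fun i => r (![v, π v, π (π v)] i))
      (fun i => r (![x, π x, π (π x)] i)) (hT v hv) (hT x hx)
    have a1 := hπ v
    have a2 := hπ (π v)
    have a3 := hπ (π (π v))
    have c1 := hπ x
    have c2 := hπ (π x)
    have c3 := hπ (π (π x))
    rw [hv] at a3
    rw [hx] at c3
    have hn' := hn
    simp only [List.nodup_cons, List.mem_cons, List.not_mem_nil, or_false, not_or,
      List.nodup_nil, not_false_eq_true, and_true] at hn'
    generalize π (π v) = v2 at *
    generalize π v = v1 at *
    generalize π (π x) = x2 at *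
    generalize π x = x1 at *
    have main : ∀ a b c d e f : V, [a, b, c, d, e, f].Perm [v, v1, v2, x, x1, x2] →
        r a + r d ≤ ‖p a - p d‖ → ‖p b - p c‖ = r b + r c → ‖p e - p f‖ = r e + r f →
        ∃ τ : V → V, Function.Involutive τ ∧ (∀ v, τ v ≠ v) ∧
          ∀ v, ‖p v - p (τ v)‖ = r v + r (τ v) := by
      intro a b c d e f hp h1 h2 h3
      have hnd := hp.nodup_iff.2 hn
      refine matching_of_six p r a b c d e f hnd (fun y => hp.mem_iff.2 (hall y))
        (le_antisymm (hr a d ?_) h1) h2 h3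
      simp only [List.nodup_cons, List.mem_cons, not_or] at hnd
      exact hnd.1.2.2.1
    have rot : ∀ a b c : V, [b, c, a].Perm [a, b, c] := fun a b c =>
      (List.perm_append_comm (l₁ := [b, c]) (l₂ := [a]))
    have rot2 : ∀ a b c : V, [c, a, b].Perm [a, b, c] := fun a b c =>
      (List.perm_append_comm (l₁ := [c]) (l₂ := [a, b]))
    have rfl3 : ∀ a b c : V, [a, b, c].Perm [a, b, c] := fun a b c => List.Perm.refl _
    fin_cases i <;> fin_cases j
    · exact main v v1 v2 x x1 x2 ((rfl3 _ _ _).append (rfl3 _ _ _)) hij a2 c2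
    · exact main v v1 v2 x1 x2 x ((rfl3 _ _ _).append (rot _ _ _)) hij a2 c3
    · exact main v v1 v2 x2 x x1 ((rfl3 _ _ _).append (rot2 _ _ _)) hij a2 c1
    · exact main v1 v2 v x x1 x2 ((rot _ _ _).append (rfl3 _ _ _)) hij a3 c2
    · exact main v1 v2 v x1 x2 x ((rot _ _ _).append (rot _ _ _)) hij a3 c3
    · exact main v1 v2 v x2 x x1 ((rot _ _ _).append (rot2 _ _ _)) hij a3 c1
    · exact main v2 v v1 x x1 x2 ((rot2 _ _ _).append (rfl3 _ _ _)) hij a1 c2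
    · exact main v2 v v1 x1 x2 x ((rot2 _ _ _).append (rot _ _ _)) hij a1 c3
    · exact main v2 v v1 x2 x x1 ((rot2 _ _ _).append (rot2 _ _ _)) hij a1 c1

lemma small_case {J : Type} [Fintype J] [DecidableEq J] (a b : J → Pl)
    (hcard : Fintype.card J ≤ 3)
    (hmax : ∀ σ : Equiv.Perm (J ⊕ J),
      ∑ i : J, ‖Sum.elim a b (σ (Sum.inl i)) - Sum.elim a b (σ (Sum.inr i))‖
        ≤ ∑ i : J, ‖a i - b i‖) :
    ∃ o : Pl, ∀ i, ‖a i - o‖ + ‖b i - o‖ ≤ 2 / Real.sqrt 3 * ‖a i - b i‖ := by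
  rcases isEmpty_or_nonempty J with hJ | hJ
  · exact ⟨0, fun i => hJ.elim i⟩
  have hnt : Nontrivial (J ⊕ J) := by
    obtain ⟨i⟩ := hJ
    exact ⟨Sum.inl i, Sum.inr i, by simp⟩
  have hs1 : 1 ≤ 2 / Real.sqrt 3 := by
    rw [one_le_div (by positivity), Real.sqrt_le_left (by norm_num)]; norm_num
  set p : J ⊕ J → Pl := Sum.elim a b with hp
  obtain ⟨r, hr, π, hπ⟩ := exists_dual_deranged p
  obtain ⟨τ, hτ, hτf, hτt⟩ := exists_tight_matching p r (by rw [Fintype.card_sum]; omega)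
    (by rw [Fintype.card_sum]; exact ⟨_, rfl⟩) hr π (fun v => (hπ v).1) (fun v => (hπ v).2)
  obtain ⟨σ, hσ⟩ := conj_of_involutive τ hτ hτf
  have h1 := hmax σ
  have h2 : ∑ i : J, ‖p (σ (Sum.inl i)) - p (σ (Sum.inr i))‖ =
      ∑ i : J, (r (Sum.inl i) + r (Sum.inr i)) := by
    have e1 : ∑ v, r (σ v) = ∑ v, r v := Equiv.sum_comp σ r
    rw [Fintype.sum_sum_type, Fintype.sum_sum_type, ← Finset.sum_add_distrib,
      ← Finset.sum_add_distrib] at e1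
    rw [← e1]
    refine Finset.sum_congr rfl fun i _ => ?_
    rw [← hσ]; exact hτt _
  rw [h2] at h1
  have h3 : ∀ i ∈ Finset.univ, ‖a i - b i‖ ≤ r (Sum.inl i) + r (Sum.inr i) := fun i _ =>
    hr (Sum.inl i) (Sum.inr i) (by simp)
  have h4 := (Finset.sum_eq_sum_iff_of_le h3).1 (le_antisymm (Finset.sum_le_sum h3) h1)
  by_cases hneg : ∃ v, r v ≤ 0
  · obtain ⟨v, hv⟩ := hneg
    refine ⟨p v, fun i => ?_⟩
    have h5 : ‖a i - p v‖ + ‖b i - p v‖ ≤ ‖a i - b i‖ := by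
      by_cases hl : Sum.inl i = v
      · rw [← hl]; simp [hp, norm_sub_rev]
      by_cases hrr : Sum.inr i = v
      · rw [← hrr]; simp [hp]
      have e1 : ‖a i - p v‖ ≤ r (Sum.inl i) + r v := hr (Sum.inl i) v hl
      have e2 : ‖b i - p v‖ ≤ r (Sum.inr i) + r v := hr (Sum.inr i) v hrr
      have := h4 i (Finset.mem_univ i)
      linarith
    exact h5.trans (le_mul_of_one_le_left (norm_nonneg _) hs1)
  · push Not at hneg
    obtain ⟨o, ho⟩ := jung_discs p r hneg (fun u v => by
      by_cases huv : u = v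
      · subst huv; have := hneg u; simp; linarith
      · exact hr u v huv)
    refine ⟨o, fun i => ?_⟩
    have e1 : ‖a i - o‖ ≤ _ := ho (Sum.inl i)
    have e2 : ‖b i - o‖ ≤ _ := ho (Sum.inr i)
    rw [h4 i (Finset.mem_univ i), mul_add]
    linarith

lemma restrict_max {n : ℕ} (a b : Fin n → Pl)
    (hmax : ∀ σ : Equiv.Perm (Fin n ⊕ Fin n),
      ∑ i : Fin n, ‖Sum.elim a b (σ (Sum.inl i)) - Sum.elim a b (σ (Sum.inr i))‖
        ≤ ∑ i : Fin n, ‖a i - b i‖) (I : Finset (Fin n))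
    (σ : Equiv.Perm ({i // i ∈ I} ⊕ {i // i ∈ I})) :
    ∑ i : {i // i ∈ I}, ‖Sum.elim (fun i : {i // i ∈ I} => a i) (fun i : {i // i ∈ I} => b i)
        (σ (Sum.inl i)) - Sum.elim (fun i : {i // i ∈ I} => a i) (fun i : {i // i ∈ I} => b i)
        (σ (Sum.inr i))‖
        ≤ ∑ i : {i // i ∈ I}, ‖a i - b i‖ := by
  classical
  let P : Fin n ⊕ Fin n → Prop := Sum.elim (fun i => i ∈ I) (fun i => i ∈ I)
  let e : {i // i ∈ I} ⊕ {i // i ∈ I} ≃ {v // P v} := (Equiv.subtypeSum (p := P)).symm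
  have hdec : DecidablePred P := Classical.decPred _
  have hel : ∀ w : {i // i ∈ I} ⊕ {i // i ∈ I}, Sum.elim a b ((e w : Fin n ⊕ Fin n)) =
      Sum.elim (fun i : {i // i ∈ I} => a i) (fun i : {i // i ∈ I} => b i) w := by
    rintro (w | w) <;> rfl
  have h := hmax (σ.extendDomain e)
  rw [← Fintype.sum_subtype_add_sum_subtype (fun i => i ∈ I),
    ← Fintype.sum_subtype_add_sum_subtype (fun i => i ∈ I) (fun i => ‖a i - b i‖)] at h
  have h1 : ∀ i : {i // i ∈ I}, (σ.extendDomain e) (Sum.inl (i : Fin n)) = e (σ (Sum.inl i)) :=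
    fun i => Equiv.Perm.extendDomain_apply_image σ e (Sum.inl i)
  have h2 : ∀ i : {i // i ∈ I}, (σ.extendDomain e) (Sum.inr (i : Fin n)) = e (σ (Sum.inr i)) :=
    fun i => Equiv.Perm.extendDomain_apply_image σ e (Sum.inr i)
  have h3 : ∀ i : {i // i ∉ I}, (σ.extendDomain e) (Sum.inl (i : Fin n)) = Sum.inl (i : Fin n) :=
    fun i => Equiv.Perm.extendDomain_apply_not_subtype σ e i.2
  have h4 : ∀ i : {i // i ∉ I}, (σ.extendDomain e) (Sum.inr (i : Fin n)) = Sum.inr (i : Fin n) :=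
    fun i => Equiv.Perm.extendDomain_apply_not_subtype σ e i.2
  simp only [h1, h2, h3, h4, hel, Sum.elim_inl, Sum.elim_inr] at h
  have h5 := le_of_add_le_add_right h
  convert h5

/-- If the matching {a_i b_i} is max-sum for a set of 2n points in the
plane, then the elliptical regions
`E(a_i b_i) = {x : ‖a_i - x‖ + ‖b_i - x‖ ≤ (2/√3) ‖a_i - b_i‖}` have a common point. -/
theorem fingerhut_ellipses_intersect (n : ℕ) (a b : Fin n → EuclideanSpace ℝ (Fin 2))
    (hmax : ∀ σ : Equiv.Perm (Fin n ⊕ Fin n),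
      ∑ i : Fin n, ‖Sum.elim a b (σ (Sum.inl i)) - Sum.elim a b (σ (Sum.inr i))‖
        ≤ ∑ i : Fin n, ‖a i - b i‖) :
    (⋂ i : Fin n,
      {x : EuclideanSpace ℝ (Fin 2) |
        ‖a i - x‖ + ‖b i - x‖ ≤ (2 / Real.sqrt 3) * ‖a i - b i‖}).Nonempty := by
  have hconv : ∀ i ∈ (Finset.univ : Finset (Fin n)), Convex ℝ {x : EuclideanSpace ℝ (Fin 2) |
        ‖a i - x‖ + ‖b i - x‖ ≤ (2 / Real.sqrt 3) * ‖a i - b i‖} := by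
    intro i _
    have h1 : ∀ c : Pl, ConvexOn ℝ Set.univ (fun x : Pl => ‖c - x‖) := fun c => by
      have := convexOn_dist c (convex_univ (𝕜 := ℝ) (E := Pl))
      simpa only [dist_eq_norm, norm_sub_rev c] using this
    have := ((h1 (a i)).add (h1 (b i))).convex_le (2 / Real.sqrt 3 * ‖a i - b i‖)
    simpa using this
  have := Convex.helly_theorem' hconv (fun I _ hI => by
    obtain ⟨o, ho⟩ := small_case (fun i : {i // i ∈ I} => a i) (fun i : {i // i ∈ I} => b i)
      (by simpa using hI) (restrict_max a b hmax I)
    exact ⟨o, Set.mem_iInter₂.2 fun i hi => ho ⟨i, hi⟩⟩)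
  simpa using this
end

section
/- Let S = {a₁,b₁,…,aₙ,bₙ} be an even set of 2n points in the Euclidean plane and let M = {a₁b₁,…,aₙbₙ} be a max-sum perfect matching of S. Then t(S) ≤ (2/√3)·cost(M), where t(S) = min_{y∈ℝ²} ∑_{x∈S} ‖y−x‖ and cost(M) = ∑ᵢ‖aᵢ−bᵢ‖. -/
open scoped BigOperators


theorem aux_median {ι : Type*} [Fintype ι] [DecidableEq ι] (n : ℕ) (hn : 0 < n)
    (hc : Fintype.card ι = 2 * n) :
    ∃ F : (ι → ℝ) → ℝ, Continuous F ∧ (∀ v, F (-v) = - F v) ∧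
      ∀ v, ∃ A : Finset ι, A.card = n ∧ (∀ i ∈ A, v i ≤ F v) ∧ (∀ i, i ∉ A → F v ≤ v i) ∧
        ((∃ i, v i = F v) → (∃ i ∈ A, v i = F v) ∧ (∃ i, i ∉ A ∧ v i = F v)) := by
  classical
  -- the n-element subsets, as nonempty finsets
  let T := {A : Finset ι // A.card = n}
  have hT : Nonempty T := by
    obtain ⟨A, -, hA⟩ := Finset.exists_subset_card_eq (s := (Finset.univ : Finset ι)) (n := n)
      (by rw [Finset.card_univ]; omega)
    exact ⟨⟨A, hA⟩⟩
  have ne : ∀ A : T, A.1.Nonempty := fun A => by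
    rw [← Finset.card_pos, A.2]; exact hn
  let L : (ι → ℝ) → ℝ := fun v =>
    (Finset.univ : Finset T).inf' Finset.univ_nonempty (fun A => A.1.sup' (ne A) v)
  let U : (ι → ℝ) → ℝ := fun v =>
    (Finset.univ : Finset T).sup' Finset.univ_nonempty (fun A => A.1.inf' (ne A) v)
  have hLc : Continuous L := by
    apply Continuous.finset_inf'_apply
    intro A _
    apply Continuous.finset_sup'_apply
    intro i _
    exact continuous_apply i
  have hUc : Continuous U := by
    apply Continuous.finset_sup'_apply
    intro A _
    apply Continuous.finset_inf'_apply
    intro i _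
    exact continuous_apply i
  have hneg : ∀ v, U (-v) = - L v := by
    intro v
    apply le_antisymm
    · apply Finset.sup'_le
      intro A _
      have h1 : L v ≤ A.1.sup' (ne A) v := Finset.inf'_le _ (Finset.mem_univ A)
      obtain ⟨i, hi, he⟩ := Finset.exists_mem_eq_sup' (ne A) v
      have h2 : A.1.inf' (ne A) (-v) ≤ (-v) i := Finset.inf'_le _ hi
      have h3 : (-v) i = - v i := rfl
      linarith
    · obtain ⟨A, -, he⟩ := Finset.exists_mem_eq_inf' (Finset.univ_nonempty (α := T))
        (fun A => A.1.sup' (ne A) v)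
      have h1 : A.1.inf' (ne A) (-v) ≤ U (-v) :=
        Finset.le_sup' (fun A : T => A.1.inf' (ne A) (-v)) (Finset.mem_univ A)
      obtain ⟨i, hi, hi'⟩ := Finset.exists_mem_eq_inf' (ne A) (-v)
      have h2 : v i ≤ A.1.sup' (ne A) v := Finset.le_sup' v hi
      have : L v = A.1.sup' (ne A) v := he
      have h3 : (-v) i = - v i := rfl
      linarith
  have hneg' : ∀ v, L (-v) = - U v := by
    intro v
    have := hneg (-v)
    rw [neg_neg] at this
    linarith
  refine ⟨fun v => (L v + U v) / 2, by fun_prop, ?_, ?_⟩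
  · intro v
    simp only [hneg, hneg']
    ring
  intro v
  have hlt : (Finset.univ.filter (fun i => v i < L v)).card ≤ n := by
    by_contra hcon
    obtain ⟨B, hB, hBc⟩ := Finset.exists_subset_card_eq (not_le.1 hcon).le
    have h1 : L v ≤ B.sup' (ne ⟨B, hBc⟩) v :=
      Finset.inf'_le (fun A : T => A.1.sup' (ne A) v) (Finset.mem_univ (⟨B, hBc⟩ : T))
    obtain ⟨i, hi, he⟩ := Finset.exists_mem_eq_sup' (ne ⟨B, hBc⟩) v
    have := (Finset.mem_filter.1 (hB hi)).2
    simp only at he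
    linarith
  have hle : n ≤ (Finset.univ.filter (fun i => v i ≤ L v)).card := by
    obtain ⟨A, -, he⟩ := Finset.exists_mem_eq_inf' (Finset.univ_nonempty (α := T))
        (fun A => A.1.sup' (ne A) v)
    have he' : L v = A.1.sup' (ne A) v := he
    rw [← A.2]
    apply Finset.card_le_card
    intro i hi
    simp only [Finset.mem_filter, Finset.mem_univ, true_and]
    rw [he']
    exact Finset.le_sup' v hi
  obtain ⟨A, hA1, hA2, hAc⟩ := Finset.exists_subsuperset_card_eq
    (show Finset.univ.filter (fun i => v i < L v) ⊆ Finset.univ.filter (fun i => v i ≤ L v) by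
      intro i hi
      simp only [Finset.mem_filter, Finset.mem_univ, true_and] at hi ⊢
      exact hi.le) hlt hle
  have hAL : ∀ i ∈ A, v i ≤ L v := fun i hi => (Finset.mem_filter.1 (hA2 hi)).2
  have hAL' : ∀ i, i ∉ A → L v ≤ v i := by
    intro i hi
    by_contra hcon
    exact hi (hA1 (by simpa using hcon))
  have hAcc : Aᶜ.card = n := by rw [Finset.card_compl, hAc, hc]; omega
  have hUA : U v = Aᶜ.inf' (ne ⟨Aᶜ, hAcc⟩) v := by
    apply le_antisymm
    · apply Finset.sup'_le
      intro B _
      by_cases hB : B.1 ⊆ Aᶜ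
      · have : B.1 = Aᶜ := Finset.eq_of_subset_of_card_le hB (by rw [hAcc, B.2])
        obtain ⟨B, hBc⟩ := B
        simp only at this
        subst this
        exact le_rfl
      · obtain ⟨i, hi, hi'⟩ := Finset.not_subset.1 hB
        rw [Finset.mem_compl, not_not] at hi'
        apply le_trans (Finset.inf'_le v hi)
        apply le_trans (hAL i hi')
        apply Finset.le_inf'
        intro j hj
        exact hAL' j (Finset.mem_compl.1 hj)
    · exact Finset.le_sup' (fun A : T => A.1.inf' (ne A) v) (Finset.mem_univ (⟨Aᶜ, hAcc⟩ : T))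
  have hLA : L v = A.sup' (ne ⟨A, hAc⟩) v := by
    apply le_antisymm
    · exact Finset.inf'_le (fun A : T => A.1.sup' (ne A) v) (Finset.mem_univ (⟨A, hAc⟩ : T))
    · exact Finset.sup'_le _ _ hAL
  have hAU : ∀ i, i ∉ A → U v ≤ v i := by
    intro i hi
    rw [hUA]
    exact Finset.inf'_le _ (Finset.mem_compl.2 hi)
  obtain ⟨i, hi, hi'⟩ := Finset.exists_mem_eq_sup' (ne ⟨A, hAc⟩) v
  obtain ⟨j, hj, hj'⟩ := Finset.exists_mem_eq_inf' (ne ⟨Aᶜ, hAcc⟩) v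
  have hiL : v i = L v := by rw [hLA]; exact hi'.symm
  have hjU : v j = U v := by rw [hUA]; exact hj'.symm
  have hjA : j ∉ A := Finset.mem_compl.1 hj
  have hLU : L v ≤ U v := by rw [← hjU]; exact hAL' j hjA
  refine ⟨A, hAc, ?_, ?_, ?_⟩
  · intro k hk
    have := hAL k hk
    simp only; linarith
  · intro k hk
    have := hAU k hk
    simp only; linarith
  · rintro ⟨k, hk⟩
    simp only at hk
    have hEq : L v = U v := by
      by_cases hkA : k ∈ A
      · have := hAL k hkA
        linarith
      · have := hAU k hkA
        linarith
    refine ⟨⟨i, hi, ?_⟩, ⟨j, hjA, ?_⟩⟩ <;> simp only <;> linarith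

theorem aux_match (n : ℕ) (A0 A1 A2 : Finset (Fin n ⊕ Fin n))
    (h0 : A0.card = n) (h1 : A1.card = n) (h2 : A2.card = n)
    (hb1 : ∀ i, ¬ (i ∈ A0 ∧ i ∉ A1 ∧ i ∈ A2)) (hb2 : ∀ i, ¬ (i ∉ A0 ∧ i ∈ A1 ∧ i ∉ A2)) :
    ∃ σ : Equiv.Perm (Fin n ⊕ Fin n), ∀ i : Fin n,
      (σ (Sum.inl i) ∈ A0 ∧ σ (Sum.inr i) ∉ A0) ∧
      (σ (Sum.inl i) ∈ A1 ↔ σ (Sum.inr i) ∉ A1) ∧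
      (σ (Sum.inl i) ∈ A2 ↔ σ (Sum.inr i) ∉ A2) := by
  classical
  let f : {i // i ∈ A0} → Bool × Bool := fun i => (decide (i.1 ∈ A1), decide (i.1 ∈ A2))
  let g : {i // ¬ i ∈ A0} → Bool × Bool := fun i => (!decide (i.1 ∈ A1), !decide (i.1 ∈ A2))
  let N : Bool → Bool → Bool → ℕ := fun s t u =>
    (Finset.univ.filter (fun i => decide (i ∈ A0) = s ∧ decide (i ∈ A1) = t ∧
      decide (i ∈ A2) = u)).card
  have hcd : ∀ A : Finset (Fin n ⊕ Fin n), A.card = ∑ i, if i ∈ A then 1 else 0 := by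
    intro A; simp
  have e0 : A0.card = N true true true + N true true false + N true false true
      + N true false false := by
    simp only [N, Finset.card_filter, ← Finset.sum_add_distrib, hcd A0]
    apply Finset.sum_congr rfl
    intro i _
    by_cases i ∈ A0 <;> by_cases i ∈ A1 <;> by_cases i ∈ A2 <;> simp [*]
  have e1 : A1.card = N true true true + N true true false + N false true true
      + N false true false := by
    simp only [N, Finset.card_filter, ← Finset.sum_add_distrib, hcd A1]
    apply Finset.sum_congr rfl
    intro i _
    by_cases i ∈ A0 <;> by_cases i ∈ A1 <;> by_cases i ∈ A2 <;> simp [*]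
  have e2 : A2.card = N true true true + N true false true + N false true true
      + N false false true := by
    simp only [N, Finset.card_filter, ← Finset.sum_add_distrib, hcd A2]
    apply Finset.sum_congr rfl
    intro i _
    by_cases i ∈ A0 <;> by_cases i ∈ A1 <;> by_cases i ∈ A2 <;> simp [*]
  have e3 : n + n = A0.card + N false true true + N false true false + N false false true
      + N false false false := by
    have : n + n = ∑ i : Fin n ⊕ Fin n, 1 := by simp
    rw [this]
    simp only [N, Finset.card_filter, ← Finset.sum_add_distrib, hcd A0]
    apply Finset.sum_congr rfl
    intro i _
    by_cases i ∈ A0 <;> by_cases i ∈ A1 <;> by_cases i ∈ A2 <;> simp [*]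
  have z1 : N true false true = 0 := by
    simp only [N, Finset.card_eq_zero, Finset.filter_eq_empty_iff]
    intro i _
    have := hb1 i
    simpa using this
  have z2 : N false true false = 0 := by
    simp only [N, Finset.card_eq_zero, Finset.filter_eq_empty_iff]
    intro i _
    have := hb2 i
    simpa using this
  have hf : ∀ c, Fintype.card {a // f a = c} = N true c.1 c.2 := by
    intro c
    simp only [N]
    rw [← Fintype.card_coe]
    refine Fintype.card_congr
      ⟨fun a => ⟨a.1.1, ?_⟩, fun a => ⟨⟨a.1, ?_⟩, ?_⟩, fun _ => rfl, fun _ => rfl⟩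
    · obtain ⟨⟨a, ha⟩, rfl⟩ := a
      simp [f, ha]
    · have := a.2
      simp at this
      exact this.1
    · have := a.2
      simp at this
      ext <;> simp [f, this]
  have hg : ∀ c, Fintype.card {a // g a = c} = N false (!c.1) (!c.2) := by
    intro c
    simp only [N]
    rw [← Fintype.card_coe]
    refine Fintype.card_congr
      ⟨fun a => ⟨a.1.1, ?_⟩, fun a => ⟨⟨a.1, ?_⟩, ?_⟩, fun _ => rfl, fun _ => rfl⟩
    · obtain ⟨⟨a, ha⟩, rfl⟩ := a
      simp [g, ha]
    · have := a.2
      simp at this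
      exact this.1
    · have := a.2
      simp at this
      apply Prod.ext <;> simp [g, this]
  have hfg : ∀ c, Nonempty ({a // f a = c} ≃ {a // g a = c}) := by
    intro c
    rw [← Fintype.card_eq, hf, hg]
    obtain ⟨s, t⟩ := c
    cases s <;> cases t <;> simp only [Bool.not_true, Bool.not_false] <;> omega
  let E : {i // i ∈ A0} ≃ {i // ¬ i ∈ A0} := Equiv.ofFiberEquiv (fun c => (hfg c).some)
  have hE : ∀ a, g (E a) = f a := fun a => Equiv.ofFiberEquiv_map _ a
  let e : Fin n ≃ {i // i ∈ A0} := (Fintype.equivFinOfCardEq (by simp [h0])).symm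
  let σ : Equiv.Perm (Fin n ⊕ Fin n) :=
    (Equiv.sumCongr e (e.trans E)).trans (Equiv.sumCompl (fun i => i ∈ A0))
  refine ⟨σ, fun i => ?_⟩
  have s1 : σ (Sum.inl i) = (e i).1 := rfl
  have s2 : σ (Sum.inr i) = (E (e i)).1 := rfl
  have := hE (e i)
  simp only [f, g, Prod.mk.injEq] at this
  rw [s1, s2]
  refine ⟨⟨(e i).2, (E (e i)).2⟩, ?_, ?_⟩
  · have h := this.1
    by_cases h' : (e i).1 ∈ A1 <;> simp [h'] at h ⊢ <;> exact h
  · have h := this.2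
    by_cases h' : (e i).1 ∈ A2 <;> simp [h'] at h ⊢ <;> exact h

/-- Key angular estimate in oblique coordinates. -/
theorem aux_pos (a b c d : ℝ) (ha : 0 ≤ a) (hb : 0 ≤ b) (hc : 0 ≤ c) (hd : 0 ≤ d) :
    Real.sqrt ((a^2 + a*b + b^2) * (c^2 + c*d + d^2)) ≤ 2*a*c + 2*b*d + a*d + b*c := by
  apply Real.sqrt_le_iff.2
  refine ⟨by positivity, ?_⟩
  have : 0 ≤ 3*(a*c)^2 + 3*(b*d)^2 + 9*(a*b*c*d) + 3*(a^2*c*d) + 3*(c^2*a*b) + 3*(b^2*c*d)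
    + 3*(d^2*a*b) := by positivity
  nlinarith

theorem aux_six (a b c d : ℝ)
    (h : (0 ≤ a ∧ 0 ≤ b ∧ c ≤ 0 ∧ d ≤ 0) ∨ (0 ≤ a ∧ b ≤ 0 ∧ 0 ≤ a + b ∧ c ≤ 0 ∧ 0 ≤ d ∧ c + d ≤ 0)
      ∨ (0 ≤ a ∧ b ≤ 0 ∧ a + b ≤ 0 ∧ c ≤ 0 ∧ 0 ≤ d ∧ 0 ≤ c + d)) :
    Real.sqrt ((a^2 + a*b + b^2) * (c^2 + c*d + d^2)) ≤ -(2*a*c + 2*b*d + a*d + b*c) := by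
  rcases h with ⟨h1, h2, h3, h4⟩ | ⟨h1, h2, h3, h4, h5, h6⟩ | ⟨h1, h2, h3, h4, h5, h6⟩
  · have := aux_pos a b (-c) (-d) h1 h2 (by linarith) (by linarith)
    convert this using 1
    · congr 1; ring
    · ring
  · have := aux_pos (-b) (a+b) d (-(c+d)) (by linarith) h3 h5 (by linarith)
    convert this using 1
    · congr 1; ring
    · ring
  · have := aux_pos a (-(a+b)) (-c) (c+d) h1 (by linarith) (by linarith) h6
    convert this using 1
    · congr 1; ring
    · ring

/-- Coordinates form: `p = (p0,p1)`, direction `(C,S)`, other axes rotated by 60 degrees. -/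
theorem aux_geom (p q : EuclideanSpace ℝ (Fin 2)) (a b c d : ℝ)
    (hp : p 0 ^ 2 + p 1 ^ 2 = 4/3 * (a^2 + a*b + b^2))
    (hq : q 0 ^ 2 + q 1 ^ 2 = 4/3 * (c^2 + c*d + d^2))
    (hpq : p 0 * q 0 + p 1 * q 1 = 2/3 * (2*a*c + 2*b*d + a*d + b*c))
    (h : (0 ≤ a ∧ 0 ≤ b ∧ c ≤ 0 ∧ d ≤ 0) ∨ (0 ≤ a ∧ b ≤ 0 ∧ 0 ≤ a + b ∧ c ≤ 0 ∧ 0 ≤ d ∧ c + d ≤ 0)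
      ∨ (0 ≤ a ∧ b ≤ 0 ∧ a + b ≤ 0 ∧ c ≤ 0 ∧ 0 ≤ d ∧ 0 ≤ c + d)) :
    ‖p‖ + ‖q‖ ≤ 2 / Real.sqrt 3 * ‖p - q‖ := by
  have h6 := aux_six a b c d h
  have np : ‖p‖ ^ 2 = p 0 ^ 2 + p 1 ^ 2 := by
    rw [EuclideanSpace.norm_sq_eq]; simp [Fin.sum_univ_two]
  have nq : ‖q‖ ^ 2 = q 0 ^ 2 + q 1 ^ 2 := by
    rw [EuclideanSpace.norm_sq_eq]; simp [Fin.sum_univ_two]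
  have npq : ‖p - q‖ ^ 2 = (p 0 - q 0) ^ 2 + (p 1 - q 1) ^ 2 := by
    rw [EuclideanSpace.norm_sq_eq]; simp [Fin.sum_univ_two]
  have hmul : ‖p‖ * ‖q‖ = 4/3 * Real.sqrt ((a^2 + a*b + b^2) * (c^2 + c*d + d^2)) := by
    have h1 : 0 ≤ ‖p‖ * ‖q‖ := by positivity
    have h2 : (‖p‖ * ‖q‖)^2 = (4/3)^2 * ((a^2 + a*b + b^2) * (c^2 + c*d + d^2)) := by
      rw [mul_pow, np, nq, hp, hq]; ring
    rw [← Real.sqrt_sq h1, h2, Real.sqrt_mul (by norm_num), Real.sqrt_sq (by norm_num)]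
  have key : (‖p‖ + ‖q‖)^2 * 3 ≤ 4 * ‖p - q‖^2 := by
    have : (‖p‖ - ‖q‖)^2 ≥ 0 := sq_nonneg _
    nlinarith
  have h3 : 0 < Real.sqrt 3 := by positivity
  have h3' : Real.sqrt 3 ^ 2 = 3 := Real.sq_sqrt (by norm_num)
  rw [div_mul_eq_mul_div, le_div_iff₀ h3]
  refine le_of_sq_le_sq ?_ (by positivity)
  rw [mul_pow, mul_pow, h3']
  linarith

theorem aux_generic (n : ℕ) (hn : 0 < n) (x : Fin n ⊕ Fin n → EuclideanSpace ℝ (Fin 2))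
    (hx : ∀ i j k, j ≠ i → k ≠ i →
      ((x j 0 - x i 0) * (x k 1 - x i 1) - (x j 1 - x i 1) * (x k 0 - x i 0)) ^ 2 ≠
      3 * ((x j 0 - x i 0) * (x k 0 - x i 0) + (x j 1 - x i 1) * (x k 1 - x i 1)) ^ 2) :
    ∃ (c : EuclideanSpace ℝ (Fin 2)) (σ : Equiv.Perm (Fin n ⊕ Fin n)),
      ∑ i, ‖c - x i‖ ≤
        2 / Real.sqrt 3 * ∑ i : Fin n, ‖x (σ (Sum.inl i)) - x (σ (Sum.inr i))‖ := by
  obtain ⟨F, hFc, hFn, hF⟩ := aux_median (ι := Fin n ⊕ Fin n) n hn (by simp; omega)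
  let v : ℝ → (Fin n ⊕ Fin n) → ℝ := fun θ i => x i 0 * Real.cos θ + x i 1 * Real.sin θ
  let f : ℝ → ℝ := fun θ => F (v θ)
  have hvc : Continuous v := by
    apply continuous_pi
    intro i
    fun_prop
  have hfc : Continuous f := hFc.comp hvc
  have hfpi : ∀ θ, f (θ + Real.pi) = - f θ := by
    intro θ
    have : v (θ + Real.pi) = - v θ := by
      ext i
      simp only [v, Real.cos_add_pi, Real.sin_add_pi, Pi.neg_apply]
      ring
    simp only [f, this, hFn]
  let g : ℝ → ℝ := fun θ => f θ - f (θ + Real.pi / 3) + f (θ + Real.pi / 3 + Real.pi / 3)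
  have hgc : Continuous g := by
    simp only [g]
    fun_prop
  have hg : g (0 + Real.pi / 3) = - g 0 := by
    have : f (0 + Real.pi / 3 + Real.pi / 3 + Real.pi / 3) = - f 0 := by
      rw [← hfpi]; congr 1; ring
    simp only [g, this]
    ring
  have hzero : ∃ θ, g θ = 0 := by
    rcases le_total (g 0) 0 with h | h
    · exact mem_range_of_exists_le_of_exists_ge hgc ⟨0, h⟩ ⟨0 + Real.pi / 3, by rw [hg]; linarith⟩
    · exact mem_range_of_exists_le_of_exists_ge hgc ⟨0 + Real.pi / 3, by rw [hg]; linarith⟩ ⟨0, h⟩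
  obtain ⟨θ, hθ⟩ := hzero
  have hs3 : Real.sqrt 3 ^ 2 = 3 := Real.sq_sqrt (by norm_num)
  have hs3p : 0 < Real.sqrt 3 := by positivity
  obtain ⟨A0, h0c, h0l, h0u, h0e⟩ := hF (v θ)
  obtain ⟨A1, h1c, h1l, h1u, h1e⟩ := hF (v (θ + Real.pi / 3))
  obtain ⟨A2, h2c, h2l, h2u, h2e⟩ := hF (v (θ + Real.pi / 3 + Real.pi / 3))
  have hf1 : F (v (θ + Real.pi / 3)) = F (v θ) + F (v (θ + Real.pi / 3 + Real.pi / 3)) := by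
    simp only [g, f] at hθ
    linarith
  have hCS := Real.sin_sq_add_cos_sq θ
  have hv0 : ∀ i, v θ i = x i 0 * Real.cos θ + x i 1 * Real.sin θ := fun i => rfl
  have hv1 : ∀ i, v (θ + Real.pi / 3) i = x i 0 * (Real.cos θ / 2 - Real.sqrt 3 / 2 * Real.sin θ)
      + x i 1 * (Real.sin θ / 2 + Real.sqrt 3 / 2 * Real.cos θ) := by
    intro i
    simp only [v, Real.cos_add, Real.sin_add, Real.cos_pi_div_three, Real.sin_pi_div_three]
    ring
  have hv2 : ∀ i, v (θ + Real.pi / 3 + Real.pi / 3) i =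
      x i 0 * (- Real.cos θ / 2 - Real.sqrt 3 / 2 * Real.sin θ)
      + x i 1 * (- Real.sin θ / 2 + Real.sqrt 3 / 2 * Real.cos θ) := by
    intro i
    simp only [v, Real.cos_add, Real.sin_add, Real.cos_pi_div_three, Real.sin_pi_div_three]
    linear_combination (-(x i 0 * Real.cos θ)/4 - (x i 1 * Real.sin θ)/4) * hs3
  rw [hf1] at h1l h1u h1e
  generalize v θ = w0 at *
  generalize v (θ + Real.pi / 3) = w1 at *
  generalize v (θ + Real.pi / 3 + Real.pi / 3) = w2 at *
  generalize F w0 = f0 at *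
  generalize F w2 = f2 at *
  generalize Real.cos θ = C at *
  generalize Real.sin θ = S at *
  generalize hr : Real.sqrt 3 = r at *
  -- the centre
  obtain ⟨c0, c1, hc0, hc2⟩ : ∃ c0 c1 : ℝ, c0 * C + c1 * S = f0 ∧
      c0 * (-C / 2 - r / 2 * S) + c1 * (-S / 2 + r / 2 * C) = f2 := by
    refine ⟨C * f0 - S * (2 / r * (f2 + f0 / 2)), S * f0 + C * (2 / r * (f2 + f0 / 2)), ?_, ?_⟩
    · linear_combination f0 * hCS
    · field_simp
      linear_combination f2 * hCS * 2 * r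
  have hw1 : ∀ i, w1 i = w0 i + w2 i := by
    intro i; rw [hv0, hv1, hv2]; ring
  have hsum : ∀ i, x i 0 - c0 = C * (w0 i - f0) - S * (2 / r * ((w2 i - f2) + (w0 i - f0) / 2)) ∧
      x i 1 - c1 = S * (w0 i - f0) + C * (2 / r * ((w2 i - f2) + (w0 i - f0) / 2)) := by
    intro i
    have e0 : w0 i - f0 = (x i 0 - c0) * C + (x i 1 - c1) * S := by rw [hv0, ← hc0]; ring
    have e2 : 2 / r * ((w2 i - f2) + (w0 i - f0) / 2) = - (x i 0 - c0) * S + (x i 1 - c1) * C := by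
      rw [e0, hv2, ← hc2]; field_simp; ring
    rw [e2, e0]
    constructor
    · linear_combination (-(x i 0 - c0)) * hCS
    · linear_combination (-(x i 1 - c1)) * hCS
  -- no point at the centre
  have hnoc : ∀ i, w0 i = f0 → w2 i = f2 → False := by
    intro i hi0 hi2
    have hi1 : w1 i = f0 + f2 := by rw [hw1, hi0, hi2]
    have hq : ∃ j, j ≠ i ∧ w0 j = f0 := by
      obtain ⟨⟨j, hj, hj'⟩, ⟨k, hk, hk'⟩⟩ := h0e ⟨i, hi0⟩
      by_cases h : j = i
      · refine ⟨k, ?_, hk'⟩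
        rintro rfl
        exact hk (h ▸ hj)
      · exact ⟨j, h, hj'⟩
    have hq' : ∃ j, j ≠ i ∧ w1 j = f0 + f2 := by
      obtain ⟨⟨j, hj, hj'⟩, ⟨k, hk, hk'⟩⟩ := h1e ⟨i, hi1⟩
      by_cases h : j = i
      · refine ⟨k, ?_, hk'⟩
        rintro rfl
        exact hk (h ▸ hj)
      · exact ⟨j, h, hj'⟩
    obtain ⟨j, hji, hj⟩ := hq
    obtain ⟨k, hki, hk⟩ := hq'
    apply hx i j k hji hki
    obtain ⟨i0, i1⟩ := hsum i
    obtain ⟨j0, j1⟩ := hsum j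
    obtain ⟨k0, k1⟩ := hsum k
    have hk2 : w2 k - f2 = -(w0 k - f0) := by
      have := hw1 k
      linarith
    rw [hk2] at k0 k1
    rw [hi0, hi2] at i0 i1
    rw [hj] at j0 j1
    have i0' : x i 0 = c0 := by linarith [i0, show C * (f0 - f0) - S * (2 / r * ((f2 - f2) + (f0 - f0) / 2)) = 0 by ring]
    have i1' : x i 1 = c1 := by linarith [i1, show S * (f0 - f0) + C * (2 / r * ((f2 - f2) + (f0 - f0) / 2)) = 0 by ring]
    rw [i0', i1', j0, j1, k0, k1]
    have hC2 : C ^ 2 = 1 - S ^ 2 := by linarith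
    generalize w0 k - f0 = m
    generalize w2 j - f2 = l
    have e1 : (C * (f0 - f0) - S * (2 / r * (l + (f0 - f0) / 2))) = - S * (2 * l / r) := by ring
    have e2 : (S * (f0 - f0) + C * (2 / r * (l + (f0 - f0) / 2))) = C * (2 * l / r) := by ring
    have e3 : (C * m - S * (2 / r * (-m + m / 2))) = C * m + S * (m / r) := by ring
    have e4 : (S * m + C * (2 / r * (-m + m / 2))) = S * m - C * (m / r) := by ring
    rw [e1, e2, e3, e4]
    have e5 : (-S * (2 * l / r) * (S * m - C * (m / r)) - C * (2 * l / r) * (C * m + S * (m / r)))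
        = - (2 * l / r * m) := by
      linear_combination (-(2 * l / r * m)) * hCS
    have e6 : (-S * (2 * l / r) * (C * m + S * (m / r)) + C * (2 * l / r) * (S * m - C * (m / r)))
        = - (2 * l / r * (m / r)) := by
      linear_combination (-(2 * l / r * (m / r))) * hCS
    rw [e5, e6]
    have e7 : 3 * (-(2 * l / r * (m / r))) ^ 2 = 3 / r ^ 2 * (2 * l / r * m) ^ 2 := by ring
    rw [e7, hs3]
    ring
  obtain ⟨σ, hσ⟩ := aux_match n A0 A1 A2 h0c h1c h2c
    (by
      rintro i ⟨a0, a1, a2⟩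
      have b0 := h0l i a0
      have b1 := h1u i a1
      have b2 := h2l i a2
      rw [hw1] at b1
      exact hnoc i (by linarith) (by linarith))
    (by
      rintro i ⟨a0, a1, a2⟩
      have b0 := h0u i a0
      have b1 := h1l i a1
      have b2 := h2u i a2
      rw [hw1] at b1
      exact hnoc i (by linarith) (by linarith))
  refine ⟨!₂[c0, c1], σ, ?_⟩
  rw [← Equiv.sum_comp σ, Fintype.sum_sum_type, ← Finset.sum_add_distrib, Finset.mul_sum]
  apply Finset.sum_le_sum
  intro i _
  obtain ⟨⟨s0, s0'⟩, s1, s2⟩ := hσ i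
  generalize σ (Sum.inl i) = q at *
  generalize σ (Sum.inr i) = p at *
  have hr2 : (2 / r) ^ 2 = 4 / 3 := by rw [div_pow, hs3]; norm_num
  have hgoal := aux_geom (x p - !₂[c0, c1]) (x q - !₂[c0, c1]) (w0 p - f0) (w2 p - f2)
    (w0 q - f0) (w2 q - f2) ?_ ?_ ?_ ?_
  · rw [hr, sub_sub_sub_cancel_right] at hgoal
    rw [norm_sub_rev _ (x q), norm_sub_rev _ (x p), norm_sub_rev (x q) (x p)]
    linarith
  · simp only [PiLp.sub_apply, PiLp.toLp_apply, Matrix.cons_val_zero, Matrix.cons_val_one]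
    obtain ⟨e0, e1⟩ := hsum p
    rw [e0, e1]
    generalize w0 p - f0 = m
    generalize w2 p - f2 = l
    linear_combination (m ^ 2 + (2 / r) ^ 2 * (l + m / 2) ^ 2) * hCS + (l + m / 2) ^ 2 * hr2
  · simp only [PiLp.sub_apply, PiLp.toLp_apply, Matrix.cons_val_zero, Matrix.cons_val_one]
    obtain ⟨e0, e1⟩ := hsum q
    rw [e0, e1]
    generalize w0 q - f0 = m
    generalize w2 q - f2 = l
    linear_combination (m ^ 2 + (2 / r) ^ 2 * (l + m / 2) ^ 2) * hCS + (l + m / 2) ^ 2 * hr2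
  · simp only [PiLp.sub_apply, PiLp.toLp_apply, Matrix.cons_val_zero, Matrix.cons_val_one]
    obtain ⟨e0, e1⟩ := hsum q
    obtain ⟨e2, e3⟩ := hsum p
    rw [e0, e1, e2, e3]
    generalize w0 q - f0 = m
    generalize w2 q - f2 = l
    generalize w0 p - f0 = m'
    generalize w2 p - f2 = l'
    linear_combination (m * m' + (2 / r) ^ 2 * (l + m / 2) * (l' + m' / 2)) * hCS +
      (l + m / 2) * (l' + m' / 2) * hr2
  · have a0 := h0l q s0
    have b0 := h0u p s0'
    by_cases hp2 : p ∈ A2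
    · have b2 := h2l p hp2
      have a2 := h2u q (fun h => s2.1 h hp2)
      by_cases hp1 : p ∈ A1
      · have b1 := h1l p hp1
        have a1 := h1u q (fun h => s1.1 h hp1)
        rw [hw1] at a1 b1
        right; right
        refine ⟨?_, ?_, ?_, ?_, ?_, ?_⟩ <;> linarith
      · have b1 := h1u p hp1
        have a1 := h1l q (s1.2 hp1)
        rw [hw1] at a1 b1
        right; left
        refine ⟨?_, ?_, ?_, ?_, ?_, ?_⟩ <;> linarith
    · have b2 := h2u p hp2
      have a2 := h2l q (s2.2 hp2)
      left
      refine ⟨?_, ?_, ?_, ?_⟩ <;> linarith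

theorem aux_roots (a b c d p q : ℝ) (hp : p ≠ 0) (hq : q ≠ 0) :
    {t : ℝ | ((a + t * p) * d - b * (c + t * q)) ^ 2 =
      3 * ((a + t * p) * (c + t * q) + b * d) ^ 2}.Finite := by
  let P : Polynomial ℝ :=
    ((Polynomial.C a + Polynomial.X * Polynomial.C p) * Polynomial.C d
      - Polynomial.C b * (Polynomial.C c + Polynomial.X * Polynomial.C q)) ^ 2
    - Polynomial.C 3 * ((Polynomial.C a + Polynomial.X * Polynomial.C p) *
      (Polynomial.C c + Polynomial.X * Polynomial.C q) + Polynomial.C (b * d)) ^ 2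
  have hP : P ≠ 0 := by
    intro h
    have h4 : P.coeff 4 = -3 * (p * q) ^ 2 := by
      simp only [P]
      compute_degree
      · ring
      all_goals norm_num
    rw [h, Polynomial.coeff_zero] at h4
    have : p * q ≠ 0 := mul_ne_zero hp hq
    have : (p * q) ^ 2 ≠ 0 := pow_ne_zero _ this
    apply this
    linarith
  apply (Polynomial.finite_setOf_isRoot hP).subset
  intro t ht
  simp only [Set.mem_setOf_eq] at ht
  simp only [P, Set.mem_setOf_eq, Polynomial.IsRoot.def, Polynomial.eval_sub, Polynomial.eval_pow,
    Polynomial.eval_mul, Polynomial.eval_add, Polynomial.eval_C, Polynomial.eval_X]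
  linarith

/-- Suri's conjecture, theorem of Fekete and Meijer: for a max-sum
matching `M = {a_i b_i}` of 2n points in the plane, the minimum Steiner star cost
`t(S) = min_y ∑_{x ∈ S} ‖y - x‖` satisfies `t(S) ≤ (2/√3) · cost(M)`. -/
theorem steiner_star_le_max_sum_matching (n : ℕ) (a b : Fin n → EuclideanSpace ℝ (Fin 2))
    (hmax : ∀ σ : Equiv.Perm (Fin n ⊕ Fin n),
      ∑ i : Fin n, ‖Sum.elim a b (σ (Sum.inl i)) - Sum.elim a b (σ (Sum.inr i))‖
        ≤ ∑ i : Fin n, ‖a i - b i‖) :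
    (⨅ y : EuclideanSpace ℝ (Fin 2), ∑ i : Fin n, (‖y - a i‖ + ‖y - b i‖))
      ≤ (2 / Real.sqrt 3) * ∑ i : Fin n, ‖a i - b i‖ := by
  rcases Nat.eq_zero_or_pos n with rfl | hn
  · simp
  have hbdd : BddBelow (Set.range
      (fun y : EuclideanSpace ℝ (Fin 2) => ∑ i : Fin n, (‖y - a i‖ + ‖y - b i‖))) := by
    refine ⟨0, ?_⟩
    rintro _ ⟨y, rfl⟩
    positivity
  let w : Fin n ⊕ Fin n → ℝ := fun i => ((finSumFinEquiv i : Fin (n + n)) : ℕ)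
  have hw : ∀ i j, j ≠ i → w j - w i ≠ 0 := by
    intro i j hij h
    apply hij
    have : (((finSumFinEquiv j : Fin (n + n)) : ℕ) : ℝ) = ((finSumFinEquiv i : Fin (n + n)) : ℕ) :=
      sub_eq_zero.1 h
    exact finSumFinEquiv.injective (Fin.ext (Nat.cast_injective this))
  let z : Fin n ⊕ Fin n → EuclideanSpace ℝ (Fin 2) := Sum.elim a b
  let x : ℝ → Fin n ⊕ Fin n → EuclideanSpace ℝ (Fin 2) := fun t i => z i + t • !₂[w i, 0]
  let W : ℝ := ∑ i, ‖(!₂[w i, 0] : EuclideanSpace ℝ (Fin 2))‖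
  have hfin : (⋃ i, ⋃ j, ⋃ k, {t : ℝ | j ≠ i ∧ k ≠ i ∧
      ((x t j 0 - x t i 0) * (x t k 1 - x t i 1) - (x t j 1 - x t i 1) * (x t k 0 - x t i 0)) ^ 2 =
      3 * ((x t j 0 - x t i 0) * (x t k 0 - x t i 0)
        + (x t j 1 - x t i 1) * (x t k 1 - x t i 1)) ^ 2}).Finite := by
    refine Set.finite_iUnion fun i => Set.finite_iUnion fun j => Set.finite_iUnion fun k => ?_
    by_cases hj : j = i
    · simp [hj]
    by_cases hk : k = i
    · simp [hk]
    apply (aux_roots (z j 0 - z i 0) (z j 1 - z i 1) (z k 0 - z i 0) (z k 1 - z i 1)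
      (w j - w i) (w k - w i) (hw i j hj) (hw i k hk)).subset
    rintro t ⟨-, -, ht⟩
    simp only [x, PiLp.add_apply, PiLp.smul_apply, PiLp.toLp_apply, Matrix.cons_val_zero,
      Matrix.cons_val_one, smul_eq_mul, mul_zero, add_zero] at ht
    simp only [Set.mem_setOf_eq]
    convert ht using 2 <;> ring
  have hW : 0 ≤ W := by positivity
  have hs : 0 < 2 / Real.sqrt 3 := by positivity
  have main : ∀ δ > 0, (⨅ y : EuclideanSpace ℝ (Fin 2), ∑ i : Fin n, (‖y - a i‖ + ‖y - b i‖))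
      ≤ (2 / Real.sqrt 3) * ∑ i : Fin n, ‖a i - b i‖ + δ * (W + 2 / Real.sqrt 3 * W) := by
    intro δ hδ
    obtain ⟨t, ⟨ht0, htδ⟩, ht⟩ := ((Set.Ioo_infinite hδ).diff hfin).nonempty
    simp only [Set.mem_iUnion, Set.mem_setOf_eq, not_exists, not_and] at ht
    obtain ⟨c, σ, hcσ⟩ := aux_generic n hn (x t) ht
    have hd : ∀ i, ‖x t i - z i‖ = t * ‖(!₂[w i, 0] : EuclideanSpace ℝ (Fin 2))‖ := by
      intro i
      simp only [x, add_sub_cancel_left, norm_smul, Real.norm_eq_abs, abs_of_pos ht0]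
    have h1 : (⨅ y : EuclideanSpace ℝ (Fin 2), ∑ i : Fin n, (‖y - a i‖ + ‖y - b i‖))
        ≤ ∑ i, ‖c - z i‖ := by
      refine (ciInf_le hbdd c).trans ?_
      rw [Fintype.sum_sum_type, ← Finset.sum_add_distrib]
      exact le_rfl
    have h2 : ∑ i, ‖c - z i‖ ≤ ∑ i, ‖c - x t i‖ + t * W := by
      rw [Finset.mul_sum, ← Finset.sum_add_distrib]
      apply Finset.sum_le_sum
      intro i _
      rw [← hd]
      exact norm_sub_le_norm_sub_add_norm_sub _ _ _
    have h3 : ∑ i : Fin n, ‖x t (σ (Sum.inl i)) - x t (σ (Sum.inr i))‖ ≤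
        ∑ i : Fin n, ‖a i - b i‖ + t * W := by
      have e : t * W = ∑ i : Fin n, (‖x t (σ (Sum.inl i)) - z (σ (Sum.inl i))‖ +
          ‖x t (σ (Sum.inr i)) - z (σ (Sum.inr i))‖) := by
        rw [Finset.mul_sum, ← Equiv.sum_comp σ, Fintype.sum_sum_type, ← Finset.sum_add_distrib]
        simp only [hd]
      refine le_trans ?_ (add_le_add_left (hmax σ) _)
      rw [e, ← Finset.sum_add_distrib]
      apply Finset.sum_le_sum
      intro i _
      have := norm_sub_le_norm_sub_add_norm_sub (x t (σ (Sum.inl i))) (z (σ (Sum.inl i)))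
        (x t (σ (Sum.inr i)))
      have h' := norm_sub_le_norm_sub_add_norm_sub (z (σ (Sum.inl i))) (z (σ (Sum.inr i)))
        (x t (σ (Sum.inr i)))
      rw [norm_sub_rev (z (σ (Sum.inr i)))] at h'
      simp only [z] at *
      linarith
    have h4 := mul_le_mul_of_nonneg_left h3 hs.le
    have h5 : t * (W + 2 / Real.sqrt 3 * W) ≤ δ * (W + 2 / Real.sqrt 3 * W) :=
      mul_le_mul_of_nonneg_right htδ.le (by positivity)
    linarith
  have hK : 0 < W + 2 / Real.sqrt 3 * W + 1 := by positivity
  apply le_of_forall_pos_le_add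
  intro ε hε
  refine (main (ε / (W + 2 / Real.sqrt 3 * W + 1)) (by positivity)).trans ?_
  have : ε / (W + 2 / Real.sqrt 3 * W + 1) * (W + 2 / Real.sqrt 3 * W) ≤ ε := by
    rw [div_mul_eq_mul_div, div_le_iff₀ hK]
    apply mul_le_mul_of_nonneg_left _ hε.le
    linarith
  linarith
end

section
/- For any even set of 2n points in the Euclidean plane ℝ², there exists a perfect matching M of the points and a point o ∈ ℝ² such that for every matched pair xy ∈ M, either o ∈ {x,y} or the angle ∠xoy is at least 2π/3. -/
section
open Finset

theorem comb_aux {ι : Type*} [DecidableEq ι] (s0 s1 s2 : ι → ℤ)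
    (h0 : ∀ x, s0 x = 1 ∨ s0 x = -1) (h1 : ∀ x, s1 x = 1 ∨ s1 x = -1)
    (h2 : ∀ x, s2 x = 1 ∨ s2 x = -1) (S : Finset ι) (hS : S.Nonempty)
    (z0 : ∑ x ∈ S, s0 x = 0) (z1 : ∑ x ∈ S, s1 x = 0) (z2 : ∑ x ∈ S, s2 x = 0) :
    (∃ x ∈ S, ∃ y ∈ S, s0 x = - s0 y ∧ s1 x = - s1 y ∧ s2 x = - s2 y) ∨
    (∃ e : ℤ, (e = 1 ∨ e = -1) ∧ ∃ a ∈ S, ∃ b ∈ S, ∃ c ∈ S, ∃ d ∈ S,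
      (s0 a = e ∧ s1 a = e ∧ s2 a = e) ∧ (s0 b = e ∧ s1 b = -e ∧ s2 b = -e) ∧
      (s0 c = -e ∧ s1 c = e ∧ s2 c = -e) ∧ (s0 d = -e ∧ s1 d = -e ∧ s2 d = e)) := by
  -- for every sign vector (p,q,r), the sum of its signed indicator is determined
  have key : ∀ p q r : ℤ, (p = 1 ∨ p = -1) → (q = 1 ∨ q = -1) → (r = 1 ∨ r = -1) →
      ∑ x ∈ S, (p * s0 x + q * s1 x + r * s2 x + p * q * r * (s0 x * s1 x * s2 x)) =
        p * q * r * ∑ x ∈ S, s0 x * s1 x * s2 x := by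
    intro p q r _ _ _
    simp only [Finset.sum_add_distrib, ← Finset.mul_sum, z0, z1, z2]
    ring
  have pos : ∀ p q r : ℤ, (p = 1 ∨ p = -1) → (q = 1 ∨ q = -1) → (r = 1 ∨ r = -1) →
      0 < p * q * r * ∑ x ∈ S, s0 x * s1 x * s2 x →
      ∃ x ∈ S, s0 x = p ∧ s1 x = q ∧ s2 x = r := by
    intro p q r hp hq hr hpos
    rw [← key p q r hp hq hr] at hpos
    obtain ⟨x, hx, hlt⟩ := Finset.exists_lt_of_sum_lt (s := S) (f := fun _ => (0:ℤ)) (by simpa using hpos)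
    refine ⟨x, hx, ?_⟩
    rcases h0 x with a | a <;> rcases h1 x with b | b <;> rcases h2 x with c | c <;>
      rcases hp with rfl | rfl <;> rcases hq with rfl | rfl <;> rcases hr with rfl | rfl <;>
      simp [a, b, c] at hlt ⊢
  rcases lt_trichotomy 0 (∑ x ∈ S, s0 x * s1 x * s2 x) with h | h | h
  · right
    refine ⟨1, Or.inl rfl, ?_⟩
    obtain ⟨a, ha, ha'⟩ := pos 1 1 1 (by simp) (by simp) (by simp) (by linarith)
    obtain ⟨b, hb, hb'⟩ := pos 1 (-1) (-1) (by simp) (by simp) (by simp) (by linarith)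
    obtain ⟨c, hc, hc'⟩ := pos (-1) 1 (-1) (by simp) (by simp) (by simp) (by linarith)
    obtain ⟨d, hd, hd'⟩ := pos (-1) (-1) 1 (by simp) (by simp) (by simp) (by linarith)
    exact ⟨a, ha, b, hb, c, hc, d, hd, ha', hb', hc', hd'⟩
  · left
    obtain ⟨x, hx⟩ := hS
    by_contra hno
    push Not at hno
    have k := key (s0 x) (s1 x) (s2 x) (h0 x) (h1 x) (h2 x)
    rw [← h, mul_zero] at k
    have : 0 < ∑ y ∈ S, (s0 x * s0 y + s1 x * s1 y + s2 x * s2 y +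
        s0 x * s1 x * s2 x * (s0 y * s1 y * s2 y)) := by
      apply Finset.sum_pos'
      · intro y hy
        have := hno x hx y hy
        rcases h0 x with a | a <;> rcases h1 x with b | b <;> rcases h2 x with c | c <;>
          rcases h0 y with a' | a' <;> rcases h1 y with b' | b' <;> rcases h2 y with c' | c' <;>
          simp [a, b, c, a', b', c'] at this ⊢
      · refine ⟨x, hx, ?_⟩
        rcases h0 x with a | a <;> rcases h1 x with b | b <;> rcases h2 x with c | c <;>
          simp [a, b, c]
    omega
  · right
    refine ⟨-1, Or.inr rfl, ?_⟩
    obtain ⟨a, ha, ha'⟩ := pos (-1) (-1) (-1) (by simp) (by simp) (by simp) (by linarith)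
    obtain ⟨b, hb, hb'⟩ := pos (-1) 1 1 (by simp) (by simp) (by simp) (by linarith)
    obtain ⟨c, hc, hc'⟩ := pos 1 (-1) 1 (by simp) (by simp) (by simp) (by linarith)
    obtain ⟨d, hd, hd'⟩ := pos 1 1 (-1) (by simp) (by simp) (by simp) (by linarith)
    exact ⟨a, ha, b, hb, c, hc, d, hd, by simpa using ha', by simpa using hb',
      by simpa using hc', by simpa using hd'⟩

theorem comb {ι : Type*} [DecidableEq ι] (R : ι → ι → Prop) (s0 s1 s2 : ι → ℤ)
    (h0 : ∀ x, s0 x = 1 ∨ s0 x = -1) (h1 : ∀ x, s1 x = 1 ∨ s1 x = -1)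
    (h2 : ∀ x, s2 x = 1 ∨ s2 x = -1)
    (H1 : ∀ x y, s0 x = - s0 y → s1 x = - s1 y → s2 x = - s2 y → R x y)
    (H2 : ∀ e : ℤ, (e = 1 ∨ e = -1) → ∀ a b c d,
      (s0 a = e ∧ s1 a = e ∧ s2 a = e) → (s0 b = e ∧ s1 b = -e ∧ s2 b = -e) →
      (s0 c = -e ∧ s1 c = e ∧ s2 c = -e) → (s0 d = -e ∧ s1 d = -e ∧ s2 d = e) →
      (R a b ∧ R c d) ∨ (R a c ∧ R b d) ∨ (R a d ∧ R b c)) :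
    ∀ (S : Finset ι), 
    ∑ x ∈ S, s0 x = 0 → ∑ x ∈ S, s1 x = 0 → ∑ x ∈ S, s2 x = 0 →
    ∃ l : List (ι × ι), 2 * l.length = S.card ∧ (∀ x ∈ S, ∃ q ∈ l, x = q.1 ∨ x = q.2) ∧
      ∀ q ∈ l, R q.1 q.2 := by
  intro S
  induction S using Finset.strongInduction with
  | H S ih =>
    intro z0 z1 z2
    rcases S.eq_empty_or_nonempty with rfl | hS
    · exact ⟨[], by simp⟩
    -- remove a balanced subset
    have rem : ∀ T ⊆ S, T.Nonempty → ∑ x ∈ T, s0 x = 0 → ∑ x ∈ T, s1 x = 0 →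
        ∑ x ∈ T, s2 x = 0 → 
        (∃ l : List (ι × ι), 2 * l.length = T.card ∧ (∀ x ∈ T, ∃ q ∈ l, x = q.1 ∨ x = q.2) ∧
          ∀ q ∈ l, R q.1 q.2) → 
        ∃ l : List (ι × ι), 2 * l.length = S.card ∧ (∀ x ∈ S, ∃ q ∈ l, x = q.1 ∨ x = q.2) ∧
          ∀ q ∈ l, R q.1 q.2 := by
      rintro T hT hTn t0 t1 t2 ⟨l, l1, l2, l3⟩
      have e0 := Finset.sum_sdiff (f := s0) hT
      have e1 := Finset.sum_sdiff (f := s1) hT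
      have e2 := Finset.sum_sdiff (f := s2) hT
      obtain ⟨l', l1', l2', l3'⟩ := ih (S \ T) (Finset.sdiff_ssubset hT hTn)
        (by omega) (by omega) (by omega)
      have hc := Finset.card_sdiff_add_card_eq_card hT
      refine ⟨l ++ l', by rw [List.length_append]; omega, ?_, ?_⟩
      · intro x hx
        by_cases hxT : x ∈ T
        · obtain ⟨q, hq, h⟩ := l2 x hxT
          exact ⟨q, by simp [hq], h⟩
        · obtain ⟨q, hq, h⟩ := l2' x (by simp [hx, hxT])
          exact ⟨q, by simp [hq], h⟩
      · intro q hq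
        rcases List.mem_append.1 hq with h | h
        · exact l3 q h
        · exact l3' q h
    rcases comb_aux s0 s1 s2 h0 h1 h2 S hS z0 z1 z2 with
      ⟨x, hx, y, hy, g0, g1, g2⟩ | ⟨e, he, a, ha, b, hb, c, hc, d, hd, ga, gb, gc, gd⟩
    · have hxy : x ≠ y := by
        rintro rfl
        rcases h0 x with h | h <;> omega
      refine rem {x, y} (by simp [Finset.insert_subset_iff, hx, hy]) (by simp) ?_ ?_ ?_ ?_
      · rw [Finset.sum_pair hxy]; omega
      · rw [Finset.sum_pair hxy]; omega
      · rw [Finset.sum_pair hxy]; omega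
      · refine ⟨[(x, y)], by simp [Finset.card_pair hxy], by simp, by simpa using H1 x y g0 g1 g2⟩
    · have he0 : e ≠ -e := by omega
      have hab : a ≠ b := by rintro rfl; omega
      have hac : a ≠ c := by rintro rfl; omega
      have had : a ≠ d := by rintro rfl; omega
      have hbc : b ≠ c := by rintro rfl; omega
      have hbd : b ≠ d := by rintro rfl; omega
      have hcd : c ≠ d := by rintro rfl; omega
      have hsum : ∀ f : ι → ℤ, ∑ x ∈ {a, b, c, d}, f x = f a + (f b + (f c + f d)) := by
        intro f
        rw [Finset.sum_insert (by simp [*]), Finset.sum_insert (by simp [*]), Finset.sum_pair hcd]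
      have hcard : ({a, b, c, d} : Finset ι).card = 4 := by
        rw [Finset.card_insert_of_notMem (by simp [*]), Finset.card_insert_of_notMem (by simp [*]),
          Finset.card_pair hcd]
      refine rem {a, b, c, d} (by simp [Finset.insert_subset_iff, *]) (by simp) ?_ ?_ ?_ ?_
      · rw [hsum]; omega
      · rw [hsum]; omega
      · rw [hsum]; omega
      · rcases H2 e he a b c d ga gb gc gd with ⟨r, r'⟩ | ⟨r, r'⟩ | ⟨r, r'⟩
        · exact ⟨[(a, b), (c, d)], by simp [hcard], by simp, by simp [r, r']⟩
        · exact ⟨[(a, c), (b, d)], by simp [hcard], by simp, by simp [r, r']⟩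
        · exact ⟨[(a, d), (b, c)], by simp [hcard], by simp, by simp [r, r']⟩

theorem exists_kth {ι : Type*} [Fintype ι] (n : ℕ) (hn : 0 < n)
    (hc : n ≤ Fintype.card ι) :
    ∃ U : (ι → ℝ) → ℝ, Continuous U ∧ ∀ y, (univ.filter fun i => U y < y i).card < n ∧
      n ≤ (univ.filter fun i => U y ≤ y i).card := by
  classical
  have : Nonempty (Fin n) := ⟨⟨0, hn⟩⟩
  have : Nonempty (Fin n ↪ ι) := Function.Embedding.nonempty_of_card_le (by simpa using hc)
  refine ⟨fun y => (univ : Finset (Fin n ↪ ι)).sup' univ_nonempty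
    fun e => (univ : Finset (Fin n)).inf' univ_nonempty fun i => y (e i), ?_, ?_⟩
  · apply Continuous.finset_sup'_apply
    intro e _
    apply Continuous.finset_inf'_apply
    intro i _
    fun_prop
  · intro y
    set u := (univ : Finset (Fin n ↪ ι)).sup' univ_nonempty
      fun e => (univ : Finset (Fin n)).inf' univ_nonempty fun i => y (e i) with hu
    constructor
    · by_contra! h
      obtain ⟨T, hT, hTc⟩ := Finset.exists_subset_card_eq h
      let e : Fin n ↪ ι := (T.equivFinOfCardEq hTc).symm.toEmbedding.trans (Function.Embedding.subtype _)
      have he : ∀ i, u < y (e i) := fun i => by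
        have : e i ∈ T := ((T.equivFinOfCardEq hTc).symm i).2
        exact (Finset.mem_filter.1 (hT this)).2
      have h1 : u < (univ : Finset (Fin n)).inf' univ_nonempty fun i => y (e i) := by
        rw [Finset.lt_inf'_iff]; exact fun i _ => he i
      have h2 := Finset.le_sup' (s := (univ : Finset (Fin n ↪ ι)))
        (fun e => (univ : Finset (Fin n)).inf' univ_nonempty fun i => y (e i)) (mem_univ e)
      exact absurd (h1.trans_le h2) (lt_irrefl _)
    · obtain ⟨e, _, he⟩ := Finset.exists_mem_eq_sup' (univ_nonempty (α := Fin n ↪ ι))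
        (fun e => (univ : Finset (Fin n)).inf' univ_nonempty fun i => y (e i))
      rw [← hu] at he
      have : (univ.map e) ⊆ univ.filter fun i => u ≤ y i := by
        intro x hx
        obtain ⟨i, _, rfl⟩ := Finset.mem_map.1 hx
        simp only [mem_filter, mem_univ, true_and]
        rw [he]
        exact Finset.inf'_le _ (mem_univ i)
      have h3 := Finset.card_le_card this
      rw [Finset.card_map, Finset.card_univ, Fintype.card_fin] at h3
      exact h3

theorem exists_median {ι : Type*} [Fintype ι] (n : ℕ) (hn : 0 < n)
    (hc : Fintype.card ι = 2 * n) :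
    ∃ m : (ι → ℝ) → ℝ, Continuous m ∧ (∀ y, m (-y) = - m y) ∧
      ∀ y, ∃ s : ι → ℤ, (∀ i, s i = 1 ∨ s i = -1) ∧ ∑ i, s i = 0 ∧
        ∀ i, 0 ≤ s i * (y i - m y) := by
  classical
  obtain ⟨U, hU, hU'⟩ := exists_kth (ι := ι) n hn (by omega)
  refine ⟨fun y => (U y - U (-y)) / 2, by fun_prop, fun y => by simp; ring, fun y => ?_⟩
  obtain ⟨p1, p2⟩ := hU' y
  obtain ⟨q1, q2⟩ := hU' (-y)
  set u := U y
  set v := U (-y)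
  simp only [Pi.neg_apply] at q1 q2
  have compl : ∀ t : ℝ, (univ.filter fun i => t < y i).card + (univ.filter fun i => y i ≤ t).card = 2 * n := by
    intro t
    have := Finset.card_filter_add_card_filter_not (s := (univ : Finset ι)) (fun i => t < y i)
    simpa [hc] using this
  have compl' : ∀ t : ℝ, (univ.filter fun i => t ≤ y i).card + (univ.filter fun i => y i < t).card = 2 * n := by
    intro t
    have := Finset.card_filter_add_card_filter_not (s := (univ : Finset ι)) (fun i => t ≤ y i)
    simpa [hc] using this
  have q1' : (univ.filter fun i => y i < -v).card < n := by
    convert q1 using 3; constructor <;> intro <;> linarith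
  have q2' : n ≤ (univ.filter fun i => y i ≤ -v).card := by
    convert q2 using 3; constructor <;> intro <;> linarith
  have huv : -v ≤ u := by
    by_contra! h
    have h1 : (univ.filter fun i => -v ≤ y i) ⊆ univ.filter fun i => u < y i :=
      Finset.monotone_filter_right _ fun i _ hi => lt_of_lt_of_le h hi
    have := Finset.card_le_card h1
    have := compl' (-v)
    omega
  obtain ⟨P, P1, P2, P3⟩ := Finset.exists_subsuperset_card_eq (n := n)
    (s := univ.filter fun i => (u - v) / 2 < y i) (t := univ.filter fun i => (u - v) / 2 ≤ y i)
    (Finset.monotone_filter_right _ fun i _ hi => le_of_lt hi)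
    (by
      have h1 : (univ.filter fun i => (u - v) / 2 < y i) ⊆ univ.filter fun i => -v < y i :=
        Finset.monotone_filter_right _ fun i _ hi => lt_of_le_of_lt (by linarith) hi
      have := Finset.card_le_card h1
      have := compl (-v)
      omega)
    (by
      have h1 : (univ.filter fun i => u ≤ y i) ⊆ univ.filter fun i => (u - v) / 2 ≤ y i :=
        Finset.monotone_filter_right _ fun i _ hi => le_trans (by linarith) hi
      have := Finset.card_le_card h1
      omega)
  refine ⟨fun i => if i ∈ P then 1 else -1, fun i => by by_cases h : i ∈ P <;> simp [h], ?_, ?_⟩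
  · rw [Finset.sum_ite]
    have h1 : (univ.filter fun i => i ∈ P) = P := by ext; simp
    have h2 : (univ.filter fun i => i ∉ P) = Pᶜ := by ext; simp
    have h3 := Finset.card_compl_add_card P
    rw [h1, h2]
    simp only [sum_const, nsmul_eq_mul]
    rw [hc] at h3
    push_cast
    omega
  · intro i
    by_cases h : i ∈ P
    · have := P2 h
      simp at this
      simp [h]; linarith
    · have : ¬ ((u - v) / 2 < y i) := fun hh => h (P1 (by simpa using hh))
      simp [h]; linarith

end

theorem opp_alg (x0 x1 x2 y0 y1 y2 r t : ℝ) (hx : x0 + x1 + x2 = 0) (hy : y0 + y1 + y2 = 0)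
    (hr : 0 ≤ r) (ht : 0 ≤ t) (hr2 : r ^ 2 = x0 ^ 2 + x1 ^ 2 + x2 ^ 2)
    (ht2 : t ^ 2 = y0 ^ 2 + y1 ^ 2 + y2 ^ 2)
    (a1 : x1 ≤ 0) (a2 : x2 ≤ 0) (b1 : 0 ≤ y1) (b2 : 0 ≤ y2) :
    x0 * y0 + x1 * y1 + x2 * y2 ≤ -(1 / 2) * (r * t) := by
  obtain ⟨α, rfl⟩ : ∃ α, x1 = -α := ⟨-x1, by ring⟩
  obtain ⟨β, rfl⟩ : ∃ β, x2 = -β := ⟨-x2, by ring⟩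
  have hα : 0 ≤ α := by linarith
  have hβ : 0 ≤ β := by linarith
  obtain rfl : x0 = α + β := by linarith
  obtain rfl : y0 = -(y1 + y2) := by linarith
  have h : r * t ≤ 2 * (2 * α * y1 + 2 * β * y2 + α * y2 + β * y1) := by
    apply abs_le_of_sq_le_sq' _ (by positivity) |>.2
    have e : (2 * (2 * α * y1 + 2 * β * y2 + α * y2 + β * y1)) ^ 2 - r ^ 2 * t ^ 2 =
      12 * (α ^ 2 * y1 ^ 2 + α ^ 2 * (y1 * y2) + β ^ 2 * y2 ^ 2 + β ^ 2 * (y1 * y2)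
        + α * β * y1 ^ 2 + α * β * y2 ^ 2 + 3 * (α * β * (y1 * y2))) := by
      rw [hr2, ht2]; ring
    have : 0 ≤ 12 * (α ^ 2 * y1 ^ 2 + α ^ 2 * (y1 * y2) + β ^ 2 * y2 ^ 2 + β ^ 2 * (y1 * y2)
        + α * β * y1 ^ 2 + α * β * y2 ^ 2 + 3 * (α * β * (y1 * y2))) := by positivity
    rw [mul_pow]; linarith
  linarith

theorem same_alg (x0 x1 x2 r : ℝ) (hx : x0 + x1 + x2 = 0) 
    (hr2 : r ^ 2 = x0 ^ 2 + x1 ^ 2 + x2 ^ 2)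
    (a0 : 0 ≤ x0) (a1 : 0 ≤ x1) (a2 : 0 ≤ x2) : x0 = 0 ∧ x1 = 0 ∧ x2 = 0 ∧ r = 0 := by
  have h0 : x0 = 0 := by linarith
  have h1 : x1 = 0 := by linarith
  have h2 : x2 = 0 := by linarith
  subst h0 h1 h2
  refine ⟨rfl, rfl, rfl, ?_⟩
  simpa using hr2

/-- opposite sign vectors -/
theorem opp_all (x0 x1 x2 y0 y1 y2 r t : ℝ) (s0 s1 s2 : ℤ)
    (hx : x0 + x1 + x2 = 0) (hy : y0 + y1 + y2 = 0)
    (hr : 0 ≤ r) (ht : 0 ≤ t) (hr2 : r ^ 2 = x0 ^ 2 + x1 ^ 2 + x2 ^ 2)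
    (ht2 : t ^ 2 = y0 ^ 2 + y1 ^ 2 + y2 ^ 2)
    (h0 : s0 = 1 ∨ s0 = -1) (h1 : s1 = 1 ∨ s1 = -1) (h2 : s2 = 1 ∨ s2 = -1)
    (a0 : 0 ≤ s0 * x0) (a1 : 0 ≤ s1 * x1) (a2 : 0 ≤ s2 * x2)
    (b0 : s0 * y0 ≤ 0) (b1 : s1 * y1 ≤ 0) (b2 : s2 * y2 ≤ 0) :
    x0 * y0 + x1 * y1 + x2 * y2 ≤ -(1 / 2) * (r * t) := by
  rcases h0 with rfl | rfl <;> rcases h1 with rfl | rfl <;> rcases h2 with rfl | rfl <;>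
    push_cast at * <;> simp only [one_mul, neg_mul, neg_nonneg, neg_nonpos] at a0 a1 a2 b0 b1 b2
  · obtain ⟨rfl, rfl, rfl, rfl⟩ := same_alg x0 x1 x2 r hx hr2 a0 a1 a2
    simp
  · have := opp_alg y2 y0 y1 x2 x0 x1 t r (by linarith) (by linarith) ht hr (by linarith) (by linarith) b0 b1 a0 a1
    linarith
  · have := opp_alg y1 y0 y2 x1 x0 x2 t r (by linarith) (by linarith) ht hr (by linarith) (by linarith) b0 b2 a0 a2
    linarith
  · have := opp_alg x0 x1 x2 y0 y1 y2 r t (by linarith) (by linarith) hr ht (by linarith) (by linarith) a1 a2 b1 b2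
    linarith
  · have := opp_alg y0 y1 y2 x0 x1 x2 t r (by linarith) (by linarith) ht hr (by linarith) (by linarith) b1 b2 a1 a2
    linarith
  · have := opp_alg x1 x0 x2 y1 y0 y2 r t (by linarith) (by linarith) hr ht (by linarith) (by linarith) a0 a2 b0 b2
    linarith
  · have := opp_alg x2 x0 x1 y2 y0 y1 r t (by linarith) (by linarith) hr ht (by linarith) (by linarith) a0 a1 b0 b1
    linarith
  · obtain ⟨rfl, rfl, rfl, rfl⟩ := same_alg y0 y1 y2 t hy ht2 b0 b1 b2
    simp

theorem cross_zero (x0 x1 x2 y0 y1 y2 r t : ℝ) (hx : x0 + x1 + x2 = 0) (hy : y0 + y1 + y2 = 0)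
    (hr : 0 ≤ r) (ht : 0 ≤ t) (hr2 : r ^ 2 = x0 ^ 2 + x1 ^ 2 + x2 ^ 2)
    (ht2 : t ^ 2 = y0 ^ 2 + y1 ^ 2 + y2 ^ 2)
    (a1 : x1 ≤ 0) (a2 : x2 ≤ 0) (b0 : y0 ≤ 0) (b2 : y2 ≤ 0) :
    0 ≤ x0 * y1 - x1 * y0 ∧
    (x0 * y1 - x1 * y0 = 0 → x0 * y0 + x1 * y1 + x2 * y2 ≤ -(1 / 2) * (r * t)) := by
  obtain ⟨α, rfl⟩ : ∃ α, x1 = -α := ⟨-x1, by ring⟩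
  obtain ⟨β, rfl⟩ : ∃ β, x2 = -β := ⟨-x2, by ring⟩
  have hα : 0 ≤ α := by linarith
  have hβ : 0 ≤ β := by linarith
  obtain rfl : x0 = α + β := by linarith
  obtain ⟨γ, rfl⟩ : ∃ α, y0 = -α := ⟨-y0, by ring⟩
  obtain ⟨δ, rfl⟩ : ∃ β, y2 = -β := ⟨-y2, by ring⟩
  have hγ : 0 ≤ γ := by linarith
  have hδ : 0 ≤ δ := by linarith
  obtain rfl : y1 = γ + δ := by linarith
  have e : (α + β) * (γ + δ) - -α * -γ = α * δ + β * γ + β * δ := by ring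
  have p1 : 0 ≤ α * δ := by positivity
  have p2 : 0 ≤ β * γ := by positivity
  have p3 : 0 ≤ β * δ := by positivity
  rw [e]
  refine ⟨by positivity, fun h => ?_⟩
  have q1 : α * δ = 0 := by linarith
  have q2 : β * γ = 0 := by linarith
  have q3 : β * δ = 0 := by linarith
  have h : r * t ≤ 2 * (2 * α * γ) := by
    apply abs_le_of_sq_le_sq' _ (by positivity) |>.2
    have e : (2 * (2 * α * γ)) ^ 2 - r ^ 2 * t ^ 2 =
        16 * (α * γ) ^ 2 - 4 * (α ^ 2 + β ^ 2 + α * β) * (γ ^ 2 + δ ^ 2 + γ * δ) := by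
      rw [hr2, ht2]; ring
    have e2 : 4 * (α ^ 2 + β ^ 2 + α * β) * (γ ^ 2 + δ ^ 2 + γ * δ) = 4 * (α * γ) ^ 2 := by
      linear_combination (4 * (α * δ + α * γ + β * δ)) * q1 + (4 * (β * γ + α * γ + β * δ)) * q2 + 4 * (β * δ + α * γ) * q3
    have e3 := sq_nonneg (α * γ)
    rw [e2] at e
    rw [mul_pow]; linarith
  have e4 : (α + β) * -γ + -α * (γ + δ) + -β * -δ = -(2 * α * γ) - α * δ - β * γ + β * δ := by ring
  rw [e4, q1, q2, q3]; linarith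

theorem triple_alg (x0 x1 x2 y0 y1 y2 z0 z1 z2 r t q : ℝ)
    (hx : x0 + x1 + x2 = 0) (hy : y0 + y1 + y2 = 0) (hz : z0 + z1 + z2 = 0)
    (hr : 0 ≤ r) (ht : 0 ≤ t) (hq : 0 ≤ q) (hr2 : r ^ 2 = x0 ^ 2 + x1 ^ 2 + x2 ^ 2)
    (ht2 : t ^ 2 = y0 ^ 2 + y1 ^ 2 + y2 ^ 2) (hq2 : q ^ 2 = z0 ^ 2 + z1 ^ 2 + z2 ^ 2)
    (a1 : x1 ≤ 0) (a2 : x2 ≤ 0) (b0 : y0 ≤ 0) (b2 : y2 ≤ 0) (c0 : z0 ≤ 0) (c1 : z1 ≤ 0) :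
    x0 * y0 + x1 * y1 + x2 * y2 ≤ -(1 / 2) * (r * t) ∨
    x0 * z0 + x1 * z1 + x2 * z2 ≤ -(1 / 2) * (r * q) ∨
    y0 * z0 + y1 * z1 + y2 * z2 ≤ -(1 / 2) * (t * q) := by
  by_contra! hcon
  obtain ⟨n1, n2, n3⟩ := hcon
  obtain ⟨k3, k3'⟩ := cross_zero x0 x1 x2 y0 y1 y2 r t hx hy hr ht hr2 ht2 a1 a2 b0 b2
  obtain ⟨k1, k1'⟩ := cross_zero y1 y2 y0 z1 z2 z0 t q (by linarith) (by linarith) ht hq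
    (by linarith) (by linarith) b2 b0 c1 c0
  obtain ⟨k2, k2'⟩ := cross_zero z2 z0 z1 x2 x0 x1 q r (by linarith) (by linarith) hq hr
    (by linarith) (by linarith) c0 c1 a2 a1
  have k1p : 0 < y1 * z2 - y2 * z1 := lt_of_le_of_ne k1 fun h => by linarith [k1' h.symm]
  have k2p : 0 < z2 * x0 - z0 * x2 := lt_of_le_of_ne k2 fun h => by linarith [k2' h.symm]
  have k3p : 0 < x0 * y1 - x1 * y0 := lt_of_le_of_ne k3 fun h => by linarith [k3' h.symm]
  set a := y1 * z2 - y2 * z1 with ha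
  set b := z2 * x0 - z0 * x2 with hb
  set c := x0 * y1 - x1 * y0 with hc
  have w0 : a * x0 + b * y0 + c * z0 = 0 := by
    rw [ha, hb, hc]
    obtain rfl : x2 = -x0-x1 := by linarith
    obtain rfl : y2 = -y0-y1 := by linarith
    obtain rfl : z2 = -z0-z1 := by linarith
    ring
  have w1 : a * x1 + b * y1 + c * z1 = 0 := by
    rw [ha, hb, hc]
    obtain rfl : x2 = -x0-x1 := by linarith
    obtain rfl : y2 = -y0-y1 := by linarith
    obtain rfl : z2 = -z0-z1 := by linarith
    ring
  have w2 : a * x2 + b * y2 + c * z2 = 0 := by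
    obtain rfl : x2 = -x0-x1 := by linarith
    obtain rfl : y2 = -y0-y1 := by linarith
    obtain rfl : z2 = -z0-z1 := by linarith
    linarith
  clear_value a b c
  clear k1' k2' k3' ha hb hc
  have tot : (a * r) ^ 2 + (b * t) ^ 2 + (c * q) ^ 2 + 2 * (a * b) * (x0 * y0 + x1 * y1 + x2 * y2)
      + 2 * (a * c) * (x0 * z0 + x1 * z1 + x2 * z2)
      + 2 * (b * c) * (y0 * z0 + y1 * z1 + y2 * z2) = 0 := by
    simp only [mul_pow, hr2, ht2, hq2]
    linear_combination (a * x0 + b * y0 + c * z0) * w0 + (a * x1 + b * y1 + c * z1) * w1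
      + (a * x2 + b * y2 + c * z2) * w2
  have m1 := mul_lt_mul_of_pos_left n1 (mul_pos k1p k2p)
  have m2 := mul_lt_mul_of_pos_left n2 (mul_pos k1p k3p)
  have m3 := mul_lt_mul_of_pos_left n3 (mul_pos k2p k3p)
  clear w0 w1 w2
  generalize x0 * y0 + x1 * y1 + x2 * y2 = A at *
  generalize x0 * z0 + x1 * z1 + x2 * z2 = B at *
  generalize y0 * z0 + y1 * z1 + y2 * z2 = C at *
  linarith [sq_nonneg (a * r - b * t), sq_nonneg (a * r - c * q), sq_nonneg (b * t - c * q)]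

theorem angle_of_inner (x o y : EuclideanSpace ℝ (Fin 2))
    (h : inner ℝ (x - o) (y - o) ≤ -(1 / 2) * (‖x - o‖ * ‖y - o‖)) :
    (o = x ∨ o = y) ∨ 2 * Real.pi / 3 ≤ EuclideanGeometry.angle x o y := by
  by_cases hx : o = x
  · exact Or.inl (Or.inl hx)
  by_cases hy : o = y
  · exact Or.inl (Or.inr hy)
  right
  have h1 : 0 < ‖x - o‖ := norm_pos_iff.2 (sub_ne_zero.2 (Ne.symm hx))
  have h2 : 0 < ‖y - o‖ := norm_pos_iff.2 (sub_ne_zero.2 (Ne.symm hy))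
  have h3 : Real.arccos (-(1 / 2)) = 2 * Real.pi / 3 := by
    rw [Real.arccos_neg, ← Real.cos_pi_div_three, Real.arccos_cos (by positivity)
      (by linarith [Real.pi_pos])]
    ring
  rw [← h3]
  unfold EuclideanGeometry.angle InnerProductGeometry.angle
  apply Real.arccos_le_arccos
  simp only [vsub_eq_sub]
  rw [div_le_iff₀ (mul_pos h1 h2)]
  exact h

theorem inner_of_coords (c s h : ℝ) (hcs : c ^ 2 + s ^ 2 = 1) (hh : h ^ 2 = 3)
    (v w : EuclideanSpace ℝ (Fin 2)) (a0 a1 a2 b0 b1 b2 : ℝ)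
    (ha : a0 + a1 + a2 = 0) (hb : b0 + b1 + b2 = 0)
    (va : c * v 0 + s * v 1 = a0) (va' : h * (c * v 1 - s * v 0) = a1 - a2)
    (wb : c * w 0 + s * w 1 = b0) (wb' : h * (c * w 1 - s * w 0) = b1 - b2) :
    inner ℝ v w = 2 / 3 * (a0 * b0 + a1 * b1 + a2 * b2) := by
  have e : inner ℝ v w = v 0 * w 0 + v 1 * w 1 := by
    simp [EuclideanSpace.inner_eq_star_dotProduct, dotProduct, Fin.sum_univ_two, mul_comm]
  have e1 : (c ^ 2 + s ^ 2) * (v 0 * w 0 + v 1 * w 1) =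
    (c * v 0 + s * v 1) * (c * w 0 + s * w 1) + (c * v 1 - s * v 0) * (c * w 1 - s * w 0) := by
    ring
  have e2 : h ^ 2 * ((c * v 1 - s * v 0) * (c * w 1 - s * w 0)) = (a1 - a2) * (b1 - b2) := by
    rw [← va', ← wb']; ring
  rw [hcs, one_mul, va, wb] at e1
  rw [hh] at e2
  rw [e, e1]
  obtain rfl : a0 = -a1 - a2 := by linarith
  obtain rfl : b0 = -b1 - b2 := by linarith
  linarith

/-- Three concurrent halving lines at mutual angle 60 degrees. -/
theorem exists_concurrent {ι : Type*} [Fintype ι] (n : ℕ) (hn : 0 < n)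
    (hc : Fintype.card ι = 2 * n) (p : ι → EuclideanSpace ℝ (Fin 2)) :
    ∃ (o : EuclideanSpace ℝ (Fin 2)) (a0 a1 a2 : ι → ℝ) (s0 s1 s2 : ι → ℤ),
      (∀ i, a0 i + a1 i + a2 i = 0) ∧
      (∀ i k, inner ℝ (p i - o) (p k - o) =
        2 / 3 * (a0 i * a0 k + a1 i * a1 k + a2 i * a2 k)) ∧
      (∀ i, s0 i = 1 ∨ s0 i = -1) ∧ (∀ i, s1 i = 1 ∨ s1 i = -1) ∧ (∀ i, s2 i = 1 ∨ s2 i = -1) ∧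
      ∑ i, s0 i = 0 ∧ ∑ i, s1 i = 0 ∧ ∑ i, s2 i = 0 ∧
      (∀ i, 0 ≤ s0 i * a0 i) ∧ (∀ i, 0 ≤ s1 i * a1 i) ∧ (∀ i, 0 ≤ s2 i * a2 i) := by
  obtain ⟨m, mc, modd, ms⟩ := exists_median (ι := ι) n hn hc
  obtain ⟨h, hh0, hh⟩ : ∃ h : ℝ, h ≠ 0 ∧ h ^ 2 = 3 :=
    ⟨√3, by positivity, Real.sq_sqrt (by norm_num)⟩
  let Y0 : ℝ → ι → ℝ := fun θ i => Real.cos θ * p i 0 + Real.sin θ * p i 1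
  let Y1 : ℝ → ι → ℝ := fun θ i => -(1 / 2) * (Real.cos θ * p i 0 + Real.sin θ * p i 1)
    + h / 2 * (Real.cos θ * p i 1 - Real.sin θ * p i 0)
  let Y2 : ℝ → ι → ℝ := fun θ i => -(1 / 2) * (Real.cos θ * p i 0 + Real.sin θ * p i 1)
    - h / 2 * (Real.cos θ * p i 1 - Real.sin θ * p i 0)
  have cY0 : Continuous Y0 := by fun_prop
  have cY1 : Continuous Y1 := by fun_prop
  have cY2 : Continuous Y2 := by fun_prop
  have n0 : Y0 Real.pi = - Y0 0 := by ext i; simp [Y0]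
  have n1 : Y1 Real.pi = - Y1 0 := by ext i; simp [Y1]; ring
  have n2 : Y2 Real.pi = - Y2 0 := by ext i; simp [Y2]; ring
  let f : ℝ → ℝ := fun θ => m (Y0 θ) + m (Y1 θ) + m (Y2 θ)
  have cf : Continuous f := by fun_prop
  have nf : f Real.pi = - f 0 := by simp only [f, n0, n1, n2, modd]; ring
  obtain ⟨θ, hθ⟩ : ∃ θ, f θ = 0 := by
    rcases le_total (f 0) 0 with h | h
    · obtain ⟨θ, hθ⟩ := intermediate_value_univ (f := f) 0 Real.pi cf
        (show (0 : ℝ) ∈ Set.Icc (f 0) (f Real.pi) from ⟨h, by linarith⟩)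
      exact ⟨θ, hθ⟩
    · obtain ⟨θ, hθ⟩ := intermediate_value_univ (f := f) Real.pi 0 cf
        (show (0 : ℝ) ∈ Set.Icc (f Real.pi) (f 0) from ⟨by linarith, h⟩)
      exact ⟨θ, hθ⟩
  obtain ⟨s0, s0a, s0b, s0c⟩ := ms (Y0 θ)
  obtain ⟨s1, s1a, s1b, s1c⟩ := ms (Y1 θ)
  obtain ⟨s2, s2a, s2b, s2c⟩ := ms (Y2 θ)
  have hm : m (Y0 θ) + m (Y1 θ) + m (Y2 θ) = 0 := hθ
  have hcs := Real.cos_sq_add_sin_sq θ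
  have hsum : ∀ i, (Y0 θ i - m (Y0 θ)) + (Y1 θ i - m (Y1 θ)) + (Y2 θ i - m (Y2 θ)) = 0 := by
    intro i; simp only [Y0, Y1, Y2] at hm ⊢; linarith
  generalize m (Y0 θ) = m0 at *
  generalize m (Y1 θ) = m1 at *
  generalize m (Y2 θ) = m2 at *
  let o : EuclideanSpace ℝ (Fin 2) := !₂[Real.cos θ * m0 - Real.sin θ * ((m1 - m2) / h),
    Real.sin θ * m0 + Real.cos θ * ((m1 - m2) / h)]
  have o0 : o 0 = Real.cos θ * m0 - Real.sin θ * ((m1 - m2) / h) := rfl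
  have o1 : o 1 = Real.sin θ * m0 + Real.cos θ * ((m1 - m2) / h) := rfl
  have g0 : ∀ i, Real.cos θ * (p i - o) 0 + Real.sin θ * (p i - o) 1 = Y0 θ i - m0 := by
    intro i
    simp only [PiLp.sub_apply, o0, o1, Y0]
    linear_combination (-m0) * hcs
  have g1 : ∀ i, h * (Real.cos θ * (p i - o) 1 - Real.sin θ * (p i - o) 0)
      = (Y1 θ i - m1) - (Y2 θ i - m2) := by
    intro i
    have hd : h * ((m1 - m2) / h) = m1 - m2 := by field_simp
    simp only [PiLp.sub_apply, o0, o1, Y1, Y2]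
    linear_combination (-(h * ((m1 - m2) / h))) * hcs - hd
  exact ⟨o, fun i => Y0 θ i - m0, fun i => Y1 θ i - m1, fun i => Y2 θ i - m2, s0, s1, s2, hsum,
    fun i k => inner_of_coords _ _ h hcs hh _ _ _ _ _ _ _ _ (hsum i) (hsum k) (g0 i) (g1 i)
      (g0 k) (g1 k), s0a, s1a, s2a, s0b, s1b, s2b, s0c, s1c, s2c⟩

theorem matching_aux {ι : Type*} [Fintype ι] [DecidableEq ι] (n : ℕ) (hn : 0 < n)
    (hc : Fintype.card ι = 2 * n) (p : ι → EuclideanSpace ℝ (Fin 2)) :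
    ∃ (o : EuclideanSpace ℝ (Fin 2)) (l : List (ι × ι)), l.length = n ∧
      (∀ x, ∃ q ∈ l, x = q.1 ∨ x = q.2) ∧
      ∀ q ∈ l, inner ℝ (p q.1 - o) (p q.2 - o) ≤ -(1 / 2) * (‖p q.1 - o‖ * ‖p q.2 - o‖) := by
  obtain ⟨o, a0, a1, a2, s0, s1, s2, ha, hin, t0, t1, t2, z0, z1, z2, d0, d1, d2⟩ :=
    exists_concurrent n hn hc p
  obtain ⟨h, hh0, hh⟩ : ∃ h : ℝ, 0 ≤ h ∧ h ^ 2 = 3 / 2 :=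
    ⟨√(3 / 2), by positivity, Real.sq_sqrt (by norm_num)⟩
  let r : ι → ℝ := fun i => h * ‖p i - o‖
  have r0 : ∀ i, 0 ≤ r i := fun i => by positivity
  have r2 : ∀ i, r i ^ 2 = a0 i ^ 2 + a1 i ^ 2 + a2 i ^ 2 := by
    intro i
    have := hin i i
    rw [real_inner_self_eq_norm_sq] at this
    simp only [r, mul_pow, hh, this]
    ring
  let R : ι → ι → Prop := fun i k =>
    a0 i * a0 k + a1 i * a1 k + a2 i * a2 k ≤ -(1 / 2) * (r i * r k)
  have Rin : ∀ i k, R i k →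
      inner ℝ (p i - o) (p k - o) ≤ -(1 / 2) * (‖p i - o‖ * ‖p k - o‖) := by
    intro i k hR
    rw [hin]
    have e : r i * r k = 3 / 2 * (‖p i - o‖ * ‖p k - o‖) := by
      rw [← hh]; simp only [r]; ring
    simp only [R] at hR
    rw [e] at hR
    linarith
  have H1 : ∀ x y, s0 x = - s0 y → s1 x = - s1 y → s2 x = - s2 y → R x y := by
    intro x y g0 g1 g2
    have k0 := d0 y
    have k1 := d1 y
    have k2 := d2 y
    refine opp_all _ _ _ _ _ _ _ _ (s0 x) (s1 x) (s2 x) (ha x) (ha y) (r0 x) (r0 y) (r2 x) (r2 y)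
      (t0 x) (t1 x) (t2 x) (d0 x) (d1 x) (d2 x) ?_ ?_ ?_
    · rw [g0]; push_cast; linarith
    · rw [g1]; push_cast; linarith
    · rw [g2]; push_cast; linarith
  have Z : ∀ i, (a0 i = 0 ∧ a1 i = 0 ∧ a2 i = 0 ∧ r i = 0) → ∀ k, R i k := by
    rintro i ⟨e0, e1, e2, e3⟩ k
    simp [R, e0, e1, e2, e3]
  have H2 : ∀ e : ℤ, (e = 1 ∨ e = -1) → ∀ a b c d,
      (s0 a = e ∧ s1 a = e ∧ s2 a = e) → (s0 b = e ∧ s1 b = -e ∧ s2 b = -e) →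
      (s0 c = -e ∧ s1 c = e ∧ s2 c = -e) → (s0 d = -e ∧ s1 d = -e ∧ s2 d = e) →
      (R a b ∧ R c d) ∨ (R a c ∧ R b d) ∨ (R a d ∧ R b c) := by
    intro e he a b c d ⟨ea0, ea1, ea2⟩ ⟨eb0, eb1, eb2⟩ ⟨ec0, ec1, ec2⟩ ⟨ed0, ed1, ed2⟩
    have ka0 := d0 a
    have ka1 := d1 a
    have ka2 := d2 a
    have kb1 := d1 b
    have kb2 := d2 b
    have kc0 := d0 c
    have kc2 := d2 c
    have kd0 := d0 d
    have kd1 := d1 d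
    have sa := ha a
    have sb := ha b
    have sc := ha c
    have sd := ha d
    rw [ea0] at ka0
    rw [ea1] at ka1
    rw [ea2] at ka2
    rw [eb1] at kb1
    rw [eb2] at kb2
    rw [ec0] at kc0
    rw [ec2] at kc2
    rw [ed0] at kd0
    rw [ed1] at kd1
    have main : (∀ k, R a k) ∧ (R b c ∨ R b d ∨ R c d) := by
      rcases he with rfl | rfl <;> push_cast at ka0 ka1 ka2 kb1 kb2 kc0 kc2 kd0 kd1
      · refine ⟨Z a (same_alg _ _ _ _ sa (r2 a) (by linarith) (by linarith) (by linarith)), ?_⟩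
        exact triple_alg _ _ _ _ _ _ _ _ _ _ _ _ sb sc sd (r0 b) (r0 c) (r0 d) (r2 b) (r2 c) (r2 d)
          (by linarith) (by linarith) (by linarith) (by linarith) (by linarith) (by linarith)
      · constructor
        · have := same_alg (-a0 a) (-a1 a) (-a2 a) (r a) (by linarith) (by rw [r2]; ring)
            (by linarith) (by linarith) (by linarith)
          simp only [neg_eq_zero] at this
          exact Z a this
        · have := triple_alg (-a0 b) (-a1 b) (-a2 b) (-a0 c) (-a1 c) (-a2 c) (-a0 d) (-a1 d) (-a2 d)
            (r b) (r c) (r d) (by linarith) (by linarith) (by linarith) (r0 b) (r0 c) (r0 d)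
            (by rw [r2]; ring) (by rw [r2]; ring) (by rw [r2]; ring)
            (by linarith) (by linarith) (by linarith) (by linarith) (by linarith) (by linarith)
          simpa only [neg_mul_neg] using this
    obtain ⟨ma, m1 | m1 | m1⟩ := main
    · exact Or.inr (Or.inr ⟨ma d, m1⟩)
    · exact Or.inr (Or.inl ⟨ma c, m1⟩)
    · exact Or.inl ⟨ma b, m1⟩
  obtain ⟨l, l1, l2, l3⟩ := comb R s0 s1 s2 t0 t1 t2 H1 H2 Finset.univ z0 z1 z2
  refine ⟨o, l, ?_, fun x => l2 x (Finset.mem_univ x), fun q hq => Rin _ _ (l3 q hq)⟩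
  rw [Finset.card_univ, hc] at l1
  omega

/-- Fekete–Meijer / Dumitrescu–Pach–Tóth: for any 2n points in the plane
(given as `p : Fin n ⊕ Fin n → ℝ²`), there is a perfect matching of the points
(encoded by a permutation `σ` of the 2n point slots, matching `p (σ (inl i))` with
`p (σ (inr i))`) and a point `o` such that for every matched pair `x y`, either
`o ∈ {x, y}` or the angle `∠ x o y` is at least `2π/3`. -/
theorem exists_matching_wide_angles (n : ℕ) (p : Fin n ⊕ Fin n → EuclideanSpace ℝ (Fin 2)) :
    ∃ (σ : Equiv.Perm (Fin n ⊕ Fin n)) (o : EuclideanSpace ℝ (Fin 2)),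
      ∀ i : Fin n,
        (o = p (σ (Sum.inl i)) ∨ o = p (σ (Sum.inr i))) ∨
          2 * Real.pi / 3 ≤ EuclideanGeometry.angle (p (σ (Sum.inl i))) o (p (σ (Sum.inr i))) := by
  rcases Nat.eq_zero_or_pos n with rfl | hn
  · exact ⟨Equiv.refl _, 0, fun i => i.elim0⟩
  obtain ⟨o, l, hl, hcov, hR⟩ := matching_aux n hn (by simp; ring) p
  let g : Fin n ⊕ Fin n → Fin n ⊕ Fin n :=
    Sum.elim (fun i => (l.get (i.cast hl.symm)).1) (fun i => (l.get (i.cast hl.symm)).2)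
  have hg : Function.Surjective g := by
    intro x
    obtain ⟨q, hq, hx⟩ := hcov x
    obtain ⟨i, rfl⟩ := List.get_of_mem hq
    rcases hx with hx | hx
    · exact ⟨Sum.inl (i.cast hl), hx.symm⟩
    · exact ⟨Sum.inr (i.cast hl), hx.symm⟩
  refine ⟨Equiv.ofBijective g (Finite.injective_iff_surjective.2 hg |> fun h => ⟨h, hg⟩), o, ?_⟩
  intro i
  exact angle_of_inner _ _ _ (hR _ (List.get_mem l (i.cast hl.symm)))
end
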